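/- Let f : ℝⁿ → ℝ be C¹, nonnegative, not identically zero, with compact support, c := max_{ℝⁿ} f > 0, and U := {x : f(x) = c}; assume U contains a closed ball of radius n-1, and that U = ⋃_{i∈I} E_i where each E_i is a closed set with nonempty interior of the form E_i = {ρ_i ≤ 0} for some C² function ρ_i with Dρ_i ≠ 0 and div(Dρ_i/|Dρ_i|) ≥ -1 on ∂E_i = {ρ_i = 0}. Let u : ℝⁿ × [0,∞) → ℝ be continuous, bounded and uniformly continuous on ℝⁿ × [0,T] for every T > 0, with u(·,0) = 0, and a viscosity solution of u_t - (div(Du/|Du|)+1)|Du| = f(x) in ℝⁿ × (0,∞). Then there exists a continuous function v_∞ : ℝⁿ → ℝ which is a viscosity solution of -(div(Dv/|Dv|)+1)|Dv| = f(x) - c in ℝⁿ, such that u(x,t) - c·t → v_∞(x) locally uniformly in x ∈ ℝⁿ as t → ∞. -/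

import Mathlib

open Set Filter Topology
open scoped RealInnerProductSpace

noncomputable section

/-- The trace of a continuous linear endomorphism of `ℝⁿ`. -/
def clmTrace {n : ℕ} (A : EuclideanSpace ℝ (Fin n) →L[ℝ] EuclideanSpace ℝ (Fin n)) : ℝ :=
  LinearMap.trace ℝ (EuclideanSpace ℝ (Fin n)) A.toLinearMap

/-- The (spatial) Hessian of `φ : ℝⁿ → ℝ` at `x`, as the derivative of the gradient. -/
def hess {n : ℕ} (φ : EuclideanSpace ℝ (Fin n) → ℝ) (x : EuclideanSpace ℝ (Fin n)) :
    EuclideanSpace ℝ (Fin n) →L[ℝ] EuclideanSpace ℝ (Fin n) :=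
  fderiv ℝ (gradient φ) x

/-- `tr((I - η⊗η) D²φ(x))` for a continuous linear map `A = D²φ(x)` and `η ∈ ℝⁿ`. -/
def trProj {n : ℕ} (A : EuclideanSpace ℝ (Fin n) →L[ℝ] EuclideanSpace ℝ (Fin n))
    (η : EuclideanSpace ℝ (Fin n)) : ℝ :=
  clmTrace A - ⟪A η, η⟫

/-- `v` is a viscosity subsolution of the stationary level-set equation
`-(div(Dv/|Dv|)+1)|Dv| = g(x)` on the open set `O ⊆ ℝⁿ`.  When the gradient of
the test function does not vanish one uses `η = Dφ/|Dφ|`, noting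
`div(Dφ/|Dφ|)·|Dφ| = tr((I - η⊗η) D²φ)`; when it vanishes, some `η` with `|η| ≤ 1`. -/
def StatSubsol {n : ℕ} (g : EuclideanSpace ℝ (Fin n) → ℝ) (O : Set (EuclideanSpace ℝ (Fin n)))
    (v : EuclideanSpace ℝ (Fin n) → ℝ) : Prop :=
  ∀ φ : EuclideanSpace ℝ (Fin n) → ℝ, ContDiff ℝ 2 φ →
    ∀ x₀ ∈ O, IsLocalMax (fun x => v x - φ x) x₀ →
      (gradient φ x₀ ≠ 0 →
        -(trProj (hess φ x₀) (‖gradient φ x₀‖⁻¹ • gradient φ x₀) + ‖gradient φ x₀‖) ≤ g x₀) ∧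
      (gradient φ x₀ = 0 →
        ∃ η : EuclideanSpace ℝ (Fin n), ‖η‖ ≤ 1 ∧ -(trProj (hess φ x₀) η) ≤ g x₀)

/-- Viscosity supersolution of the stationary level-set equation
`-(div(Dv/|Dv|)+1)|Dv| = g(x)` on the open set `O ⊆ ℝⁿ`. -/
def StatSupersol {n : ℕ} (g : EuclideanSpace ℝ (Fin n) → ℝ) (O : Set (EuclideanSpace ℝ (Fin n)))
    (v : EuclideanSpace ℝ (Fin n) → ℝ) : Prop :=
  ∀ φ : EuclideanSpace ℝ (Fin n) → ℝ, ContDiff ℝ 2 φ →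
    ∀ x₀ ∈ O, IsLocalMin (fun x => v x - φ x) x₀ →
      (gradient φ x₀ ≠ 0 →
        -(trProj (hess φ x₀) (‖gradient φ x₀‖⁻¹ • gradient φ x₀) + ‖gradient φ x₀‖) ≥ g x₀) ∧
      (gradient φ x₀ = 0 →
        ∃ η : EuclideanSpace ℝ (Fin n), ‖η‖ ≤ 1 ∧ -(trProj (hess φ x₀) η) ≥ g x₀)

/-- Spatial gradient of a space-time test function. -/
def sGrad {n : ℕ} (φ : EuclideanSpace ℝ (Fin n) → ℝ → ℝ) (x : EuclideanSpace ℝ (Fin n))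
    (t : ℝ) : EuclideanSpace ℝ (Fin n) :=
  gradient (fun y => φ y t) x

/-- Spatial Hessian of a space-time test function. -/
def sHess {n : ℕ} (φ : EuclideanSpace ℝ (Fin n) → ℝ → ℝ) (x : EuclideanSpace ℝ (Fin n))
    (t : ℝ) : EuclideanSpace ℝ (Fin n) →L[ℝ] EuclideanSpace ℝ (Fin n) :=
  fderiv ℝ (fun y => gradient (fun z => φ z t) y) x

/-- Time derivative of a space-time test function. -/
def tDeriv {n : ℕ} (φ : EuclideanSpace ℝ (Fin n) → ℝ → ℝ) (x : EuclideanSpace ℝ (Fin n))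
    (t : ℝ) : ℝ :=
  deriv (fun s => φ x s) t

/-- `u` is a viscosity subsolution of the level-set equation
`u_t - (div(Du/|Du|)+1)|Du| = f(x)` in `O × (0,∞)`: at any local maximum `(x₀,t₀)`,
`t₀ > 0`, `x₀ ∈ O`, of `u - φ` with `φ` C², the subsolution inequality holds, where
`(div(D_xφ/|D_xφ|)+1)|D_xφ| = tr((I - η⊗η) D_x²φ) + |D_xφ|` with `η = D_xφ/|D_xφ|`
if `D_xφ ≠ 0`, and with some `η`, `|η| ≤ 1`, and no `|D_xφ|` term if `D_xφ = 0`. -/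
def ParabSubsol {n : ℕ} (f : EuclideanSpace ℝ (Fin n) → ℝ) (O : Set (EuclideanSpace ℝ (Fin n)))
    (u : EuclideanSpace ℝ (Fin n) → ℝ → ℝ) : Prop :=
  ∀ φ : EuclideanSpace ℝ (Fin n) → ℝ → ℝ,
    ContDiff ℝ 2 (fun p : EuclideanSpace ℝ (Fin n) × ℝ => φ p.1 p.2) →
    ∀ x₀ ∈ O, ∀ t₀ : ℝ, 0 < t₀ →
      IsLocalMax (fun p : EuclideanSpace ℝ (Fin n) × ℝ => u p.1 p.2 - φ p.1 p.2) (x₀, t₀) →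
        (sGrad φ x₀ t₀ ≠ 0 →
          tDeriv φ x₀ t₀ -
            (trProj (sHess φ x₀ t₀) (‖sGrad φ x₀ t₀‖⁻¹ • sGrad φ x₀ t₀) + ‖sGrad φ x₀ t₀‖)
            ≤ f x₀) ∧
        (sGrad φ x₀ t₀ = 0 →
          ∃ η : EuclideanSpace ℝ (Fin n), ‖η‖ ≤ 1 ∧
            tDeriv φ x₀ t₀ - trProj (sHess φ x₀ t₀) η ≤ f x₀)

/-- Viscosity supersolution of the level-set equation
`u_t - (div(Du/|Du|)+1)|Du| = f(x)` in `O × (0,∞)`. -/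
def ParabSupersol {n : ℕ} (f : EuclideanSpace ℝ (Fin n) → ℝ) (O : Set (EuclideanSpace ℝ (Fin n)))
    (u : EuclideanSpace ℝ (Fin n) → ℝ → ℝ) : Prop :=
  ∀ φ : EuclideanSpace ℝ (Fin n) → ℝ → ℝ,
    ContDiff ℝ 2 (fun p : EuclideanSpace ℝ (Fin n) × ℝ => φ p.1 p.2) →
    ∀ x₀ ∈ O, ∀ t₀ : ℝ, 0 < t₀ →
      IsLocalMin (fun p : EuclideanSpace ℝ (Fin n) × ℝ => u p.1 p.2 - φ p.1 p.2) (x₀, t₀) →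
        (sGrad φ x₀ t₀ ≠ 0 →
          tDeriv φ x₀ t₀ -
            (trProj (sHess φ x₀ t₀) (‖sGrad φ x₀ t₀‖⁻¹ • sGrad φ x₀ t₀) + ‖sGrad φ x₀ t₀‖)
            ≥ f x₀) ∧
        (sGrad φ x₀ t₀ = 0 →
          ∃ η : EuclideanSpace ℝ (Fin n), ‖η‖ ≤ 1 ∧
            tDeriv φ x₀ t₀ - trProj (sHess φ x₀ t₀) η ≥ f x₀)

end

set_option linter.unusedSectionVars false
open Set Filter Topology
open scoped RealInnerProductSpace

namespace VS

section Alex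

variable {H : Type} [NormedAddCommGroup H] [InnerProductSpace ℝ H] [FiniteDimensional ℝ H]

/-- subgradient -/
def Sub (G : H → ℝ) (z p : H) : Prop := ∀ y, G z + ⟪p, y - z⟫ ≤ G y

lemma Sub.mono {G : H → ℝ} {z p z' p' : H} (h : Sub G z p) (h' : Sub G z' p') :
    0 ≤ ⟪p - p', z - z'⟫ := by
  have h1 := h z'
  have h2 := h' z
  simp only [inner_sub_left, inner_sub_right] at *
  linarith

lemma convex_of_sub {G : H → ℝ} (hG : ∀ z, ∃ p, Sub G z p) : ConvexOn ℝ univ G := by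
  refine ⟨convex_univ, ?_⟩
  intro x _ y _ a b ha hb hab
  obtain ⟨p, hp⟩ := hG (a • x + b • y)
  have h1 := hp x
  have h2 := hp y
  have e : a * ⟪p, x - (a • x + b • y)⟫ + b * ⟪p, y - (a • x + b • y)⟫ = 0 := by
    simp only [inner_sub_right, inner_add_right, inner_smul_right]
    have : a = 1 - b := by linarith
    subst this; ring
  have h3 := mul_le_mul_of_nonneg_left h1 ha
  have h4 := mul_le_mul_of_nonneg_left h2 hb
  simp only [smul_eq_mul]
  have : G (a • x + b • y) = a * G (a • x + b • y) + b * G (a • x + b • y) := by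
    rw [← add_mul, hab, one_mul]
  linarith

lemma cont_of_sub {G : H → ℝ} (hG : ∀ z, ∃ p, Sub G z p) : Continuous G := by
  have := (convex_of_sub hG).continuousOn isOpen_univ
  exact continuousOn_univ.mp this

lemma exists_prox {G : H → ℝ} (hG : ∀ z, ∃ p, Sub G z p) (y : H) : ∃ z, Sub G z (y - z) := by
  have hc := cont_of_sub hG
  obtain ⟨p, hp⟩ := hG y
  have hF : Continuous (fun z => G z + ‖z - y‖ ^ 2 / 2) := by fun_prop
  have hcoer : Tendsto (fun z => G z + ‖z - y‖ ^ 2 / 2) (cocompact H) atTop := by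
    have h1 : Tendsto (fun z : H => ‖z - y‖) (cocompact H) atTop := by
      have := tendsto_norm_cocompact_atTop (E := H)
      refine tendsto_atTop_mono (f := fun z => ‖z‖ - ‖y‖) (fun z => ?_) ?_
      · exact norm_sub_norm_le z y
      · exact tendsto_atTop_add_const_right _ _ this
    have h2 : Tendsto (fun z : H => G y - ‖p‖ ^ 2 - ‖y‖ * 0 + ‖z - y‖ * (1/4 * ‖z - y‖)) (cocompact H) atTop := by
      apply tendsto_atTop_add_const_left
      exact h1.atTop_mul_atTop₀ (h1.const_mul_atTop (by norm_num))
    refine tendsto_atTop_mono (fun z => ?_) h2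
    have h3 := hp z
    have h4 : -(‖p‖ * ‖z - y‖) ≤ ⟪p, z - y⟫ := by
      have := abs_real_inner_le_norm p (z - y)
      linarith [neg_abs_le ⟪p, z - y⟫]
    nlinarith [sq_nonneg (‖p‖ - ‖z - y‖ / 2)]
  obtain ⟨z, hz⟩ := hF.exists_forall_le hcoer
  refine ⟨z, fun w => ?_⟩
  by_contra hcon
  push Not at hcon
  have key : ∀ s : ℝ, 0 < s → s ≤ 1 → G z + ⟪y - z, w - z⟫ ≤ G w + s / 2 * ‖w - z‖ ^ 2 := by
    intro s hs hs1
    have h1 := hz (z + s • (w - z))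
    have h2 := (convex_of_sub hG).2 (mem_univ z) (mem_univ w) (sub_nonneg.mpr hs1) hs.le (by ring)
    have e : (1 - s) • z + s • w = z + s • (w - z) := by module
    rw [e] at h2
    have e2 : ‖z + s • (w - z) - y‖ ^ 2 = ‖z - y‖ ^ 2 - 2 * s * ⟪y - z, w - z⟫ + s ^ 2 * ‖w - z‖ ^ 2 := by
      have : z + s • (w - z) - y = (z - y) + s • (w - z) := by abel
      rw [this, norm_add_sq_real, norm_smul, inner_smul_right, mul_pow, Real.norm_eq_abs, sq_abs]
      have : (z - y) = - (y - z) := by abel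
      rw [this, inner_neg_left, norm_neg]; ring
    simp only [e2, smul_eq_mul] at h1 h2
    have h3 : s * (G z + ⟪y - z, w - z⟫) ≤ s * (G w + s / 2 * ‖w - z‖ ^ 2) := by nlinarith
    exact le_of_mul_le_mul_left h3 hs
  have hlim : Tendsto (fun s : ℝ => G w + s / 2 * ‖w - z‖ ^ 2) (𝓝[>] 0) (𝓝 (G w + 0 / 2 * ‖w - z‖ ^ 2)) := by
    apply Tendsto.mono_left _ nhdsWithin_le_nhds
    apply Continuous.tendsto
    fun_prop
  have := ge_of_tendsto hlim (b := G z + ⟪y - z, w - z⟫) (by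
    filter_upwards [Ioc_mem_nhdsGT (zero_lt_one (α := ℝ))] with s hs
    exact key s hs.1 hs.2)
  simp only [zero_div, zero_mul, add_zero] at this
  linarith

/-- first order expansion of the subdifferential implies second order expansion -/
lemma second_order {G : H → ℝ} (hG : ∀ z, ∃ p, Sub G z p) {z p : H} {S : H →L[ℝ] H} {σ ρ : ℝ}
    (hS : ∀ h q, ‖h‖ ≤ ρ → Sub G (z + h) q → ‖q - p - S h‖ ≤ σ * ‖h‖) (hσ : 0 ≤ σ) (h : H) (hh : ‖h‖ ≤ ρ) :
    |G (z + h) - G z - ⟪p, h⟫ - 1 / 2 * ⟪S h, h⟫| ≤ σ * ‖h‖ ^ 2 := by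
  have hq : ∀ t : ℝ, 0 ≤ t → t ≤ 1 → ∀ q, Sub G (z + t • h) q →
      |⟪q, h⟫ - ⟪p, h⟫ - t * ⟪S h, h⟫| ≤ σ * ‖h‖ ^ 2 := by
    intro t ht ht1 q hq
    have hn : ‖t • h‖ = t * ‖h‖ := by rw [norm_smul, Real.norm_eq_abs, abs_of_nonneg ht]
    have hle : t * ‖h‖ ≤ ‖h‖ := by nlinarith [norm_nonneg h]
    have h1 := hS (t • h) q (by rw [hn]; linarith) hq
    have e : ⟪q, h⟫ - ⟪p, h⟫ - t * ⟪S h, h⟫ = ⟪q - p - S (t • h), h⟫ := by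
      rw [inner_sub_left, inner_sub_left, map_smul, inner_smul_left]; simp
    rw [e]
    refine (abs_real_inner_le_norm _ _).trans ?_
    rw [hn] at h1
    have : σ * (t * ‖h‖) ≤ σ * ‖h‖ := mul_le_mul_of_nonneg_left hle hσ
    nlinarith [norm_nonneg h]
  -- bounds along the partition
  have key : ∀ m : ℕ, 0 < m → ∀ k : ℕ, k ≤ m →
      G (z + ((k : ℝ) / m) • h) - G z ≤ (k : ℝ) / m * (⟪p, h⟫ + σ * ‖h‖ ^ 2) + (k : ℝ) * (k + 1) / (2 * m ^ 2) * ⟪S h, h⟫ ∧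
      (k : ℝ) / m * (⟪p, h⟫ - σ * ‖h‖ ^ 2) + (k : ℝ) * (k - 1) / (2 * m ^ 2) * ⟪S h, h⟫ ≤ G (z + ((k : ℝ) / m) • h) - G z := by
    intro m hm k
    have hm' : (0 : ℝ) < m := by exact_mod_cast hm
    induction k with
    | zero => intro _; simp
    | succ k ih =>
      intro hk
      obtain ⟨ih1, ih2⟩ := ih (by omega)
      have hk' : (k : ℝ) + 1 ≤ m := by exact_mod_cast hk
      obtain ⟨q0, hq0⟩ := hG (z + ((k : ℝ) / m) • h)
      obtain ⟨q1, hq1⟩ := hG (z + (((k : ℝ) + 1) / m) • h)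
      have b0 := abs_le.mp (hq _ (by positivity) (by rw [div_le_one hm']; linarith) q0 hq0)
      have b1 := abs_le.mp (hq _ (by positivity) (by rw [div_le_one hm']; linarith) q1 hq1)
      have s0 := hq0 (z + (((k : ℝ) + 1) / m) • h)
      have s1 := hq1 (z + ((k : ℝ) / m) • h)
      have e0 : z + (((k : ℝ) + 1) / m) • h - (z + ((k : ℝ) / m) • h) = (1 / (m : ℝ)) • h := by
        rw [add_div]; module
      have e1 : z + ((k : ℝ) / m) • h - (z + (((k : ℝ) + 1) / m) • h) = -((1 / (m : ℝ)) • h) := by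
        rw [add_div]; module
      rw [e0, inner_smul_right] at s0
      rw [e1, inner_neg_right, inner_smul_right] at s1
      push_cast
      have i0 : 0 ≤ 1 / (m : ℝ) := by positivity
      have c0 := mul_le_mul_of_nonneg_left b0.1 i0
      have c1 := mul_le_mul_of_nonneg_left b1.2 i0
      have f1 : ((k : ℝ) + 1) / m = k / m + 1 / m := by ring
      have f2 : ((k : ℝ) + 1) * (k + 1 + 1) / (2 * m ^ 2) = (k : ℝ) * (k + 1) / (2 * m ^ 2) + 1 / m * ((k + 1) / m) := by
        field_simp; ring
      have f3 : ((k : ℝ) + 1) * (k + 1 - 1) / (2 * m ^ 2) = (k : ℝ) * (k - 1) / (2 * m ^ 2) + 1 / m * (k / m) := by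
        field_simp; ring
      constructor
      · rw [f2]
        have : ((k : ℝ) + 1) / m * (⟪p, h⟫ + σ * ‖h‖ ^ 2) = k / m * (⟪p, h⟫ + σ * ‖h‖ ^ 2) + 1 / m * (⟪p, h⟫ + σ * ‖h‖ ^ 2) := by ring
        rw [this]
        nlinarith
      · rw [f3]
        have : ((k : ℝ) + 1) / m * (⟪p, h⟫ - σ * ‖h‖ ^ 2) = k / m * (⟪p, h⟫ - σ * ‖h‖ ^ 2) + 1 / m * (⟪p, h⟫ - σ * ‖h‖ ^ 2) := by ring
        rw [this]
        nlinarith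
  have hlim : Tendsto (fun m : ℕ => 1 / ((m : ℝ) + 1)) atTop (𝓝 0) := tendsto_one_div_add_atTop_nhds_zero_nat
  have up : G (z + h) - G z ≤ ⟪p, h⟫ + σ * ‖h‖ ^ 2 + 1 / 2 * ⟪S h, h⟫ + 0 * (1 / 2 * ⟪S h, h⟫) := by
    refine ge_of_tendsto ((hlim.mul_const (1 / 2 * ⟪S h, h⟫)).const_add (⟪p, h⟫ + σ * ‖h‖ ^ 2 + 1 / 2 * ⟪S h, h⟫)) ?_
    filter_upwards with m
    have := (key (m + 1) (by omega) (m + 1) le_rfl).1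
    have hm : ((m : ℝ) + 1) ≠ 0 := by positivity
    push_cast at this
    rw [div_self hm, one_smul] at this
    refine this.trans (le_of_eq ?_)
    field_simp; ring
  have lo : ⟪p, h⟫ - σ * ‖h‖ ^ 2 + 1 / 2 * ⟪S h, h⟫ + 0 * (-(1 / 2 * ⟪S h, h⟫)) ≤ G (z + h) - G z := by
    refine le_of_tendsto ((hlim.mul_const (-(1 / 2 * ⟪S h, h⟫))).const_add (⟪p, h⟫ - σ * ‖h‖ ^ 2 + 1 / 2 * ⟪S h, h⟫)) ?_
    filter_upwards with m
    have := (key (m + 1) (by omega) (m + 1) le_rfl).2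
    have hm : ((m : ℝ) + 1) ≠ 0 := by positivity
    push_cast at this
    rw [div_self hm, one_smul] at this
    refine le_trans (le_of_eq ?_) this
    field_simp; ring
  rw [abs_le]
  constructor <;> linarith

end Alex
end VS

open Set Filter Topology
open scoped RealInnerProductSpace
set_option linter.unusedSectionVars false
namespace VS
open MeasureTheory
section Alex

variable {H : Type} [NormedAddCommGroup H] [InnerProductSpace ℝ H] [FiniteDimensional ℝ H]

lemma prox_firm {G : H → ℝ} {J : H → H} (hJ : ∀ y, Sub G (J y) (y - J y)) (y y' : H) :
    ‖J y - J y'‖ ^ 2 ≤ ⟪J y - J y', y - y'⟫ := by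
  have h := (hJ y).mono (hJ y')
  have e : y - J y - (y' - J y') = (y - y') - (J y - J y') := by abel
  rw [e, inner_sub_left, real_inner_self_eq_norm_sq, real_inner_comm] at h
  linarith

lemma prox_unique {G : H → ℝ} {J : H → H} (hJ : ∀ y, Sub G (J y) (y - J y)) {z p : H} (h : Sub G z p) :
    J (z + p) = z := by
  have h1 := (hJ (z + p)).mono h
  have e : z + p - J (z + p) - p = -(J (z + p) - z) := by abel
  rw [e, inner_neg_left, real_inner_self_eq_norm_sq] at h1
  have : ‖J (z + p) - z‖ = 0 := by nlinarith [norm_nonneg (J (z + p) - z)]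
  exact sub_eq_zero.mp (norm_eq_zero.mp this)

lemma alex_point {G : H → ℝ} {J : H → H} (hJ : ∀ y, Sub G (J y) (y - J y)) {z p : H} (hp : Sub G z p)
    (hd : DifferentiableAt ℝ J (z + p)) (hdet : (fderiv ℝ J (z + p)).det ≠ 0) :
    ∃ S : H →L[ℝ] H, ∀ σ > 0, ∃ ρ > 0, ∀ h q, ‖h‖ ≤ ρ → Sub G (z + h) q → ‖q - p - S h‖ ≤ σ * ‖h‖ := by
  set y := z + p with hy
  set B := fderiv ℝ J y with hB
  set Be := B.toContinuousLinearEquivOfDetNeZero hdet with hBe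
  have hBe' : ∀ v, Be v = B v := fun v => rfl
  set Bi : H →L[ℝ] H := (Be.symm : H →L[ℝ] H) with hBi
  have hBB : ∀ v, Bi (B v) = v := fun v => by
    rw [← hBe']; exact Be.symm_apply_apply v
  refine ⟨Bi - ContinuousLinearMap.id ℝ H, fun σ hσ => ?_⟩
  set M := ‖Bi‖ + 1 with hM
  have hM0 : 0 < M := by positivity
  have hMv : ∀ v, ‖Bi v‖ ≤ M * ‖v‖ := fun v => (Bi.le_opNorm v).trans (by
    apply mul_le_mul_of_nonneg_right _ (norm_nonneg _); simp [hM])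
  have hBv : ∀ v, ‖v‖ ≤ M * ‖B v‖ := fun v => by
    have := hMv (B v); rwa [hBB] at this
  have hJy : J y = z := prox_unique hJ hp
  set τ := min (1 / (2 * M)) (σ / (2 * M ^ 2)) with hτ
  have hτ0 : 0 < τ := by positivity
  have hτ1 : τ * (2 * M) ≤ 1 := by
    have : τ ≤ 1 / (2 * M) := min_le_left _ _
    rwa [le_div_iff₀ (by positivity)] at this
  have hτ2 : τ * (2 * M ^ 2) ≤ σ := by
    have : τ ≤ σ / (2 * M ^ 2) := min_le_right _ _
    rwa [le_div_iff₀ (by positivity)] at this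
  have hdiff := hd.hasFDerivAt.isLittleO.def hτ0
  rw [← hB] at hdiff
  obtain ⟨r, hr0, hr⟩ := Metric.eventually_nhds_iff.mp hdiff
  have hr' : ∀ y', ‖y' - y‖ < r → ‖J y' - z - B (y' - y)‖ ≤ τ * ‖y' - y‖ := by
    intro y' hy'
    have := hr (y := y') (by rwa [dist_eq_norm])
    rwa [hJy] at this
  -- lower bound
  have hlow : ∀ y', ‖y' - y‖ < r → ‖y' - y‖ ≤ 2 * M * ‖J y' - z‖ := by
    intro y' hy'
    have h1 := hr' y' hy'
    have h2 := hBv (y' - y)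
    have h3 : ‖B (y' - y)‖ ≤ ‖J y' - z‖ + τ * ‖y' - y‖ := by
      have : B (y' - y) = (J y' - z) - (J y' - z - B (y' - y)) := by abel
      calc ‖B (y' - y)‖ = ‖(J y' - z) - (J y' - z - B (y' - y))‖ := by rw [← this]
        _ ≤ ‖J y' - z‖ + ‖J y' - z - B (y' - y)‖ := norm_sub_le _ _
        _ ≤ _ := by linarith
    have h4 : ‖y' - y‖ ≤ M * (‖J y' - z‖ + τ * ‖y' - y‖) := h2.trans (mul_le_mul_of_nonneg_left h3 hM0.le)
    have h5 : τ * (2 * M) * ‖y' - y‖ ≤ 1 * ‖y' - y‖ := mul_le_mul_of_nonneg_right hτ1 (norm_nonneg _)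
    nlinarith
  set r0 := r / 2 with hr0'
  have hr00 : 0 < r0 := by positivity
  refine ⟨r0 / (8 * M ^ 2), by positivity, fun h q hh hq => ?_⟩
  set y' := z + h + q with hy'
  have hJy' : J y' = z + h := prox_unique hJ hq
  -- y' is close
  have hclose : ‖y' - y‖ < r := by
    by_contra hcon
    push Not at hcon
    have hv0 : 0 < ‖y' - y‖ := by linarith
    set s := r0 / ‖y' - y‖ with hs
    have hs0 : 0 < s := by positivity
    have hs1 : s < 1 := by rw [hs, div_lt_one hv0]; linarith
    have hsv : s * ‖y' - y‖ = r0 := by rw [hs]; field_simp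
    set y2 := y + s • (y' - y) with hy2
    have e2 : y2 - y = s • (y' - y) := by rw [hy2]; abel
    have n2 : ‖y2 - y‖ = r0 := by rw [e2, norm_smul, Real.norm_eq_abs, abs_of_pos hs0, hsv]
    have l2 := hlow y2 (by rw [n2]; linarith)
    rw [n2] at l2
    have f1 := prox_firm hJ y2 y
    rw [hJy, e2, inner_smul_right] at f1
    have f2 := prox_firm hJ y' y2
    have e3 : y' - y2 = (1 - s) • (y' - y) := by rw [hy2]; module
    rw [e3, inner_smul_right, hJy'] at f2
    have f3 : 0 ≤ ⟪z + h - J y2, y' - y⟫ := by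
      have : 0 ≤ (1 - s) * ⟪z + h - J y2, y' - y⟫ := le_trans (by positivity) f2
      exact nonneg_of_mul_nonneg_right this (by linarith)
    have e4 : z + h - J y2 = h - (J y2 - z) := by abel
    rw [e4, inner_sub_left] at f3
    have f4 : ⟪h, y' - y⟫ ≤ ‖h‖ * ‖y' - y‖ := real_inner_le_norm _ _
    have f5 : ‖J y2 - z‖ ^ 2 ≤ s * (‖h‖ * ‖y' - y‖) := f1.trans (mul_le_mul_of_nonneg_left (by linarith) hs0.le)
    have f6 : s * (‖h‖ * ‖y' - y‖) = ‖h‖ * r0 := by rw [← hsv]; ring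
    rw [f6] at f5
    have f7 : r0 ^ 2 ≤ (2 * M * ‖J y2 - z‖) ^ 2 := pow_le_pow_left₀ hr00.le l2 2
    have f8 : r0 ^ 2 ≤ 4 * M ^ 2 * (‖h‖ * r0) := by nlinarith [sq_nonneg M]
    have f9 : r0 ≤ 4 * M ^ 2 * ‖h‖ := by
      have : r0 * r0 ≤ r0 * (4 * M ^ 2 * ‖h‖) := by nlinarith
      exact le_of_mul_le_mul_left this hr00
    rw [le_div_iff₀ (by positivity)] at hh
    nlinarith
  have g1 := hr' y' hclose
  have g2 := hlow y' hclose
  rw [hJy'] at g1 g2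
  have e5 : z + h - z = h := by abel
  rw [e5] at g1 g2
  have e6 : q - p - (Bi - ContinuousLinearMap.id ℝ H) h = -(Bi (h - B (y' - y))) := by
    rw [map_sub, hBB, hy', hy]; simp; abel
  rw [e6, norm_neg]
  refine (hMv _).trans ?_
  have g3 : M * ‖h - B (y' - y)‖ ≤ M * (τ * (2 * M * ‖h‖)) :=
    mul_le_mul_of_nonneg_left (g1.trans (mul_le_mul_of_nonneg_left g2 hτ0.le)) hM0.le
  have g4 : τ * (2 * M ^ 2) * ‖h‖ ≤ σ * ‖h‖ := mul_le_mul_of_nonneg_right hτ2 (norm_nonneg _)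
  nlinarith

/-- Second-order expansion. -/
def Exp2 (A : H → ℝ) (z p : H) (S : H →L[ℝ] H) : Prop :=
  ∀ σ > 0, ∃ ρ > 0, ∀ h, ‖h‖ ≤ ρ → |A (z + h) - A z - ⟪p, h⟫ - 1 / 2 * ⟪S h, h⟫| ≤ σ * ‖h‖ ^ 2

lemma alexandrov [MeasurableSpace H] [BorelSpace H] {G : H → ℝ} (hG : ∀ z, ∃ p, Sub G z p) :
    ∃ N : Set H, Measure.hausdorffMeasure (X := H) (Module.finrank ℝ H : ℝ) N = 0 ∧
      ∀ z ∉ N, ∃ p S, Exp2 G z p S := by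
  choose J hJ using exists_prox hG
  haveI := isAddHaarMeasure_hausdorffMeasure (E := H)
  set μ : Measure H := Measure.hausdorffMeasure (X := H) (Module.finrank ℝ H : ℝ) with hμ
  have hLip : LipschitzWith 1 J := by
    apply LipschitzWith.of_dist_le_mul
    intro y y'
    rw [dist_eq_norm, dist_eq_norm]
    have h1 := prox_firm hJ y y'
    have h2 := real_inner_le_norm (J y - J y') (y - y')
    by_contra hc
    push Not at hc
    simp only [NNReal.coe_one, one_mul] at hc
    nlinarith [norm_nonneg (y - y'), norm_nonneg (J y - J y')]
  have hae := hLip.ae_differentiableAt (μ := μ)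
  rw [ae_iff] at hae
  refine ⟨J '' {y | ¬ DifferentiableAt ℝ J y} ∪ J '' {y | DifferentiableAt ℝ J y ∧ (fderiv ℝ J y).det = 0}, ?_, ?_⟩
  · apply measure_union_null
    · have := (hLip.lipschitzOnWith (s := {y | ¬ DifferentiableAt ℝ J y})).hausdorffMeasure_image_le
        (d := (Module.finrank ℝ H : ℝ)) (by positivity)
      rw [← hμ] at this
      rw [hae, mul_zero] at this
      exact le_antisymm this zero_le
    · exact addHaar_image_eq_zero_of_det_fderivWithin_eq_zero μ (f' := fun y => fderiv ℝ J y)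
        (fun x hx => hx.1.hasFDerivAt.hasFDerivWithinAt) (fun x hx => hx.2)
  · intro z hz
    obtain ⟨p, hp⟩ := hG z
    have hJz := prox_unique hJ hp
    simp only [mem_union, not_or] at hz
    have hd : DifferentiableAt ℝ J (z + p) := by
      by_contra hc
      exact hz.1 ⟨z + p, hc, hJz⟩
    have hdet : (fderiv ℝ J (z + p)).det ≠ 0 := fun hc => hz.2 ⟨z + p, ⟨hd, hc⟩, hJz⟩
    obtain ⟨S, hS⟩ := alex_point hJ hp hd hdet
    refine ⟨p, S, fun σ hσ => ?_⟩
    obtain ⟨ρ, hρ, h⟩ := hS σ hσ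
    exact ⟨ρ, hρ, fun v hv => second_order hG h hσ.le v hv⟩

end Alex
end VS

open Set Filter Topology
open scoped RealInnerProductSpace
set_option linter.unusedSectionVars false
namespace VS
open MeasureTheory
section Jensen

variable {H : Type} [NormedAddCommGroup H] [InnerProductSpace ℝ H] [FiniteDimensional ℝ H]

lemma lin_zero {v : H} {C ρ : ℝ} (hρ : 0 < ρ) (h : ∀ x : H, ‖x‖ ≤ ρ → ⟪v, x⟫ ≤ C * ‖x‖ ^ 2) : v = 0 := by
  by_contra hv
  have hv0 : 0 < ‖v‖ := norm_pos_iff.mpr hv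
  set s := min (ρ / ‖v‖) (1 / (2 * (|C| + 1))) with hs
  have hs0 : 0 < s := by positivity
  have h1 : s * ‖v‖ ≤ ρ := by
    have : s ≤ ρ / ‖v‖ := min_le_left _ _
    rwa [le_div_iff₀ hv0] at this
  have h2 : s * (2 * (|C| + 1)) ≤ 1 := by
    have : s ≤ 1 / (2 * (|C| + 1)) := min_le_right _ _
    rwa [le_div_iff₀ (by positivity)] at this
  have hn : ‖s • v‖ = s * ‖v‖ := by rw [norm_smul, Real.norm_eq_abs, abs_of_pos hs0]
  have h3 := h (s • v) (by rw [hn]; exact h1)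
  rw [inner_smul_right, real_inner_self_eq_norm_sq, hn] at h3
  have h4 : C ≤ |C| := le_abs_self C
  have h5 : ‖v‖ ^ 2 ≤ C * s * ‖v‖ ^ 2 := by
    have : s * ‖v‖ ^ 2 ≤ s * (C * s * ‖v‖ ^ 2) := by nlinarith
    exact le_of_mul_le_mul_left this hs0
  have h6 : C * s ≤ 1 / 2 := by nlinarith
  nlinarith [pow_pos hv0 2]

lemma norm_shift (z h z1 : H) : ‖z + h - z1‖ ^ 2 = ‖z - z1‖ ^ 2 + 2 * ⟪z - z1, h⟫ + ‖h‖ ^ 2 := by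
  have : z + h - z1 = (z - z1) + h := by abel
  rw [this, norm_add_sq_real]

lemma jensen {A Ψ : H → ℝ} {Λ : ℝ} (hA : ∀ z, ∃ p, ∀ h, A z + ⟪p, h⟫ - Λ / 2 * ‖h‖ ^ 2 ≤ A (z + h))
    (hΨc : Continuous Ψ) (DΨ : H → H)
    (hΨ : ∀ R : ℝ, ∃ C : ℝ, ∀ z h, ‖z‖ ≤ R → ‖h‖ ≤ R → Ψ (z + h) ≤ Ψ z + ⟪DΨ z, h⟫ + C * ‖h‖ ^ 2)
    (M : ℝ) (hM : ∀ z, A z - Ψ z ≤ M) (z1 : H) (κ : ℝ) (hκ : 0 < κ) :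
    ∃ z e S, ‖e‖ ≤ κ ∧ A z1 - Ψ z1 - κ ≤ A z - Ψ z ∧
      (∀ h, A (z + h) - A z ≤ Ψ (z + h) - Ψ z + ⟪e, h⟫ + κ * ‖h‖ ^ 2) ∧ Exp2 A z (DΨ z + e) S ∧
      ∀ a b, ⟪S a, b⟫ = ⟪a, S b⟫ := by
  letI : MeasurableSpace H := borel H
  haveI : BorelSpace H := ⟨rfl⟩
  set G : H → ℝ := fun z => A z + Λ / 2 * ‖z‖ ^ 2 with hGdef
  have hG : ∀ z, ∃ p, Sub G z p := by
    intro z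
    obtain ⟨p, hp⟩ := hA z
    refine ⟨p + Λ • z, fun y => ?_⟩
    have h1 := hp (y - z)
    have e1 : z + (y - z) = y := by abel
    rw [e1] at h1
    have e2 : ‖y‖ ^ 2 = ‖z‖ ^ 2 + 2 * ⟪z, y - z⟫ + ‖y - z‖ ^ 2 := by
      rw [← norm_add_sq_real, e1]
    simp only [hGdef, inner_add_left, inner_smul_left, e2]
    simp only [conj_trivial]
    linarith
  have hAc : Continuous A := by
    have h1 := cont_of_sub hG
    have : A = fun z => G z - Λ / 2 * ‖z‖ ^ 2 := by ext z; simp [hGdef]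
    rw [this]; fun_prop
  obtain ⟨N, hN0, hN⟩ := alexandrov hG
  have := isAddHaarMeasure_hausdorffMeasure (E := H)
  set μ : Measure H := Measure.hausdorffMeasure (X := H) (Module.finrank ℝ H : ℝ) with hμ
  set d := M - (A z1 - Ψ z1) with hd
  have hd0 : 0 ≤ d := by have := hM z1; linarith
  set κ1 := min (min 1 (κ / 2)) (κ ^ 2 / (16 * (2 * d + 1))) with hκ1
  have hκ10 : 0 < κ1 := by positivity
  have hκ11 : κ1 ≤ 1 := (min_le_left _ _).trans (min_le_left _ _)
  have hκ12 : κ1 ≤ κ / 2 := (min_le_left _ _).trans (min_le_right _ _)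
  have hκ13 : κ1 * (16 * (2 * d + 1)) ≤ κ ^ 2 := by
    have : κ1 ≤ κ ^ 2 / (16 * (2 * d + 1)) := min_le_right _ _
    rwa [le_div_iff₀ (by positivity)] at this
  -- maximizers
  have hmax : ∀ e0 : H, ∃ z, ∀ y, A y - Ψ y - κ1 * ‖y - z1‖ ^ 2 - ⟪e0, y - z1⟫ ≤
      A z - Ψ z - κ1 * ‖z - z1‖ ^ 2 - ⟪e0, z - z1⟫ := by
    intro e0
    have hF : Continuous (fun y => -(A y - Ψ y - κ1 * ‖y - z1‖ ^ 2 - ⟪e0, y - z1⟫)) := by fun_prop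
    have hcoer : Tendsto (fun y => -(A y - Ψ y - κ1 * ‖y - z1‖ ^ 2 - ⟪e0, y - z1⟫)) (cocompact H) atTop := by
      have h1 : Tendsto (fun z : H => ‖z - z1‖) (cocompact H) atTop := by
        have := tendsto_norm_cocompact_atTop (E := H)
        refine tendsto_atTop_mono (f := fun z => ‖z‖ - ‖z1‖) (fun z => ?_) ?_
        · exact norm_sub_norm_le z z1
        · exact tendsto_atTop_add_const_right _ _ this
      have h2 : Tendsto (fun z : H => -M + ‖z - z1‖ * (κ1 * ‖z - z1‖ + (-‖e0‖))) (cocompact H) atTop := by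
        apply tendsto_atTop_add_const_left
        exact h1.atTop_mul_atTop₀ (tendsto_atTop_add_const_right _ _ (h1.const_mul_atTop hκ10))
      refine tendsto_atTop_mono (fun z => ?_) h2
      have h4 : -(‖e0‖ * ‖z - z1‖) ≤ ⟪e0, z - z1⟫ := by
        have := abs_real_inner_le_norm e0 (z - z1)
        linarith [neg_abs_le ⟪e0, z - z1⟫]
      have := hM z
      nlinarith
    obtain ⟨z, hz⟩ := hF.exists_forall_le hcoer
    exact ⟨z, fun y => by have := hz y; linarith⟩
  choose Z hZ using hmax
  have hZr : ∀ e0, ‖e0‖ ≤ κ1 → κ1 * ‖Z e0 - z1‖ ^ 2 ≤ 2 * d + 1 ∧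
      A z1 - Ψ z1 - κ ≤ A (Z e0) - Ψ (Z e0) := by
    intro e0 he
    have h1 := hZ e0 z1
    simp only [sub_self, norm_zero, inner_zero_right] at h1
    have h2 := hM (Z e0)
    have h4 : -(κ1 * ‖Z e0 - z1‖) ≤ ⟪e0, Z e0 - z1⟫ := by
      have := abs_real_inner_le_norm e0 (Z e0 - z1)
      have := mul_le_mul_of_nonneg_right he (norm_nonneg (Z e0 - z1))
      linarith [neg_abs_le ⟪e0, Z e0 - z1⟫]
    constructor
    · nlinarith [sq_nonneg (‖Z e0 - z1‖ - 1)]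
    · nlinarith [sq_nonneg (‖Z e0 - z1‖ - 1 / 2)]
  set R1 := ‖z1‖ + ((2 * d + 1) / κ1 + 1) with hR1
  have hZR : ∀ e0, ‖e0‖ ≤ κ1 → ‖Z e0‖ ≤ R1 := by
    intro e0 he
    have h1 := (hZr e0 he).1
    have h2 : ‖Z e0 - z1‖ ^ 2 ≤ (2 * d + 1) / κ1 := by rw [le_div_iff₀ hκ10]; linarith
    have h3 : ‖Z e0 - z1‖ ≤ (2 * d + 1) / κ1 + 1 := by nlinarith [sq_nonneg (‖Z e0 - z1‖ - 1)]
    have h4 : ‖Z e0‖ ≤ ‖Z e0 - z1‖ + ‖z1‖ := by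
      have := norm_add_le (Z e0 - z1) z1; simpa using this
    linarith
  have hR10 : 0 < R1 := by positivity
  obtain ⟨C, hC⟩ := hΨ (2 * R1)
  have hup : ∀ e0 h, A (Z e0 + h) - A (Z e0) ≤ Ψ (Z e0 + h) - Ψ (Z e0) + ⟪(2 * κ1) • (Z e0 - z1) + e0, h⟫ + κ1 * ‖h‖ ^ 2 := by
    intro e0 h
    have h1 := hZ e0 (Z e0 + h)
    have e2 : ⟪e0, Z e0 + h - z1⟫ = ⟪e0, Z e0 - z1⟫ + ⟪e0, h⟫ := by
      rw [← inner_add_right]; congr 1; abel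
    rw [norm_shift, e2] at h1
    rw [inner_add_left, inner_smul_left]
    simp only [conj_trivial]
    linarith
  set C2 := Λ / 2 + C + κ1 with hC2
  have hlow : ∀ e0 h, ‖e0‖ ≤ κ1 → ‖h‖ ≤ 2 * R1 →
      A (Z e0) - Ψ (Z e0) - κ1 * ‖Z e0 - z1‖ ^ 2 + ⟪e0, h⟫ - C2 * ‖h‖ ^ 2 ≤
      A (Z e0 + h) - Ψ (Z e0 + h) - κ1 * ‖Z e0 + h - z1‖ ^ 2 := by
    intro e0 h he hh
    obtain ⟨p, hp⟩ := hA (Z e0)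
    have hz : ‖Z e0‖ ≤ 2 * R1 := (hZR e0 he).trans (by linarith)
    have key : p - DΨ (Z e0) - ((2 * κ1) • (Z e0 - z1) + e0) = 0 := by
      apply lin_zero (C := C2) (ρ := 2 * R1) (by positivity)
      intro x hx
      have h1 := hp x
      have h2 := hC (Z e0) x hz hx
      have h3 := hup e0 x
      rw [inner_sub_left, inner_sub_left]
      rw [hC2]
      linarith
    have hpe : p = DΨ (Z e0) + ((2 * κ1) • (Z e0 - z1) + e0) := by
      rw [sub_sub, sub_eq_zero] at key; exact key
    have h1 := hp h
    have h2 := hC (Z e0) h hz hh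
    rw [hpe, inner_add_left, inner_add_left, inner_smul_left] at h1
    simp only [conj_trivial] at h1
    rw [norm_shift, hC2]
    linarith
  have hanti : ∀ e e', ‖e‖ ≤ κ1 → ‖e'‖ ≤ κ1 → ‖e' - e‖ ≤ 2 * (|C2| + 1) * ‖Z e' - Z e‖ := by
    intro e e' he he'
    set r := ‖Z e' - Z e‖ with hr
    have hrR : r ≤ 2 * R1 := (norm_sub_le _ _).trans (by have := hZR e he; have := hZR e' he'; linarith)
    have hr0 : 0 ≤ r := norm_nonneg _
    rcases eq_or_ne (e' - e) 0 with h0 | h0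
    · rw [h0, norm_zero]; positivity
    have hn0 : 0 < ‖e' - e‖ := norm_pos_iff.mpr h0
    have main : ∀ h, ‖h‖ ≤ 2 * R1 → ⟪e' - e, h⟫ ≤ C2 * ‖h‖ ^ 2 + C2 * r ^ 2 := by
      intro h hh
      have h1 := hlow e' h he' hh
      have h2 := hlow e (Z e' - Z e) he hrR
      have h3 := hZ e (Z e' + h)
      have e1 : Z e + (Z e' - Z e) = Z e' := by abel
      have e2 : ⟪e, Z e' + h - z1⟫ = ⟪e, Z e - z1⟫ + ⟪e, Z e' - Z e⟫ + ⟪e, h⟫ := by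
        rw [← inner_add_right, ← inner_add_right]; congr 1; abel
      rw [e1] at h2
      rw [e2] at h3
      rw [inner_sub_left]
      linarith
    have hC2' : C2 ≤ |C2| + 1 := by linarith [le_abs_self C2]
    rcases eq_or_lt_of_le hr0 with hr00 | hr00
    · exfalso
      apply h0
      apply lin_zero (C := C2) (ρ := 2 * R1) (by positivity)
      intro x hx
      have := main x hx
      rw [← hr00] at this
      linarith
    · have h1 := main ((r / ‖e' - e‖) • (e' - e)) (by
        rw [norm_smul, Real.norm_eq_abs, abs_of_pos (by positivity), div_mul_cancel₀ _ hn0.ne']; exact hrR)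
      rw [inner_smul_right, real_inner_self_eq_norm_sq, norm_smul, Real.norm_eq_abs, abs_of_pos (by positivity),
        div_mul_cancel₀ _ hn0.ne'] at h1
      have e3 : r / ‖e' - e‖ * ‖e' - e‖ ^ 2 = r * ‖e' - e‖ := by field_simp
      rw [e3] at h1
      have h2 : r * ‖e' - e‖ ≤ r * (2 * (|C2| + 1) * r) := by nlinarith [sq_nonneg r]
      exact le_of_mul_le_mul_left h2 hr00
  -- find a good e0
  have hgood : ∃ e0 ∈ Metric.ball (0 : H) κ1, Z e0 ∉ N := by
    by_contra hcon
    push Not at hcon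
    set B := Metric.ball (0 : H) κ1 with hB
    have hBn : ∀ e ∈ B, ‖e‖ ≤ κ1 := fun e he => by
      rw [hB, mem_ball_zero_iff] at he; exact he.le
    have hinv : ∀ a ∈ Z '' B, Function.invFunOn Z B a ∈ B ∧ Z (Function.invFunOn Z B a) = a := fun a ha =>
      ⟨Function.invFunOn_mem ha, Function.invFunOn_eq ha⟩
    have hL : LipschitzOnWith (Real.toNNReal (2 * (|C2| + 1))) (Function.invFunOn Z B) (Z '' B) := by
      apply LipschitzOnWith.of_dist_le_mul
      intro a ha b hb
      obtain ⟨ha1, ha2⟩ := hinv a ha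
      obtain ⟨hb1, hb2⟩ := hinv b hb
      have := hanti _ _ (hBn _ hb1) (hBn _ ha1)
      rw [ha2, hb2] at this
      rw [dist_eq_norm, dist_eq_norm, Real.coe_toNNReal _ (by positivity)]
      exact this
    have h1 := hL.hausdorffMeasure_image_le (d := (Module.finrank ℝ H : ℝ)) (by positivity)
    rw [← hμ] at h1
    have h2 : μ (Z '' B) = 0 := measure_mono_null (by rintro _ ⟨e, he, rfl⟩; exact hcon e he) hN0
    rw [h2, mul_zero] at h1
    have h3 : B ⊆ Function.invFunOn Z B '' (Z '' B) := by
      intro e he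
      refine ⟨Z e, ⟨e, he, rfl⟩, ?_⟩
      obtain ⟨ha1, ha2⟩ := hinv (Z e) ⟨e, he, rfl⟩
      have := hanti _ _ (hBn _ he) (hBn _ ha1)
      rw [ha2, sub_self, norm_zero, mul_zero] at this
      exact sub_eq_zero.mp (norm_le_zero_iff.mp this)
    have h4 : μ B ≤ 0 := (measure_mono h3).trans h1
    exact absurd (Metric.measure_ball_pos μ (0 : H) hκ10) (not_lt.mpr h4)
  obtain ⟨e0, he0, hgd⟩ := hgood
  have he0' : ‖e0‖ ≤ κ1 := by rw [mem_ball_zero_iff] at he0; exact he0.le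
  obtain ⟨p, S0, hS0⟩ := hN _ hgd
  obtain ⟨hr1, hr2⟩ := hZr e0 he0'
  set z := Z e0 with hz
  set e := (2 * κ1) • (z - z1) + e0 with he
  have hEA : Exp2 A z (p - Λ • z) (S0 - Λ • ContinuousLinearMap.id ℝ H) := by
    intro σ hσ
    obtain ⟨ρ, hρ, h⟩ := hS0 σ hσ
    refine ⟨ρ, hρ, fun x hx => ?_⟩
    have h1 := h x hx
    have e2 : ‖z + x‖ ^ 2 = ‖z‖ ^ 2 + 2 * ⟪z, x⟫ + ‖x‖ ^ 2 := by
      rw [← norm_add_sq_real]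
    have e3 : ⟪(S0 - Λ • ContinuousLinearMap.id ℝ H) x, x⟫ = ⟪S0 x, x⟫ - Λ * ‖x‖ ^ 2 := by
      simp [inner_sub_left, inner_smul_left]
    rw [inner_sub_left, inner_smul_left, e3]
    simp only [hGdef, e2] at h1
    simp only [conj_trivial]
    convert h1 using 2
    ring
  have hz2 : ‖z‖ ≤ 2 * R1 := (hZR e0 he0').trans (by linarith)
  have hpe : p - Λ • z - (DΨ z + e) = 0 := by
    obtain ⟨ρ, hρ, h⟩ := hEA 1 one_pos
    set T := S0 - Λ • ContinuousLinearMap.id ℝ H with hT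
    apply lin_zero (C := C + κ1 + 1 + ‖T‖) (ρ := min ρ (2 * R1)) (by positivity)
    intro x hx
    have h1 := (abs_le.mp (h x (hx.trans (min_le_left _ _)))).1
    have h2 := hC z x hz2 (hx.trans (min_le_right _ _))
    have h3 := hup e0 x
    rw [← hz, ← he] at h3
    have h4 : -(‖T‖ * ‖x‖ ^ 2) ≤ ⟪T x, x⟫ := by
      have a1 := abs_real_inner_le_norm (T x) x
      have a2 := T.le_opNorm x
      have a3 : ‖T x‖ * ‖x‖ ≤ ‖T‖ * ‖x‖ ^ 2 := by nlinarith [norm_nonneg x]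
      linarith [neg_abs_le ⟪T x, x⟫]
    have h5 : 0 ≤ ‖T‖ * ‖x‖ ^ 2 := by positivity
    rw [inner_sub_left, inner_add_left]
    nlinarith
  rw [sub_eq_zero] at hpe
  rw [hpe] at hEA
  set T := S0 - Λ • ContinuousLinearMap.id ℝ H with hT
  refine ⟨z, e, (1 / 2 : ℝ) • (T + ContinuousLinearMap.adjoint T), ?_, hr2, ?_, ?_, ?_⟩
  · have a1 : (2 * κ1 * ‖z - z1‖) ^ 2 ≤ (κ / 2) ^ 2 := by nlinarith
    have a2 : 2 * κ1 * ‖z - z1‖ ≤ κ / 2 := by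
      exact (abs_le_of_sq_le_sq' a1 (by positivity)).2
    calc ‖e‖ ≤ ‖(2 * κ1) • (z - z1)‖ + ‖e0‖ := norm_add_le _ _
      _ = 2 * κ1 * ‖z - z1‖ + ‖e0‖ := by rw [norm_smul, Real.norm_eq_abs, abs_of_pos (by positivity)]
      _ ≤ κ := by linarith
  · intro h
    have := hup e0 h
    rw [← hz, ← he] at this
    nlinarith [sq_nonneg ‖h‖]
  · intro σ hσ
    obtain ⟨ρ, hρ, h⟩ := hEA σ hσ
    refine ⟨ρ, hρ, fun x hx => ?_⟩
    have e1 : ⟪((1 / 2 : ℝ) • (T + ContinuousLinearMap.adjoint T)) x, x⟫ = ⟪T x, x⟫ := by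
      simp only [ContinuousLinearMap.smul_apply, ContinuousLinearMap.add_apply, inner_smul_left, inner_add_left,
        ContinuousLinearMap.adjoint_inner_left, conj_trivial]
      rw [real_inner_comm x (T x)]; ring
    rw [e1]
    exact h x hx
  · intro a b
    simp only [ContinuousLinearMap.smul_apply, ContinuousLinearMap.add_apply, inner_smul_left, inner_add_left,
        ContinuousLinearMap.adjoint_inner_left, conj_trivial, inner_smul_right, inner_add_right,
        ContinuousLinearMap.adjoint_inner_right]
    ring

lemma supconv {D : Set H} (hD : IsClosed D) {V : H → ℝ} (hV : ContinuousOn V D) {w0 : H} (hw0 : w0 ∈ D)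
    {C0 C1 : ℝ} (hVb : ∀ w ∈ D, V w ≤ C0 + C1 * ‖w‖) {ε : ℝ} (hε : 0 < ε) (z : H) :
    ∃ w ∈ D, ∀ y ∈ D, V y - ‖z - y‖ ^ 2 / (2 * ε) ≤ V w - ‖z - w‖ ^ 2 / (2 * ε) := by
  have hc : ContinuousOn (fun y => V y - ‖z - y‖ ^ 2 / (2 * ε)) D := by
    apply hV.sub
    fun_prop
  have h := ContinuousOn.exists_isMaxOn' hc hD hw0 (by
    have h1 : Tendsto (fun y : H => ‖y - z‖) (cocompact H) atTop := by
      have := tendsto_norm_cocompact_atTop (E := H)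
      refine tendsto_atTop_mono (f := fun y => ‖y‖ - ‖z‖) (fun y => ?_) ?_
      · exact norm_sub_norm_le y z
      · exact tendsto_atTop_add_const_right _ _ this
    have h2 : Tendsto (fun y : H => -(C0 + |C1| * ‖z‖) + ‖y - z‖ * ((1 / (2 * ε)) * ‖y - z‖ + (-|C1|))) (cocompact H) atTop := by
      apply tendsto_atTop_add_const_left
      exact h1.atTop_mul_atTop₀ (tendsto_atTop_add_const_right _ _ (h1.const_mul_atTop (by positivity)))
    have h3 := (h2.mono_left inf_le_left : Tendsto _ (cocompact H ⊓ 𝓟 D) atTop).eventually_ge_atTop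
      (-(V w0 - ‖z - w0‖ ^ 2 / (2 * ε)))
    filter_upwards [h3, (mem_inf_of_right (mem_principal_self D))] with y hy hyD
    have h4 := hVb y hyD
    have h5 : ‖y‖ ≤ ‖y - z‖ + ‖z‖ := by have := norm_add_le (y - z) z; simpa using this
    have h6 : C1 * ‖y‖ ≤ |C1| * (‖y - z‖ + ‖z‖) :=
      (mul_le_mul_of_nonneg_right (le_abs_self C1) (norm_nonneg y)).trans
        (mul_le_mul_of_nonneg_left h5 (abs_nonneg _))
    rw [norm_sub_rev z y]
    have e : ‖y - z‖ ^ 2 / (2 * ε) = ‖y - z‖ * (1 / (2 * ε) * ‖y - z‖) := by ring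
    rw [e]
    nlinarith)
  obtain ⟨w, hw, hmax⟩ := h
  exact ⟨w, hw, fun y hy => hmax hy⟩

set_option maxHeartbeats 1000000 in
/-- Theorem on sums, in sup-convolution form. -/
lemma sums {D : Set H} (hD : IsClosed D) {V : H → ℝ} (hV : ContinuousOn V D)
    {C0 C1 : ℝ} (hVb : ∀ w ∈ D, V w ≤ C0 + C1 * ‖w‖) {ε : ℝ} (hε : 0 < ε)
    {Ψ : H → ℝ} (hΨc : Continuous Ψ) (DΨ : H → H)
    (hΨ : ∀ R : ℝ, ∃ C : ℝ, ∀ z h, ‖z‖ ≤ R → ‖h‖ ≤ R → Ψ (z + h) ≤ Ψ z + ⟪DΨ z, h⟫ + C * ‖h‖ ^ 2)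
    (M : ℝ) (hM : ∀ z, ∀ w ∈ D, V w - ‖z - w‖ ^ 2 / (2 * ε) - Ψ z ≤ M) {z1 : H} (hz1 : z1 ∈ D)
    {κ : ℝ} (hκ : 0 < κ) :
    ∃ z w e S, w ∈ D ∧ ‖e‖ ≤ κ ∧ V z1 - Ψ z1 - κ ≤ V w - ‖z - w‖ ^ 2 / (2 * ε) - Ψ z ∧
      w - z = ε • (DΨ z + e) ∧ (∀ a b, ⟪S a, b⟫ = ⟪a, S b⟫) ∧
      (∀ σ > 0, ∃ ρ > 0, ∀ h, ‖h‖ ≤ ρ → w + h ∈ D →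
        V (w + h) ≤ V w + ⟪DΨ z + e, h⟫ + 1 / 2 * ⟪(S : H →L[ℝ] H) h, h⟫ + σ * ‖h‖ ^ 2) ∧
      (∃ ρ > 0, ∀ h, ‖h‖ ≤ ρ → 1 / 2 * ⟪S h, h⟫ ≤ Ψ (z + h) - Ψ z - ⟪DΨ z, h⟫ + 2 * κ * ‖h‖ ^ 2) ∧
      (∀ a b, (∀ s : ℝ, ∀ w1 ∈ D, ∀ w2 ∈ D, ∃ w3 ∈ D, ∃ w4 ∈ D, V w1 + V w2 ≤ V w3 + V w4 ∧
        ‖z + (s • a + s • b) - w3‖ ^ 2 + ‖z - w4‖ ^ 2 ≤ ‖z + s • a - w1‖ ^ 2 + ‖z + s • b - w2‖ ^ 2) → 0 ≤ ⟪S a, b⟫) := by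
  choose W hWD hW using supconv hD hV hz1 hVb hε
  set A : H → ℝ := fun z => V (W z) - ‖z - W z‖ ^ 2 / (2 * ε) with hAdef
  have hAlow : ∀ z h, A z + ⟪(1 / ε) • (W z - z), h⟫ - (1 / ε) / 2 * ‖h‖ ^ 2 ≤ A (z + h) := by
    intro z h
    have h1 := hW (z + h) (W z) (hWD z)
    rw [norm_shift] at h1
    have e1 : ⟪(1 / ε) • (W z - z), h⟫ = - (1 / ε * ⟪z - W z, h⟫) := by
      have : W z - z = -(z - W z) := by abel
      rw [this, inner_smul_left, inner_neg_left]; simp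
    rw [e1]
    simp only [hAdef]
    refine le_trans (le_of_eq ?_) h1
    field_simp; ring
  have hA : ∀ z, ∃ p, ∀ h, A z + ⟪p, h⟫ - (1 / ε) / 2 * ‖h‖ ^ 2 ≤ A (z + h) :=
    fun z => ⟨_, hAlow z⟩
  obtain ⟨z, e, S, he, hval, hup, hE, hsym⟩ := jensen hA hΨc DΨ hΨ M (fun z => hM z _ (hWD z)) z1 κ hκ
  have hpe : (1 / ε) • (W z - z) - (DΨ z + e) = 0 := by
    obtain ⟨ρ, hρ, h⟩ := hE 1 one_pos
    apply lin_zero (C := (1 / ε) / 2 + 1 + ‖S‖) hρ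
    intro x hx
    have h1 := (abs_le.mp (h x hx)).2
    have h2 := hAlow z x
    have h4 : ⟪S x, x⟫ ≤ (‖S‖ * ‖x‖ ^ 2) := by
      have a1 := abs_real_inner_le_norm (S x) x
      have a2 := S.le_opNorm x
      have a3 : ‖S x‖ * ‖x‖ ≤ ‖S‖ * ‖x‖ ^ 2 := by nlinarith [norm_nonneg x]
      linarith [le_abs_self ⟪S x, x⟫]
    have h5 : 0 ≤ ‖S‖ * ‖x‖ ^ 2 := by positivity
    rw [inner_sub_left]
    nlinarith
  rw [sub_eq_zero] at hpe
  refine ⟨z, W z, e, S, hWD z, he, ?_, ?_, hsym, ?_, ?_, ?_⟩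
  · have h1 := hW z1 z1 hz1
    simp only [sub_self, norm_zero] at h1
    simp only [hAdef] at hval
    norm_num at h1
    linarith
  · rw [← hpe, smul_smul, mul_one_div, div_self hε.ne', one_smul]
  · intro σ hσ
    obtain ⟨ρ, hρ, h⟩ := hE σ hσ
    refine ⟨ρ, hρ, fun x hx hxD => ?_⟩
    have h1 := (abs_le.mp (h x hx)).2
    have h2 := hW (z + x) (W z + x) hxD
    have e1 : z + x - (W z + x) = z - W z := by abel
    rw [e1] at h2
    simp only [hAdef] at h1
    linarith
  · obtain ⟨ρ, hρ, h⟩ := hE κ hκ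
    refine ⟨ρ, hρ, fun x hx => ?_⟩
    have h1 := (abs_le.mp (h x hx)).1
    have h2 := hup x
    rw [inner_add_left] at h1
    linarith
  · intro a b hab
    by_contra hneg
    push Not at hneg
    set N := ‖a‖ ^ 2 + ‖b‖ ^ 2 + ‖a + b‖ ^ 2 + 1 with hN
    have hN0 : 0 < N := by positivity
    obtain ⟨ρ, hρ, h⟩ := hE (-⟪S a, b⟫ / (2 * N)) (by apply div_pos <;> linarith)
    set s := ρ / (‖a‖ + ‖b‖ + 1) with hs
    have hs0 : 0 < s := by positivity
    have hs1 : s * (‖a‖ + ‖b‖ + 1) = ρ := by rw [hs]; field_simp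
    have hsa : ‖s • a‖ = s * ‖a‖ := by rw [norm_smul, Real.norm_eq_abs, abs_of_pos hs0]
    have hsb : ‖s • b‖ = s * ‖b‖ := by rw [norm_smul, Real.norm_eq_abs, abs_of_pos hs0]
    have hsab : ‖s • a + s • b‖ = s * ‖a + b‖ := by rw [← smul_add, norm_smul, Real.norm_eq_abs, abs_of_pos hs0]
    have n1 := mul_nonneg hs0.le (norm_nonneg a)
    have n2 := mul_nonneg hs0.le (norm_nonneg b)
    have h1 := (abs_le.mp (h (s • a) (by rw [hsa]; nlinarith))).1
    have h2 := (abs_le.mp (h (s • b) (by rw [hsb]; nlinarith))).1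
    have h3 := (abs_le.mp (h (s • a + s • b) (by
      refine (norm_add_le _ _).trans ?_
      rw [hsa, hsb]; nlinarith))).2
    obtain ⟨w3, hw3, w4, hw4, q1, q2⟩ := hab s _ (hWD (z + s • a)) _ (hWD (z + s • b))
    have h4 := hW (z + (s • a + s • b)) w3 hw3
    have h5 := hW z w4 hw4
    have q3 : (‖z + (s • a + s • b) - w3‖ ^ 2 + ‖z - w4‖ ^ 2) / (2 * ε) ≤
      (‖z + s • a - W (z + s • a)‖ ^ 2 + ‖z + s • b - W (z + s • b)‖ ^ 2) / (2 * ε) := by gcongr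
    rw [add_div, add_div] at q3
    have e1 : ⟪S (s • a + s • b), s • a + s • b⟫ = ⟪S (s • a), s • a⟫ + ⟪S (s • b), s • b⟫ + 2 * (s ^ 2 * ⟪S a, b⟫) := by
      have := hsym b a
      have e2 := real_inner_comm (S a) b
      simp only [map_add, map_smul, inner_add_left, inner_add_right, inner_smul_left, inner_smul_right, conj_trivial]
      rw [this, e2]; ring
    rw [e1, hsab, inner_add_right] at h3
    rw [hsa] at h1
    rw [hsb] at h2
    simp only [hAdef] at h1 h2 h3
    have e3 : -⟪S a, b⟫ / (2 * N) * (s * ‖a‖) ^ 2 + -⟪S a, b⟫ / (2 * N) * (s * ‖b‖) ^ 2 + -⟪S a, b⟫ / (2 * N) * (s * ‖a + b‖) ^ 2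
        ≤ -⟪S a, b⟫ / 2 * s ^ 2 := by
      have : -⟪S a, b⟫ / (2 * N) * (s * ‖a‖) ^ 2 + -⟪S a, b⟫ / (2 * N) * (s * ‖b‖) ^ 2 + -⟪S a, b⟫ / (2 * N) * (s * ‖a + b‖) ^ 2
        = -⟪S a, b⟫ / 2 * s ^ 2 * ((N - 1) / N) := by rw [hN]; field_simp; ring
      rw [this]
      have h6 : (N - 1) / N ≤ 1 := by rw [div_le_one hN0]; linarith
      have h7 : 0 ≤ -⟪S a, b⟫ / 2 * s ^ 2 := by
        have : 0 ≤ -⟪S a, b⟫ / 2 := by linarith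
        positivity
      exact mul_le_of_le_one_right h7 h6
    have h8 : s ^ 2 * ⟪S a, b⟫ < 0 := mul_neg_of_pos_of_neg (by positivity) hneg
    linarith

end Jensen
end VS

open Set Filter Topology
open scoped RealInnerProductSpace
set_option linter.unusedSectionVars false
namespace VS
section Jets
variable {n : ℕ}

lemma quad_grad (X : (EuclideanSpace ℝ (Fin n)) →L[ℝ] (EuclideanSpace ℝ (Fin n))) (hX : ∀ a b, ⟪X a, b⟫ = ⟪a, X b⟫) (p x0 : (EuclideanSpace ℝ (Fin n))) (k : ℝ) (y : (EuclideanSpace ℝ (Fin n))) :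
    HasGradientAt (fun y : (EuclideanSpace ℝ (Fin n)) => k + ⟪p, y - x0⟫ + 1 / 2 * ⟪X (y - x0), y - x0⟫) (p + X (y - x0)) y := by
  have h0 : HasFDerivAt (fun y : (EuclideanSpace ℝ (Fin n)) => y - x0) (ContinuousLinearMap.id ℝ (EuclideanSpace ℝ (Fin n))) y :=
    (hasFDerivAt_id y).sub_const x0
  have h1 : HasFDerivAt (fun y : (EuclideanSpace ℝ (Fin n)) => X (y - x0)) (X.comp (ContinuousLinearMap.id ℝ (EuclideanSpace ℝ (Fin n)))) y :=
    X.hasFDerivAt.comp y h0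
  have h2 := h1.inner ℝ h0
  have h3 := (hasFDerivAt_const p y).inner ℝ h0
  have h4 := (h3.const_add k).add (h2.const_mul (1 / 2))
  rw [hasGradientAt_iff_hasFDerivAt]
  refine h4.congr_fderiv ?_
  ext v
  have e1 := hX (y - x0) v
  have e2 := real_inner_comm (X v) (y - x0)
  change ⟪p, v⟫ + ⟪(0 : (EuclideanSpace ℝ (Fin n))), y - x0⟫ + 1 / 2 * (⟪X (y - x0), v⟫ + ⟪X v, y - x0⟫) = ⟪p + X (y - x0), v⟫
  rw [inner_add_left, inner_zero_left]
  linarith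

lemma quad_sGrad (X : (EuclideanSpace ℝ (Fin n)) →L[ℝ] (EuclideanSpace ℝ (Fin n))) (hX : ∀ a b, ⟪X a, b⟫ = ⟪a, X b⟫) (p x0 : (EuclideanSpace ℝ (Fin n))) (θ C t0 : ℝ) (t : ℝ) (y : (EuclideanSpace ℝ (Fin n))) :
    sGrad (fun y t => (θ * (t - t0) + C * (t - t0) ^ 2) + ⟪p, y - x0⟫ + 1 / 2 * ⟪X (y - x0), y - x0⟫) y t
      = p + X (y - x0) := (quad_grad X hX p x0 _ y).gradient

lemma quad_sHess (X : (EuclideanSpace ℝ (Fin n)) →L[ℝ] (EuclideanSpace ℝ (Fin n))) (hX : ∀ a b, ⟪X a, b⟫ = ⟪a, X b⟫) (p x0 : (EuclideanSpace ℝ (Fin n))) (θ C t0 : ℝ) (t : ℝ) (y : (EuclideanSpace ℝ (Fin n))) :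
    sHess (fun y t => (θ * (t - t0) + C * (t - t0) ^ 2) + ⟪p, y - x0⟫ + 1 / 2 * ⟪X (y - x0), y - x0⟫) y t
      = X := by
  unfold sHess
  have : (fun y => gradient (fun z : (EuclideanSpace ℝ (Fin n)) => (θ * (t - t0) + C * (t - t0) ^ 2) + ⟪p, z - x0⟫ + 1 / 2 * ⟪X (z - x0), z - x0⟫) y)
      = fun y => p + X (y - x0) := by
    funext y; exact (quad_grad X hX p x0 _ y).gradient
  rw [this]
  have h0 : HasFDerivAt (fun y : (EuclideanSpace ℝ (Fin n)) => y - x0) (ContinuousLinearMap.id ℝ (EuclideanSpace ℝ (Fin n))) y :=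
    (hasFDerivAt_id y).sub_const x0
  have h1 : HasFDerivAt (fun y : (EuclideanSpace ℝ (Fin n)) => X (y - x0)) (X.comp (ContinuousLinearMap.id ℝ (EuclideanSpace ℝ (Fin n)))) y :=
    X.hasFDerivAt.comp y h0
  rw [(h1.const_add p).fderiv]; rfl

lemma quad_tDeriv (X : (EuclideanSpace ℝ (Fin n)) →L[ℝ] (EuclideanSpace ℝ (Fin n))) (p x0 : (EuclideanSpace ℝ (Fin n))) (θ C t0 : ℝ) (y : (EuclideanSpace ℝ (Fin n))) :
    tDeriv (fun y t => (θ * (t - t0) + C * (t - t0) ^ 2) + ⟪p, y - x0⟫ + 1 / 2 * ⟪X (y - x0), y - x0⟫) y t0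
      = θ := by
  unfold tDeriv
  have h0 : HasDerivAt (fun s : ℝ => s - t0) 1 t0 := (hasDerivAt_id t0).sub_const t0
  have h1 := (((h0.const_mul θ).add ((h0.pow 2).const_mul C)).add_const (⟪p, y - x0⟫)).add_const (1 / 2 * ⟪X (y - x0), y - x0⟫)
  have h2 := h1.deriv
  simp only [mul_one, sub_self] at h2
  refine Eq.trans ?_ (h2.trans (by simp))
  rfl

lemma quad_cd (X : (EuclideanSpace ℝ (Fin n)) →L[ℝ] (EuclideanSpace ℝ (Fin n))) (p x0 : (EuclideanSpace ℝ (Fin n))) (θ C t0 : ℝ) :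
    ContDiff ℝ 2 (fun q : (EuclideanSpace ℝ (Fin n)) × ℝ => (θ * (q.2 - t0) + C * (q.2 - t0) ^ 2) + ⟪p, q.1 - x0⟫ + 1 / 2 * ⟪X (q.1 - x0), q.1 - x0⟫) := by
  have h1 : ContDiff ℝ 2 (fun q : (EuclideanSpace ℝ (Fin n)) × ℝ => q.1 - x0) := contDiff_fst.sub contDiff_const
  have h2 : ContDiff ℝ 2 (fun q : (EuclideanSpace ℝ (Fin n)) × ℝ => q.2 - t0) := contDiff_snd.sub contDiff_const
  have h3 : ContDiff ℝ 2 (fun q : (EuclideanSpace ℝ (Fin n)) × ℝ => X (q.1 - x0)) := X.contDiff.comp h1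
  exact (((contDiff_const.mul h2).add (contDiff_const.mul (h2.pow 2))).add (contDiff_const.inner ℝ h1)).add
    (contDiff_const.mul (h3.inner ℝ h1))

variable {f : (EuclideanSpace ℝ (Fin n)) → ℝ} {u : (EuclideanSpace ℝ (Fin n)) → ℝ → ℝ}

lemma norm_inv_smul_aux {p : (EuclideanSpace ℝ (Fin n))} (hp : p ≠ 0) : ‖(‖p‖⁻¹ • p)‖ ≤ 1 ∧ ‖p‖ • (‖p‖⁻¹ • p) = p := by
  have : ‖p‖ ≠ 0 := norm_ne_zero_iff.mpr hp
  constructor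
  · rw [norm_smul, norm_inv, norm_norm, inv_mul_cancel₀ this]
  · rw [smul_smul, mul_inv_cancel₀ this, one_smul]

lemma jet_sub (hu : ParabSubsol f univ u) {x0 p : (EuclideanSpace ℝ (Fin n))} {t0 θ C : ℝ} (ht : 0 < t0) {X : (EuclideanSpace ℝ (Fin n)) →L[ℝ] (EuclideanSpace ℝ (Fin n))}
    (hX : ∀ a b, ⟪X a, b⟫ = ⟪a, X b⟫)
    (h : ∀ᶠ q : (EuclideanSpace ℝ (Fin n)) × ℝ in 𝓝 (x0, t0), u q.1 q.2 ≤ u x0 t0 + θ * (q.2 - t0) + ⟪p, q.1 - x0⟫ +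
      1 / 2 * ⟪X (q.1 - x0), q.1 - x0⟫ + C * (q.2 - t0) ^ 2) :
    ∃ η : (EuclideanSpace ℝ (Fin n)), ‖η‖ ≤ 1 ∧ ‖p‖ • η = p ∧ θ - (trProj X η + ‖p‖) ≤ f x0 := by
  have hm : IsLocalMax (fun q : (EuclideanSpace ℝ (Fin n)) × ℝ => u q.1 q.2 - ((θ * (q.2 - t0) + C * (q.2 - t0) ^ 2) + ⟪p, q.1 - x0⟫ + 1 / 2 * ⟪X (q.1 - x0), q.1 - x0⟫)) (x0, t0) := by
    filter_upwards [h] with q hq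
    simp only [sub_self, map_zero, inner_zero_right]
    linarith
  have h1 := hu (fun (y : (EuclideanSpace ℝ (Fin n))) (t : ℝ) => (θ * (t - t0) + C * (t - t0) ^ 2) + ⟪p, y - x0⟫ + 1 / 2 * ⟪X (y - x0), y - x0⟫) (quad_cd X p x0 θ C t0) x0 (mem_univ _) t0 ht hm
  rw [quad_sGrad X hX, quad_sHess X hX, quad_tDeriv] at h1
  simp only [sub_self, map_zero, add_zero] at h1
  by_cases hp : p = 0
  · obtain ⟨η, h2, h3⟩ := h1.2 hp
    exact ⟨η, h2, by simp [hp], by simpa [hp] using h3⟩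
  · exact ⟨_, (norm_inv_smul_aux hp).1, (norm_inv_smul_aux hp).2, h1.1 hp⟩

lemma jet_super (hu : ParabSupersol f univ u) {x0 p : (EuclideanSpace ℝ (Fin n))} {t0 θ C : ℝ} (ht : 0 < t0) {X : (EuclideanSpace ℝ (Fin n)) →L[ℝ] (EuclideanSpace ℝ (Fin n))}
    (hX : ∀ a b, ⟪X a, b⟫ = ⟪a, X b⟫)
    (h : ∀ᶠ q : (EuclideanSpace ℝ (Fin n)) × ℝ in 𝓝 (x0, t0), u x0 t0 + θ * (q.2 - t0) + ⟪p, q.1 - x0⟫ +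
      1 / 2 * ⟪X (q.1 - x0), q.1 - x0⟫ + C * (q.2 - t0) ^ 2 ≤ u q.1 q.2) :
    ∃ η : (EuclideanSpace ℝ (Fin n)), ‖η‖ ≤ 1 ∧ ‖p‖ • η = p ∧ f x0 ≤ θ - (trProj X η + ‖p‖) := by
  have hm : IsLocalMin (fun q : (EuclideanSpace ℝ (Fin n)) × ℝ => u q.1 q.2 - ((θ * (q.2 - t0) + C * (q.2 - t0) ^ 2) + ⟪p, q.1 - x0⟫ + 1 / 2 * ⟪X (q.1 - x0), q.1 - x0⟫)) (x0, t0) := by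
    filter_upwards [h] with q hq
    simp only [sub_self, map_zero, inner_zero_right]
    linarith
  have h1 := hu (fun (y : (EuclideanSpace ℝ (Fin n))) (t : ℝ) => (θ * (t - t0) + C * (t - t0) ^ 2) + ⟪p, y - x0⟫ + 1 / 2 * ⟪X (y - x0), y - x0⟫) (quad_cd X p x0 θ C t0) x0 (mem_univ _) t0 ht hm
  rw [quad_sGrad X hX, quad_sHess X hX, quad_tDeriv] at h1
  simp only [sub_self, map_zero, add_zero] at h1
  by_cases hp : p = 0
  · obtain ⟨η, h2, h3⟩ := h1.2 hp
    exact ⟨η, h2, by simp [hp], by simpa [hp] using h3⟩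
  · exact ⟨_, (norm_inv_smul_aux hp).1, (norm_inv_smul_aux hp).2, h1.1 hp⟩

/-- square root of the projection -/
lemma exists_sqrt_proj (η : (EuclideanSpace ℝ (Fin n))) (hη : ‖η‖ ≤ 1) : ∃ a : ℝ, 0 ≤ a ∧ a ≤ 1 ∧ 2 * a - a ^ 2 * ‖η‖ ^ 2 = 1 := by
  have h0 : 0 ≤ 1 - ‖η‖ ^ 2 := by nlinarith [norm_nonneg η]
  have h1 := Real.sq_sqrt h0
  have h2 := Real.sqrt_nonneg (1 - ‖η‖ ^ 2)
  set s := Real.sqrt (1 - ‖η‖ ^ 2)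
  refine ⟨1 / (1 + s), by positivity, ?_, ?_⟩
  · rw [div_le_one (by positivity)]; linarith
  · have : ‖η‖ ^ 2 = 1 - s ^ 2 := by linarith
    rw [this]; field_simp; ring

lemma trProj_eq (X : (EuclideanSpace ℝ (Fin n)) →L[ℝ] (EuclideanSpace ℝ (Fin n))) (hX : ∀ a b, ⟪X a, b⟫ = ⟪a, X b⟫) (η : (EuclideanSpace ℝ (Fin n))) {a : ℝ} (ha : 2 * a - a ^ 2 * ‖η‖ ^ 2 = 1)
    (b : OrthonormalBasis (Fin n) ℝ (EuclideanSpace ℝ (Fin n))) :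
    trProj X η = ∑ i, ⟪X (b i - (a * ⟪η, b i⟫) • η), b i - (a * ⟪η, b i⟫) • η⟫ := by
  have h1 : clmTrace X = ∑ i, ⟪X (b i), b i⟫ := by
    unfold clmTrace
    rw [LinearMap.trace_eq_sum_inner _ b]
    refine Finset.sum_congr rfl fun i _ => ?_
    rw [real_inner_comm]; rfl
  have h2 : ∀ i, ⟪X (b i - (a * ⟪η, b i⟫) • η), b i - (a * ⟪η, b i⟫) • η⟫ =
      ⟪X (b i), b i⟫ - 2 * a * (⟪η, b i⟫ * ⟪b i, X η⟫) + a ^ 2 * ⟪X η, η⟫ * (⟪η, b i⟫ * ⟪b i, η⟫) := by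
    intro i
    have e1 := hX (b i) η
    have e2 := real_inner_comm (b i) (X η)
    have e3 := real_inner_comm (b i) η
    simp only [map_sub, map_smul, inner_sub_left, inner_sub_right, inner_smul_left, inner_smul_right]
    simp only [conj_trivial]
    rw [e1, e2, e3]
    ring
  rw [Finset.sum_congr rfl fun i _ => h2 i, Finset.sum_add_distrib, Finset.sum_sub_distrib, ← Finset.mul_sum,
    ← Finset.mul_sum, OrthonormalBasis.sum_inner_mul_inner, OrthonormalBasis.sum_inner_mul_inner,
    real_inner_self_eq_norm_sq]
  unfold trProj
  rw [h1, hX η η]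
  linear_combination ⟪η, X η⟫ * ha

lemma trProj_smul_id (k : ℝ) (η : (EuclideanSpace ℝ (Fin n))) : trProj (k • ContinuousLinearMap.id ℝ (EuclideanSpace ℝ (Fin n))) η = k * (n - ‖η‖ ^ 2) := by
  unfold trProj clmTrace
  simp [inner_smul_left, real_inner_self_eq_norm_sq]
  ring
end Jets
end VS

open Set Filter Topology
open scoped RealInnerProductSpace
set_option linter.unusedSectionVars false
namespace VS
section Barrier
variable {n : ℕ}

lemma max_point {w : (EuclideanSpace ℝ (Fin n)) → ℝ → ℝ} (hc : ContinuousOn (fun q : (EuclideanSpace ℝ (Fin n)) × ℝ => w q.1 q.2) (univ ×ˢ Ici 0))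
    (h0 : ∀ x, w x 0 ≤ 0)
    (hco : ∀ T > 0, ∃ κ > 0, ∃ B, ∀ x, ∀ t ∈ Icc (0 : ℝ) T, w x t ≤ B - κ * ‖x‖)
    {x1 : (EuclideanSpace ℝ (Fin n))} {t1 : ℝ} (ht1 : 0 ≤ t1) (h : 0 < w x1 t1) :
    ∃ (x : (EuclideanSpace ℝ (Fin n))) (t θ C : ℝ), 0 < t ∧ 0 < θ ∧
      ∀ᶠ q : (EuclideanSpace ℝ (Fin n)) × ℝ in 𝓝 (x, t), w q.1 q.2 ≤ w x t + θ * (q.2 - t) + C * (q.2 - t) ^ 2 := by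
  have ht1' : 0 < t1 := by
    rcases ht1.lt_or_eq with h' | h'
    · exact h'
    · rw [← h'] at h; exact absurd (h0 x1) (not_le.mpr h)
  obtain ⟨κ, hκ, B, hB⟩ := hco (t1 + 1) (by linarith)
  set σ := w x1 t1 / (2 * t1) with hσ
  have hσ0 : 0 < σ := by positivity
  set m := |B| + 1 with hm
  have hm0 : 0 < m := by positivity
  set g : ℝ → ℝ := fun t => σ * t + m * (max 0 (t - t1)) ^ 2 with hg
  have hgc : Continuous g := by fun_prop
  have hg0 : ∀ t, 0 ≤ t → 0 ≤ g t := fun t ht => by positivity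
  set R := ‖x1‖ + |B| / κ with hR
  have hK : IsCompact (Metric.closedBall (0 : (EuclideanSpace ℝ (Fin n))) R ×ˢ Icc (0 : ℝ) (t1 + 1)) :=
    (isCompact_closedBall _ _).prod isCompact_Icc
  have hx1 : (x1, t1) ∈ Metric.closedBall (0 : (EuclideanSpace ℝ (Fin n))) R ×ˢ Icc (0 : ℝ) (t1 + 1) := by
    refine ⟨?_, ht1, by simp⟩
    simp only [mem_closedBall_zero_iff, hR]
    have : 0 ≤ |B| / κ := by positivity
    linarith
  have hcc : ContinuousOn (fun q : (EuclideanSpace ℝ (Fin n)) × ℝ => w q.1 q.2 - g q.2) (Metric.closedBall (0 : (EuclideanSpace ℝ (Fin n))) R ×ˢ Icc (0 : ℝ) (t1 + 1)) := by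
    refine ContinuousOn.sub (hc.mono ?_) (hgc.comp continuous_snd).continuousOn
    exact prod_mono (subset_univ _) Icc_subset_Ici_self
  obtain ⟨⟨x, t⟩, ⟨hxm, htm⟩, hmax⟩ := hK.exists_isMaxOn ⟨_, hx1⟩ hcc
  simp only at hxm htm
  have hval : w x1 t1 / 2 ≤ w x t - g t := by
    have h2 : w x1 t1 - g t1 ≤ w x t - g t := hmax hx1
    have h3 : g t1 = w x1 t1 / 2 := by simp [hg, hσ]; field_simp
    linarith
  have hglob : ∀ y, ∀ s ∈ Icc (0 : ℝ) (t1 + 1), w y s - g s ≤ w x t - g t := by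
    intro y s hs
    by_cases hy : ‖y‖ ≤ R
    · exact hmax (show (y, s) ∈ _ from ⟨by simpa using hy, hs⟩)
    · have h3 := hB y s hs
      have h4 := hg0 s hs.1
      have h5 : |B| / κ < ‖y‖ := by
        have := norm_nonneg x1
        linarith [not_le.mp hy]
      rw [div_lt_iff₀ hκ] at h5
      have := le_abs_self B
      nlinarith
  have ht0 : 0 < t := by
    rcases htm.1.lt_or_eq with h' | h'
    · exact h'
    · rw [← h'] at hval; linarith [h0 x, hg0 0 le_rfl]
  have htT : t < t1 + 1 := by
    rcases htm.2.lt_or_eq with h' | h'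
    · exact h'
    · have h3 := hB x t htm
      have h4 : g t = σ * (t1 + 1) + m := by simp [hg, h']
      have := le_abs_self B
      have : 0 ≤ κ * ‖x‖ := by positivity
      have : 0 < σ * (t1 + 1) := by positivity
      linarith
  refine ⟨x, t, σ + 2 * m * max 0 (t - t1), m, ht0, by positivity, ?_⟩
  have hev : ∀ᶠ q : (EuclideanSpace ℝ (Fin n)) × ℝ in 𝓝 (x, t), q.2 ∈ Ioo 0 (t1 + 1) :=
    continuous_snd.continuousAt.eventually (Ioo_mem_nhds ht0 htT)
  filter_upwards [hev] with q hq
  have h3 := hglob q.1 q.2 ⟨hq.1.le, hq.2.le⟩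
  have h4 : (max 0 (q.2 - t1)) ^ 2 ≤ (max 0 (t - t1)) ^ 2 + 2 * max 0 (t - t1) * (q.2 - t) + (q.2 - t) ^ 2 := by
    rcases le_total 0 (q.2 - t1) with h5 | h5 <;> rcases le_total 0 (t - t1) with h6 | h6
    · rw [max_eq_right h5, max_eq_right h6]; nlinarith
    · rw [max_eq_right h5, max_eq_left h6]; nlinarith
    · rw [max_eq_left h5, max_eq_right h6]; nlinarith
    · rw [max_eq_left h5, max_eq_left h6]; nlinarith
  have h5 := mul_le_mul_of_nonneg_left h4 hm0.le
  simp only [hg] at h3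
  nlinarith

variable {f : (EuclideanSpace ℝ (Fin n)) → ℝ} {u : (EuclideanSpace ℝ (Fin n)) → ℝ → ℝ}

lemma barrier_sub (hu : ParabSubsol f univ u)
    (hucont : ContinuousOn (fun p : (EuclideanSpace ℝ (Fin n)) × ℝ => u p.1 p.2) (univ ×ˢ Ici 0))
    (hub : ∀ T > (0 : ℝ), ∃ M : ℝ, ∀ x : (EuclideanSpace ℝ (Fin n)), ∀ t ∈ Icc (0 : ℝ) T, |u x t| ≤ M)
    (hinit : ∀ x, u x 0 = 0) {ψ : (EuclideanSpace ℝ (Fin n)) → ℝ → ℝ} (hψ : Continuous (fun p : (EuclideanSpace ℝ (Fin n)) × ℝ => ψ p.1 p.2))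
    (hψ0 : ∀ x, 0 ≤ ψ x 0) (hco : ∃ κ > 0, ∃ C ≥ 0, ∀ x t, 0 ≤ t → κ * ‖x‖ - C * (1 + t) ≤ ψ x t)
    (hj : ∀ x t, 0 < t → ∃ (p : (EuclideanSpace ℝ (Fin n))) (θ C : ℝ) (X : (EuclideanSpace ℝ (Fin n)) →L[ℝ] (EuclideanSpace ℝ (Fin n))), (∀ a b, ⟪X a, b⟫ = ⟪a, X b⟫) ∧
      (∀ᶠ q : (EuclideanSpace ℝ (Fin n)) × ℝ in 𝓝 (x, t), ψ q.1 q.2 ≤ ψ x t + θ * (q.2 - t) + ⟪p, q.1 - x⟫ +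
        1 / 2 * ⟪X (q.1 - x), q.1 - x⟫ + C * (q.2 - t) ^ 2) ∧
      ∀ η : (EuclideanSpace ℝ (Fin n)), ‖η‖ ≤ 1 → ‖p‖ • η = p → f x ≤ θ - (trProj X η + ‖p‖)) :
    ∀ x t, 0 ≤ t → u x t ≤ ψ x t := by
  intro x1 t1 ht1
  by_contra hcon
  obtain ⟨κ, hκ, C0, hC0, hco⟩ := hco
  obtain ⟨x, t, θ, C, ht, hθ, hev⟩ := max_point (w := fun x t => u x t - ψ x t) (hucont.sub hψ.continuousOn)
    (fun x => by simpa [hinit] using hψ0 x) (fun T hT => by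
      obtain ⟨M, hM⟩ := hub T hT
      refine ⟨κ, hκ, M + C0 * (1 + T), fun x t ht => ?_⟩
      have h1 := hco x t ht.1
      have h2 := (abs_le.mp (hM x t ht)).2
      have h3 : C0 * (1 + t) ≤ C0 * (1 + T) := by gcongr; exact ht.2
      linarith) ht1 (by simpa using not_le.mp hcon)
  obtain ⟨p, θ', C', X, hX, hev', hη⟩ := hj x t ht
  obtain ⟨η, h1, h2, h3⟩ := jet_sub hu (θ := θ + θ') (C := C + C') (p := p) ht hX (by
    filter_upwards [hev, hev'] with q hq hq'
    linarith)
  have := hη η h1 h2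
  linarith

lemma barrier_super (hu : ParabSupersol f univ u)
    (hucont : ContinuousOn (fun p : (EuclideanSpace ℝ (Fin n)) × ℝ => u p.1 p.2) (univ ×ˢ Ici 0))
    (hub : ∀ T > (0 : ℝ), ∃ M : ℝ, ∀ x : (EuclideanSpace ℝ (Fin n)), ∀ t ∈ Icc (0 : ℝ) T, |u x t| ≤ M)
    (hinit : ∀ x, u x 0 = 0) {ψ : (EuclideanSpace ℝ (Fin n)) → ℝ → ℝ} (hψ : Continuous (fun p : (EuclideanSpace ℝ (Fin n)) × ℝ => ψ p.1 p.2))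
    (hψ0 : ∀ x, ψ x 0 ≤ 0) (hco : ∃ κ > 0, ∃ C ≥ 0, ∀ x t, 0 ≤ t → ψ x t ≤ C * (1 + t) - κ * ‖x‖)
    (hj : ∀ x t, 0 < t → ∃ (p : (EuclideanSpace ℝ (Fin n))) (θ C : ℝ) (X : (EuclideanSpace ℝ (Fin n)) →L[ℝ] (EuclideanSpace ℝ (Fin n))), (∀ a b, ⟪X a, b⟫ = ⟪a, X b⟫) ∧
      (∀ᶠ q : (EuclideanSpace ℝ (Fin n)) × ℝ in 𝓝 (x, t), ψ x t + θ * (q.2 - t) + ⟪p, q.1 - x⟫ +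
        1 / 2 * ⟪X (q.1 - x), q.1 - x⟫ + C * (q.2 - t) ^ 2 ≤ ψ q.1 q.2) ∧
      ∀ η : (EuclideanSpace ℝ (Fin n)), ‖η‖ ≤ 1 → ‖p‖ • η = p → θ - (trProj X η + ‖p‖) ≤ f x) :
    ∀ x t, 0 ≤ t → ψ x t ≤ u x t := by
  intro x1 t1 ht1
  by_contra hcon
  obtain ⟨κ, hκ, C0, hC0, hco⟩ := hco
  obtain ⟨x, t, θ, C, ht, hθ, hev⟩ := max_point (w := fun x t => ψ x t - u x t) (hψ.continuousOn.sub hucont)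
    (fun x => by simpa [hinit] using hψ0 x) (fun T hT => by
      obtain ⟨M, hM⟩ := hub T hT
      refine ⟨κ, hκ, M + C0 * (1 + T), fun x t ht => ?_⟩
      have h1 := hco x t ht.1
      have h2 := (abs_le.mp (hM x t ht)).1
      have h3 : C0 * (1 + t) ≤ C0 * (1 + T) := by gcongr; exact ht.2
      linarith) ht1 (by simpa using not_le.mp hcon)
  obtain ⟨p, θ', C', X, hX, hev', hη⟩ := hj x t ht
  obtain ⟨η, h1, h2, h3⟩ := jet_super hu (θ := θ' - θ) (C := C' - C) (p := p) ht hX (by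
    filter_upwards [hev, hev'] with q hq hq'
    linarith)
  have := hη η h1 h2
  linarith

lemma smul_id_symm (k : ℝ) (a b : (EuclideanSpace ℝ (Fin n))) : ⟪(k • ContinuousLinearMap.id ℝ (EuclideanSpace ℝ (Fin n))) a, b⟫ = ⟪a, (k • ContinuousLinearMap.id ℝ (EuclideanSpace ℝ (Fin n))) b⟫ := by
  simp [inner_smul_left, inner_smul_right]

lemma sqrt_add_le {A B : ℝ} (hA : 0 < A) (hAB : 0 ≤ A + B) : √(A + B) ≤ √A + B / (2 * √A) := by
  have h1 := Real.sqrt_pos.mpr hA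
  have h2 := Real.sq_sqrt hA.le
  have h3 := Real.sq_sqrt hAB
  have h4 := Real.sqrt_nonneg (A + B)
  have h5 : B / (2 * √A) = (√(A + B) ^ 2 - √A ^ 2) / (2 * √A) := by rw [h2, h3]; ring
  rw [h5, ← sub_le_iff_le_add', le_div_iff₀ (by positivity)]
  nlinarith [sq_nonneg (√(A + B) - √A)]

lemma jap (x y : (EuclideanSpace ℝ (Fin n))) : √(1 + ‖y‖ ^ 2) ≤ √(1 + ‖x‖ ^ 2) + ⟪(√(1 + ‖x‖ ^ 2))⁻¹ • x, y - x⟫ +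
    1 / 2 * ⟪((√(1 + ‖x‖ ^ 2))⁻¹ • ContinuousLinearMap.id ℝ (EuclideanSpace ℝ (Fin n))) (y - x), y - x⟫ := by
  have h1 : ‖y‖ ^ 2 = ‖x‖ ^ 2 + 2 * ⟪x, y - x⟫ + ‖y - x‖ ^ 2 := by
    have := norm_add_sq_real x (y - x)
    rwa [add_sub_cancel] at this
  have h2 : 1 + ‖y‖ ^ 2 = (1 + ‖x‖ ^ 2) + (2 * ⟪x, y - x⟫ + ‖y - x‖ ^ 2) := by rw [h1]; ring
  have h3 := sqrt_add_le (A := 1 + ‖x‖ ^ 2) (B := 2 * ⟪x, y - x⟫ + ‖y - x‖ ^ 2) (by positivity) (by rw [← h2]; positivity)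
  rw [← h2] at h3
  have h0 : 0 < √(1 + ‖x‖ ^ 2) := Real.sqrt_pos.mpr (by positivity)
  refine h3.trans (le_of_eq ?_)
  simp only [ContinuousLinearMap.smul_apply, ContinuousLinearMap.id_apply, inner_smul_left, real_inner_self_eq_norm_sq, conj_trivial]
  field_simp
  ring

lemma jap_cont : Continuous (fun x : (EuclideanSpace ℝ (Fin n)) => √(1 + ‖x‖ ^ 2)) := by fun_prop

lemma jap_ge (x : (EuclideanSpace ℝ (Fin n))) : ‖x‖ ≤ √(1 + ‖x‖ ^ 2) := Real.le_sqrt_of_sq_le (by linarith)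
lemma jap_one (x : (EuclideanSpace ℝ (Fin n))) : 1 ≤ √(1 + ‖x‖ ^ 2) := by
  rw [Real.one_le_sqrt]; nlinarith [sq_nonneg ‖x‖]
lemma jap_p (x : (EuclideanSpace ℝ (Fin n))) : ‖(√(1 + ‖x‖ ^ 2))⁻¹ • x‖ ≤ 1 := by
  have h0 : 0 < √(1 + ‖x‖ ^ 2) := Real.sqrt_pos.mpr (by positivity)
  rw [norm_smul, norm_inv, Real.norm_eq_abs, abs_of_pos h0, inv_mul_le_iff₀ h0, mul_one]
  exact jap_ge x

lemma u_le (hu : ParabSubsol f univ u)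
    (hucont : ContinuousOn (fun p : (EuclideanSpace ℝ (Fin n)) × ℝ => u p.1 p.2) (univ ×ˢ Ici 0))
    (hub : ∀ T > (0 : ℝ), ∃ M : ℝ, ∀ x : (EuclideanSpace ℝ (Fin n)), ∀ t ∈ Icc (0 : ℝ) T, |u x t| ≤ M)
    (hinit : ∀ x, u x 0 = 0) {c : ℝ} (hc0 : 0 ≤ c) (hfc : ∀ x, f x ≤ c) :
    ∀ x t, 0 ≤ t → u x t ≤ c * t := by
  have key : ∀ κ > 0, ∀ x t, 0 ≤ t → u x t ≤ (c + κ * (n + 1)) * t + κ * √(1 + ‖x‖ ^ 2) := by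
    intro κ hκ
    refine barrier_sub hu hucont hub hinit (ψ := fun x t => (c + κ * (n + 1)) * t + κ * √(1 + ‖x‖ ^ 2)) (by fun_prop)
      (fun x => by positivity) ⟨κ, hκ, 0, le_rfl, fun x t ht => ?_⟩ (fun x t ht => ?_)
    · have := jap_ge x
      have : 0 ≤ (c + κ * (n + 1)) * t := by positivity
      nlinarith
    · refine ⟨κ • ((√(1 + ‖x‖ ^ 2))⁻¹ • x), c + κ * (n + 1), 0, (κ * (√(1 + ‖x‖ ^ 2))⁻¹) • ContinuousLinearMap.id ℝ (EuclideanSpace ℝ (Fin n)),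
        smul_id_symm _, Eventually.of_forall fun q => ?_, fun η hη _ => ?_⟩
      · have h1 := mul_le_mul_of_nonneg_left (jap x q.1) hκ.le
        simp only [ContinuousLinearMap.smul_apply, ContinuousLinearMap.id_apply, inner_smul_left, conj_trivial] at h1 ⊢
        nlinarith
      · rw [trProj_smul_id, norm_smul, Real.norm_eq_abs, abs_of_pos hκ]
        have h1 := jap_p x
        have h2 : (√(1 + ‖x‖ ^ 2))⁻¹ ≤ 1 := inv_le_one_of_one_le₀ (jap_one x)
        have h3 : (√(1 + ‖x‖ ^ 2))⁻¹ * (n - ‖η‖ ^ 2) ≤ 1 * n := by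
          have h0 : 0 ≤ (√(1 + ‖x‖ ^ 2))⁻¹ := by positivity
          have : (0 : ℝ) ≤ n := n.cast_nonneg
          nlinarith [sq_nonneg ‖η‖, mul_nonneg h0 (sq_nonneg ‖η‖)]
        nlinarith [hfc x]
  intro x t ht
  refine le_of_forall_pos_le_add fun ε hε => ?_
  have h0 : 0 < (n + 1) * t + √(1 + ‖x‖ ^ 2) := by
    have := jap_one x
    positivity
  have h1 := key (ε / ((n + 1) * t + √(1 + ‖x‖ ^ 2))) (by positivity) x t ht
  have h2 : ε / ((n + 1) * t + √(1 + ‖x‖ ^ 2)) * ((n + 1) * t + √(1 + ‖x‖ ^ 2)) = ε := by field_simp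
  nlinarith

lemma u_ge (hu : ParabSupersol f univ u)
    (hucont : ContinuousOn (fun p : (EuclideanSpace ℝ (Fin n)) × ℝ => u p.1 p.2) (univ ×ˢ Ici 0))
    (hub : ∀ T > (0 : ℝ), ∃ M : ℝ, ∀ x : (EuclideanSpace ℝ (Fin n)), ∀ t ∈ Icc (0 : ℝ) T, |u x t| ≤ M)
    (hinit : ∀ x, u x 0 = 0) (hf0 : ∀ x, 0 ≤ f x) :
    ∀ x t, 0 ≤ t → 0 ≤ u x t := by
  have key : ∀ κ > 0, ∀ x t, 0 ≤ t → -(κ * n) * t - κ * √(1 + ‖x‖ ^ 2) ≤ u x t := by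
    intro κ hκ
    refine barrier_super hu hucont hub hinit (ψ := fun x t => -(κ * n) * t - κ * √(1 + ‖x‖ ^ 2)) (by fun_prop)
      (fun x => ?_) ⟨κ, hκ, 0, le_rfl, fun x t ht => ?_⟩ (fun x t ht => ?_)
    · have : 0 ≤ κ * √(1 + ‖x‖ ^ 2) := by positivity
      simpa using this
    · have := jap_ge x
      have : 0 ≤ (κ * n) * t := by positivity
      nlinarith
    · refine ⟨(-κ) • ((√(1 + ‖x‖ ^ 2))⁻¹ • x), -(κ * n), 0, (-κ * (√(1 + ‖x‖ ^ 2))⁻¹) • ContinuousLinearMap.id ℝ (EuclideanSpace ℝ (Fin n)),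
        smul_id_symm _, Eventually.of_forall fun q => ?_, fun η hη _ => ?_⟩
      · have h1 := mul_le_mul_of_nonneg_left (jap x q.1) hκ.le
        simp only [ContinuousLinearMap.smul_apply, ContinuousLinearMap.id_apply, inner_smul_left, conj_trivial] at h1 ⊢
        nlinarith
      · rw [trProj_smul_id, norm_smul, Real.norm_eq_abs, abs_neg, abs_of_pos hκ]
        have h1 := norm_nonneg ((√(1 + ‖x‖ ^ 2))⁻¹ • x)
        have h2 : (√(1 + ‖x‖ ^ 2))⁻¹ ≤ 1 := inv_le_one_of_one_le₀ (jap_one x)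
        have h3 : (√(1 + ‖x‖ ^ 2))⁻¹ * (n - ‖η‖ ^ 2) ≤ 1 * n := by
          have h0 : 0 ≤ (√(1 + ‖x‖ ^ 2))⁻¹ := by positivity
          have : (0 : ℝ) ≤ n := n.cast_nonneg
          nlinarith [sq_nonneg ‖η‖, mul_nonneg h0 (sq_nonneg ‖η‖)]
        have h4 := mul_nonneg hκ.le h1
        nlinarith [hf0 x]
  intro x t ht
  refine le_of_forall_pos_le_add fun ε hε => ?_
  have h0 : 0 < n * t + √(1 + ‖x‖ ^ 2) := by
    have := jap_one x
    positivity
  have h1 := key (ε / (n * t + √(1 + ‖x‖ ^ 2))) (by positivity) x t ht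
  have h2 : ε / (n * t + √(1 + ‖x‖ ^ 2)) * (n * t + √(1 + ‖x‖ ^ 2)) = ε := by field_simp
  nlinarith
end Barrier
end VS

open Set Filter Topology
open scoped RealInnerProductSpace
set_option linter.unusedSectionVars false
namespace VS
section Bar3
variable {n : ℕ}

lemma G_exp {δ : ℝ} (hδ : 0 < δ) (a d : ℝ) : (a + d) + √((a + d) ^ 2 + δ ^ 2) ≤
    (a + √(a ^ 2 + δ ^ 2)) + (1 + a / √(a ^ 2 + δ ^ 2)) * d + d ^ 2 / (2 * δ) := by
  have hA : 0 < a ^ 2 + δ ^ 2 := by positivity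
  have h1 := sqrt_add_le (A := a ^ 2 + δ ^ 2) (B := 2 * a * d + d ^ 2) hA (by nlinarith [sq_nonneg (a + d)])
  have e : a ^ 2 + δ ^ 2 + (2 * a * d + d ^ 2) = (a + d) ^ 2 + δ ^ 2 := by ring
  rw [e] at h1
  have h2 : δ ≤ √(a ^ 2 + δ ^ 2) := Real.le_sqrt_of_sq_le (by nlinarith [sq_nonneg a])
  have h3 : d ^ 2 / (2 * √(a ^ 2 + δ ^ 2)) ≤ d ^ 2 / (2 * δ) := by gcongr
  have h0 : 0 < √(a ^ 2 + δ ^ 2) := Real.sqrt_pos.mpr hA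
  have h4 : (2 * a * d + d ^ 2) / (2 * √(a ^ 2 + δ ^ 2)) = a / √(a ^ 2 + δ ^ 2) * d + d ^ 2 / (2 * √(a ^ 2 + δ ^ 2)) := by
    field_simp
  rw [h4] at h1
  linarith

lemma G_facts {δ : ℝ} (hδ : 0 < δ) (a : ℝ) : 0 < 1 + a / √(a ^ 2 + δ ^ 2) ∧ (0 ≤ a → 1 ≤ 1 + a / √(a ^ 2 + δ ^ 2)) ∧
    (a ≤ 0 → (-a) * (1 + a / √(a ^ 2 + δ ^ 2)) ≤ δ) ∧ 0 ≤ a + √(a ^ 2 + δ ^ 2) ∧ 2 * a ≤ a + √(a ^ 2 + δ ^ 2) := by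
  have hA : 0 < a ^ 2 + δ ^ 2 := by positivity
  have h0 : 0 < √(a ^ 2 + δ ^ 2) := Real.sqrt_pos.mpr hA
  have h1 := Real.sq_sqrt hA.le
  have h2 : |a| < √(a ^ 2 + δ ^ 2) := by
    rw [← Real.sqrt_sq_eq_abs]; exact Real.sqrt_lt_sqrt (sq_nonneg a) (by nlinarith [pow_pos hδ 2])
  have h3 := abs_lt.mp h2
  have h4 : √(a ^ 2 + δ ^ 2) ≤ |a| + δ := by
    rw [Real.sqrt_le_left (by positivity)]
    nlinarith [sq_abs a, abs_nonneg a]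
  set q := √(a ^ 2 + δ ^ 2)
  have e : 1 + a / q = (q + a) / q := by field_simp
  rw [e]
  refine ⟨div_pos (by linarith) h0, fun ha => ?_, fun ha => ?_, by linarith, by linarith⟩
  · rw [le_div_iff₀ h0]; linarith
  · rw [← mul_div_assoc, div_le_iff₀ h0]
    rw [abs_of_nonpos ha] at h4
    have h5 : q + a ≤ δ := by linarith
    nlinarith

variable {f : (EuclideanSpace ℝ (Fin n)) → ℝ} {u : (EuclideanSpace ℝ (Fin n)) → ℝ → ℝ}

set_option maxHeartbeats 2000000 in
lemma u_center (hu : ParabSupersol f univ u) (hn : 2 ≤ n)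
    (hucont : ContinuousOn (fun p : (EuclideanSpace ℝ (Fin n)) × ℝ => u p.1 p.2) (univ ×ˢ Ici 0))
    (hub : ∀ T > (0 : ℝ), ∃ M : ℝ, ∀ x : (EuclideanSpace ℝ (Fin n)), ∀ t ∈ Icc (0 : ℝ) T, |u x t| ≤ M)
    (hinit : ∀ x, u x 0 = 0) {c K : ℝ} (hc : 0 ≤ c) (hK : 0 < K) (hfK : ∀ x y, |f x - f y| ≤ K * ‖x - y‖)
    {x0 : (EuclideanSpace ℝ (Fin n))} (hball : ∀ x, ‖x - x0‖ ≤ (n : ℝ) - 1 → f x = c) :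
    ∀ t, 0 ≤ t → c * t ≤ u x0 t := by
  have hn' : (2 : ℝ) ≤ n := by exact_mod_cast hn
  set R : ℝ := n - 1 with hR
  have hR1 : 1 ≤ R := by linarith
  have key : ∀ δ > 0, ∀ x t, 0 ≤ t → (c - 2 * K * n * δ) * t -
      K / 2 * ((‖x - x0‖ ^ 2 - R ^ 2) + √((‖x - x0‖ ^ 2 - R ^ 2) ^ 2 + δ ^ 2)) ≤ u x t := by
    intro δ hδ
    refine barrier_super hu hucont hub hinit (ψ := fun x t => (c - 2 * K * n * δ) * t -
      K / 2 * ((‖x - x0‖ ^ 2 - R ^ 2) + √((‖x - x0‖ ^ 2 - R ^ 2) ^ 2 + δ ^ 2))) (by fun_prop)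
      (fun x => ?_) ⟨2 * K, by positivity, K * (1 + R ^ 2 + 2 * ‖x0‖) + c, by positivity, fun x t ht => ?_⟩ (fun x t ht => ?_)
    · have := (G_facts hδ (‖x - x0‖ ^ 2 - R ^ 2)).2.2.2.1
      simp only [mul_zero, zero_sub, Left.neg_nonpos_iff]
      positivity
    · have h1 := (G_facts hδ (‖x - x0‖ ^ 2 - R ^ 2)).2.2.2.2
      have h2 : ‖x‖ ≤ ‖x - x0‖ + ‖x0‖ := by
        have := norm_add_le (x - x0) x0
        rwa [sub_add_cancel] at this
      have h3 : 2 * ‖x - x0‖ - 1 ≤ ‖x - x0‖ ^ 2 := by nlinarith [sq_nonneg (‖x - x0‖ - 1)]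
      have h4 := mul_le_mul_of_nonneg_left h1 (by positivity : 0 ≤ K / 2)
      have h5 : 0 ≤ 2 * K * n * δ * t := by positivity
      have h6 : K * (2 * ‖x‖ - 2 * ‖x0‖ - 1 - R ^ 2) ≤ K * (‖x - x0‖ ^ 2 - R ^ 2) := by gcongr; linarith
      have h7 : 0 ≤ K * (1 + R ^ 2 + 2 * ‖x0‖) * t := by positivity
      nlinarith only [h1, h2, h3, h4, h5, h6, h7, ht, mul_nonneg hc ht, hK, hc, norm_nonneg x0, sq_nonneg R]
    · set y := x - x0 with hy
      set a := ‖y‖ ^ 2 - R ^ 2 with ha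
      set g := 1 + a / √(a ^ 2 + δ ^ 2) with hg
      obtain ⟨g1, g2, g3, g4, g5⟩ := G_facts hδ a
      rw [← hg] at g1 g2 g3
      set X : (EuclideanSpace ℝ (Fin n)) →L[ℝ] (EuclideanSpace ℝ (Fin n)) := (-(K / 2) * (2 * g + 2 * δ)) • ContinuousLinearMap.id ℝ (EuclideanSpace ℝ (Fin n)) +
        (-(K / 2) * (8 / δ)) • (innerSL ℝ y).smulRight y with hX
      have hXa : ∀ h, X h = (-(K / 2) * (2 * g + 2 * δ)) • h + (-(K / 2) * (8 / δ) * ⟪y, h⟫) • y := by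
        intro h; simp [hX, smul_smul]
      have hXi : ∀ a b, ⟪X a, b⟫ = (-(K / 2) * (2 * g + 2 * δ)) * ⟪a, b⟫ + (-(K / 2) * (8 / δ)) * (⟪y, a⟫ * ⟪y, b⟫) := by
        intro a b; rw [hXa, inner_add_left, inner_smul_left, inner_smul_left]; simp; ring
      have htr : clmTrace X = (-(K / 2) * (2 * g + 2 * δ)) * n + (-(K / 2) * (8 / δ)) * ‖y‖ ^ 2 := by
        unfold clmTrace
        rw [LinearMap.trace_eq_sum_inner _ (EuclideanSpace.basisFun (Fin n) ℝ)]
        have : ∀ i, ⟪(EuclideanSpace.basisFun (Fin n) ℝ) i, X ((EuclideanSpace.basisFun (Fin n) ℝ) i)⟫ =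
            (-(K / 2) * (2 * g + 2 * δ)) + (-(K / 2) * (8 / δ)) * (⟪y, (EuclideanSpace.basisFun (Fin n) ℝ) i⟫ * ⟪(EuclideanSpace.basisFun (Fin n) ℝ) i, y⟫) := by
          intro i
          rw [real_inner_comm, hXi, real_inner_self_eq_norm_sq, (EuclideanSpace.basisFun (Fin n) ℝ).norm_eq_one,
            real_inner_comm y ((EuclideanSpace.basisFun (Fin n) ℝ) i)]
          ring
        refine (Finset.sum_congr rfl fun i _ => this i).trans ?_
        rw [Finset.sum_add_distrib, ← Finset.mul_sum (Finset.univ) (fun i => ⟪y, (EuclideanSpace.basisFun (Fin n) ℝ) i⟫ * ⟪(EuclideanSpace.basisFun (Fin n) ℝ) i, y⟫), OrthonormalBasis.sum_inner_mul_inner, real_inner_self_eq_norm_sq]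
        simp
        ring
      refine ⟨(-(K * g)) • y, c - 2 * K * n * δ, 0, X, fun a b => ?_, ?_, fun η hη hηp => ?_⟩
      · rw [hXi, real_inner_comm (X b) a, hXi, real_inner_comm a b]; ring
      · have hev : ∀ᶠ q : (EuclideanSpace ℝ (Fin n)) × ℝ in 𝓝 (x, t), ‖q.1 - x‖ < δ := by
          have : Tendsto (fun q : (EuclideanSpace ℝ (Fin n)) × ℝ => ‖q.1 - x‖) (𝓝 (x, t)) (𝓝 ‖x - x‖) :=
            ((continuous_fst.sub continuous_const).norm).continuousAt
          rw [sub_self, norm_zero] at this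
          exact this.eventually (gt_mem_nhds hδ)
        filter_upwards [hev] with q hq
        set h := q.1 - x with hh
        have e1 : q.1 - x0 = y + h := by rw [hy, hh]; abel
        have e2 : ‖q.1 - x0‖ ^ 2 - R ^ 2 = a + (2 * ⟪y, h⟫ + ‖h‖ ^ 2) := by
          rw [e1, norm_add_sq_real, ha]; ring
        have h1 := G_exp hδ a (2 * ⟪y, h⟫ + ‖h‖ ^ 2)
        rw [← hg] at h1
        have h2 : (2 * ⟪y, h⟫ + ‖h‖ ^ 2) ^ 2 / (2 * δ) ≤ 4 / δ * ⟪y, h⟫ ^ 2 + δ * ‖h‖ ^ 2 := by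
          rw [div_le_iff₀ (by positivity)]
          have e3 : (4 / δ * ⟪y, h⟫ ^ 2 + δ * ‖h‖ ^ 2) * (2 * δ) = 8 * ⟪y, h⟫ ^ 2 + 2 * δ ^ 2 * ‖h‖ ^ 2 := by
            field_simp; ring
          rw [e3]
          have h3 : ‖h‖ ^ 2 ≤ δ ^ 2 := by gcongr
          have h4 : ‖h‖ ^ 2 * ‖h‖ ^ 2 ≤ δ ^ 2 * ‖h‖ ^ 2 := by gcongr
          nlinarith only [h3, h4, sq_nonneg (2 * ⟪y, h⟫ - ‖h‖ ^ 2)]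
        have h5 : K / 2 * ((a + (2 * ⟪y, h⟫ + ‖h‖ ^ 2)) + √((a + (2 * ⟪y, h⟫ + ‖h‖ ^ 2)) ^ 2 + δ ^ 2)) ≤
          K / 2 * ((a + √(a ^ 2 + δ ^ 2)) + g * (2 * ⟪y, h⟫ + ‖h‖ ^ 2) + (4 / δ * ⟪y, h⟫ ^ 2 + δ * ‖h‖ ^ 2)) := by
          refine mul_le_mul_of_nonneg_left ?_ (by positivity)
          linarith
        rw [e2, hXi, real_inner_self_eq_norm_sq, inner_smul_left, conj_trivial]
        have e6 : (8 / δ) = 2 * (4 / δ) := by ring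
        rw [e6]
        linarith only [h5]
      · unfold trProj
        rw [htr, hXi, real_inner_self_eq_norm_sq]
        have hKg : 0 < K * g := by positivity
        have hnp : ‖(-(K * g)) • y‖ = K * g * ‖y‖ := by
          rw [norm_smul, Real.norm_eq_abs, abs_neg, abs_of_pos hKg]
        rw [hnp] at hηp ⊢
        have e1 : ‖y‖ • η = - y := by
          have : (K * g) • (‖y‖ • η) = (K * g) • (-y) := by
            rw [smul_smul, hηp, smul_neg, neg_smul]
          exact smul_right_injective _ hKg.ne' this
        have hyi : ⟪y, η⟫ * ⟪y, η⟫ = ‖y‖ ^ 2 ∧ (‖y‖ ≠ 0 → ‖η‖ = 1) := by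
          by_cases hy0 : ‖y‖ = 0
          · rw [norm_eq_zero] at hy0
            simp [hy0]
          · have e2 : ‖y‖ * ‖η‖ = ‖y‖ := by
              have := congrArg norm e1
              rwa [norm_smul, norm_norm, norm_neg] at this
            have e3 : ‖η‖ = 1 := by
              field_simp at e2; exact e2
            refine ⟨?_, fun _ => e3⟩
            have e4 : ‖y‖ * ⟪y, η⟫ = - ‖y‖ ^ 2 := by
              rw [← inner_smul_right, e1, inner_neg_right, real_inner_self_eq_norm_sq]
            have e5 : ⟪y, η⟫ = - ‖y‖ := by
              have : ‖y‖ * ⟪y, η⟫ = ‖y‖ * (-‖y‖) := by rw [e4]; ring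
              exact mul_left_cancel₀ hy0 this
            rw [e5]; ring
        rw [hyi.1]
        have hgoal : c - f x ≤ 2 * K * n * δ + K * (g * ‖y‖ - (g + δ) * (n - ‖η‖ ^ 2)) → c - 2 * K * ↑n * δ -
      (-(K / 2) * (2 * g + 2 * δ) * ↑n + -(K / 2) * (8 / δ) * ‖y‖ ^ 2 -
          (-(K / 2) * (2 * g + 2 * δ) * ‖η‖ ^ 2 + -(K / 2) * (8 / δ) * ‖y‖ ^ 2) +
        K * g * ‖y‖) ≤ f x := by
          intro h; linarith only [h]
        apply hgoal
        by_cases hy0 : ‖y‖ = 0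
        · have hf : f x = c := hball x (by rw [hy0]; linarith)
          rw [hf, hy0, sub_self, mul_zero]
          have hgd : g ≤ δ := by
            have := g3 (by rw [ha, hy0]; nlinarith)
            rw [ha, hy0] at this
            have hRR : 1 ≤ R ^ 2 := by nlinarith only [hR1]
            have := mul_le_mul_of_nonneg_left hRR g1.le
            linarith
          have h1 : (g + δ) * (n - ‖η‖ ^ 2) ≤ (2 * δ) * n := by
            have : (g + δ) * (n - ‖η‖ ^ 2) ≤ (g + δ) * n := by
              gcongr; linarith only [sq_nonneg ‖η‖]
            nlinarith only [this, hgd, hn', hδ]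
          nlinarith only [h1, hK, mul_le_mul_of_nonneg_left h1 hK.le]
        · rw [hyi.2 hy0]
          rcases le_total R ‖y‖ with hr | hr
          · have h1 := g2 (by rw [ha]; nlinarith only [hr, hR1])
            have h2 : c - f x ≤ K * (‖y‖ - R) := by
              set x' := x0 + (R / ‖y‖) • y with hx'
              have hyp : 0 < ‖y‖ := by positivity
              have h3 : f x' = c := hball x' (by
                rw [hx', add_sub_cancel_left, norm_smul, Real.norm_eq_abs, abs_of_nonneg (by positivity)]
                field_simp; rfl)
              have h4 : ‖x - x'‖ = ‖y‖ - R := by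
                have : x - x' = (1 - R / ‖y‖) • y := by rw [hx', sub_smul, one_smul, hy]; abel
                rw [this, norm_smul, Real.norm_eq_abs, abs_of_nonneg]
                · field_simp
                · rw [sub_nonneg, div_le_one hyp]; exact hr
              have h5 := hfK x x'
              rw [h3, h4] at h5
              linarith [(abs_le.mp h5).1]
            have h3 : (‖y‖ - R) ≤ g * (‖y‖ - R) := le_mul_of_one_le_left (by linarith) h1
            have h4 : K * (‖y‖ - R) ≤ K * (g * (‖y‖ - R)) := by gcongr
            have e : g * ‖y‖ - (g + δ) * (n - 1 ^ 2) = g * (‖y‖ - R) - δ * R := by rw [hR]; ring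
            rw [e]
            have h5 : 0 ≤ K * δ * (2 * n - R) := by
              have : 0 ≤ 2 * n - R := by linarith
              positivity
            linarith only [h2, h4, h5]
          · have hf : f x = c := hball x hr
            have h1 := g3 (by rw [ha]; nlinarith only [hr, hR1, norm_nonneg y])
            rw [hf, sub_self]
            have h2 : (R - ‖y‖) ≤ -a := by rw [ha]; nlinarith only [hr, hR1, norm_nonneg y]
            have h3 : (R - ‖y‖) * g ≤ δ := le_trans (by gcongr) h1
            have e : g * ‖y‖ - (g + δ) * (n - 1 ^ 2) = -((R - ‖y‖) * g) - δ * R := by rw [hR]; ring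
            rw [e]
            have h5 : 0 ≤ K * δ * (2 * n - R - 1) := by
              have : 0 ≤ 2 * n - R - 1 := by linarith
              positivity
            linarith only [h5, mul_le_mul_of_nonneg_left h3 hK.le]
  intro t ht
  refine le_of_forall_pos_le_add fun ε hε => ?_
  have h0 : 0 < 2 * K * n * t + K := by positivity
  set δ := ε / (2 * K * n * t + K) with hδ
  have hδ0 : 0 < δ := by positivity
  have h1 := key δ hδ0 x0 t ht
  have h2 : δ * (2 * K * n * t + K) = ε := by rw [hδ]; field_simp
  rw [sub_self, norm_zero] at h1
  have h3 : √((0 ^ 2 - R ^ 2) ^ 2 + δ ^ 2) ≤ R ^ 2 + δ := by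
    rw [Real.sqrt_le_left (by positivity)]
    have : 0 ≤ R ^ 2 * δ := by positivity
    nlinarith only [this]
  have h4 : K / 2 * ((0 ^ 2 - R ^ 2) + √((0 ^ 2 - R ^ 2) ^ 2 + δ ^ 2)) ≤ K / 2 * δ := by
    gcongr; linarith
  linarith only [h1, h2, h3, h4, mul_pos hK hδ0]
end Bar3
end VS

open Set Filter Topology
open scoped RealInnerProductSpace
set_option linter.unusedSectionVars false
namespace VS
section Dbl
abbrev PP (n : ℕ) := WithLp 2 (EuclideanSpace ℝ (Fin n) × ℝ)
abbrev HH (n : ℕ) := WithLp 2 (PP n × PP n)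
variable {n : ℕ}
def mk (x : (EuclideanSpace ℝ (Fin n))) (t : ℝ) (y : (EuclideanSpace ℝ (Fin n))) (s : ℝ) : HH n :=
  WithLp.toLp 2 (WithLp.toLp 2 (x, t), WithLp.toLp 2 (y, s))

lemma mk_inner (x : (EuclideanSpace ℝ (Fin n))) (t : ℝ) (y : (EuclideanSpace ℝ (Fin n))) (s : ℝ) (x' : (EuclideanSpace ℝ (Fin n))) (t' : ℝ) (y' : (EuclideanSpace ℝ (Fin n))) (s' : ℝ) :
    ⟪mk x t y s, mk x' t' y' s'⟫ = ⟪x, x'⟫ + t * t' + (⟪y, y'⟫ + s * s') := by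
  rw [WithLp.prod_inner_apply, WithLp.prod_inner_apply, WithLp.prod_inner_apply]
  simp [mul_comm, mk]

lemma mk_norm (x : (EuclideanSpace ℝ (Fin n))) (t : ℝ) (y : (EuclideanSpace ℝ (Fin n))) (s : ℝ) : ‖mk x t y s‖ ^ 2 = ‖x‖ ^ 2 + t ^ 2 + (‖y‖ ^ 2 + s ^ 2) := by
  rw [← real_inner_self_eq_norm_sq, mk_inner, real_inner_self_eq_norm_sq, real_inner_self_eq_norm_sq]; ring

lemma mk_add (x : (EuclideanSpace ℝ (Fin n))) (t : ℝ) (y : (EuclideanSpace ℝ (Fin n))) (s : ℝ) (x' : (EuclideanSpace ℝ (Fin n))) (t' : ℝ) (y' : (EuclideanSpace ℝ (Fin n))) (s' : ℝ) :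
    mk x t y s + mk x' t' y' s' = mk (x + x') (t + t') (y + y') (s + s') := rfl
lemma mk_sub (x : (EuclideanSpace ℝ (Fin n))) (t : ℝ) (y : (EuclideanSpace ℝ (Fin n))) (s : ℝ) (x' : (EuclideanSpace ℝ (Fin n))) (t' : ℝ) (y' : (EuclideanSpace ℝ (Fin n))) (s' : ℝ) :
    mk x t y s - mk x' t' y' s' = mk (x - x') (t - t') (y - y') (s - s') := rfl
lemma mk_smul (k : ℝ) (x : (EuclideanSpace ℝ (Fin n))) (t : ℝ) (y : (EuclideanSpace ℝ (Fin n))) (s : ℝ) :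
    k • mk x t y s = mk (k • x) (k * t) (k • y) (k * s) := rfl
lemma mk_inj {x : (EuclideanSpace ℝ (Fin n))} {t : ℝ} {y : (EuclideanSpace ℝ (Fin n))} {s : ℝ} {x' : (EuclideanSpace ℝ (Fin n))} {t' : ℝ} {y' : (EuclideanSpace ℝ (Fin n))} {s' : ℝ}
    (h : mk x t y s = mk x' t' y' s') : x = x' ∧ t = t' ∧ y = y' ∧ s = s' :=
  ⟨congrArg (fun z : HH n => z.fst.fst) h, congrArg (fun z : HH n => z.fst.snd) h,
    congrArg (fun z : HH n => z.snd.fst) h, congrArg (fun z : HH n => z.snd.snd) h⟩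
lemma exists_mk (z : HH n) : ∃ x t y s, z = mk x t y s := ⟨z.fst.fst, z.fst.snd, z.snd.fst, z.snd.snd, rfl⟩

lemma mk_norm_le {x : (EuclideanSpace ℝ (Fin n))} {t : ℝ} {y : (EuclideanSpace ℝ (Fin n))} {s R : ℝ} (h : ‖mk x t y s‖ ≤ R) : ‖x‖ ≤ R ∧ |t| ≤ R ∧ ‖y‖ ≤ R ∧ |s| ≤ R := by
  have hR : 0 ≤ R := (norm_nonneg _).trans h
  have h1 : ‖mk x t y s‖ ^ 2 ≤ R ^ 2 := by gcongr
  rw [mk_norm] at h1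
  refine ⟨?_, ?_, ?_, ?_⟩
  · exact abs_le_of_sq_le_sq' (by nlinarith [sq_nonneg t, sq_nonneg ‖y‖, sq_nonneg s]) hR |>.2
  · exact abs_le_of_sq_le_sq (by nlinarith [sq_nonneg ‖x‖, sq_nonneg ‖y‖, sq_nonneg s]) hR
  · exact abs_le_of_sq_le_sq' (by nlinarith [sq_nonneg t, sq_nonneg ‖x‖, sq_nonneg s]) hR |>.2
  · exact abs_le_of_sq_le_sq (by nlinarith [sq_nonneg ‖x‖, sq_nonneg ‖y‖, sq_nonneg t]) hR

/-- block extraction -/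
lemma exists_block (S : HH n →L[ℝ] HH n) (hS : ∀ a b, ⟪S a, b⟫ = ⟪a, S b⟫) (J : (EuclideanSpace ℝ (Fin n)) →ₗ[ℝ] HH n) :
    ∃ X : (EuclideanSpace ℝ (Fin n)) →L[ℝ] (EuclideanSpace ℝ (Fin n)), (∀ a b, ⟪X a, b⟫ = ⟪S (J a), J b⟫) ∧ ∀ a b, ⟪X a, b⟫ = ⟪a, X b⟫ := by
  have h : ∀ a b, ⟪((LinearMap.adjoint J).comp ((S : HH n →ₗ[ℝ] HH n).comp J)) a, b⟫ = ⟪S (J a), J b⟫ := by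
    intro a b
    simp [LinearMap.adjoint_inner_left]
  refine ⟨LinearMap.toContinuousLinearMap ((LinearMap.adjoint J).comp ((S : HH n →ₗ[ℝ] HH n).comp J)), h, ?_⟩
  intro a b
  have h1 := h a b
  have h2 := h b a
  rw [LinearMap.coe_toContinuousLinearMap']
  have h3 := real_inner_comm a (((LinearMap.adjoint J).comp ((S : HH n →ₗ[ℝ] HH n).comp J)) b)
  have h4 := hS (J a) (J b)
  have h5 := real_inner_comm (J a) (S (J b))
  linarith

def J1 : (EuclideanSpace ℝ (Fin n)) →ₗ[ℝ] HH n where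
  toFun x := mk x 0 0 0
  map_add' x y := by simp [mk_add]
  map_smul' k x := by simp [mk_smul]
def J2 : (EuclideanSpace ℝ (Fin n)) →ₗ[ℝ] HH n where
  toFun x := mk 0 0 x 0
  map_add' x y := by simp [mk_add]
  map_smul' k x := by simp [mk_smul]

lemma form_bound (S : HH n →L[ℝ] HH n) (hS : ∀ a b, ⟪S a, b⟫ = ⟪a, S b⟫) (j e : HH n) (α : ℝ) {σ : ℝ} (hσ : 0 < σ) (he : ‖e‖ = 1) :
    ⟪S (j + α • e), j + α • e⟫ ≤ ⟪S j, j⟫ + σ * ‖j‖ ^ 2 + (‖S‖ ^ 2 / σ + ‖S‖) * α ^ 2 := by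
  have e1 : ⟪S (j + α • e), j + α • e⟫ = ⟪S j, j⟫ + 2 * (α * ⟪S j, e⟫) + α ^ 2 * ⟪S e, e⟫ := by
    have h1 := hS e j
    have h2 := real_inner_comm (S j) e
    simp only [map_add, map_smul, inner_add_left, inner_add_right, inner_smul_left, inner_smul_right, conj_trivial]
    rw [h1, h2]; ring
  have a1 := abs_real_inner_le_norm (S j) e
  have a2 := abs_real_inner_le_norm (S e) e
  have a3 := S.le_opNorm j
  have a4 := S.le_opNorm e
  rw [he, mul_one] at a1 a2
  rw [he, mul_one] at a4
  have b1 : ⟪S e, e⟫ ≤ ‖S‖ := (le_abs_self _).trans (a2.trans a4)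
  have b2 : α * ⟪S j, e⟫ ≤ |α| * (‖S‖ * ‖j‖) := by
    refine (le_abs_self _).trans ?_
    rw [abs_mul]
    exact mul_le_mul_of_nonneg_left (a1.trans a3) (abs_nonneg α)
  have b3 : 2 * (|α| * (‖S‖ * ‖j‖)) ≤ σ * ‖j‖ ^ 2 + ‖S‖ ^ 2 / σ * α ^ 2 := by
    have e2 : σ * ‖j‖ ^ 2 + ‖S‖ ^ 2 / σ * α ^ 2 - 2 * (|α| * (‖S‖ * ‖j‖)) = σ * (‖j‖ - ‖S‖ * |α| / σ) ^ 2 := by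
      rw [← sq_abs α]; field_simp; ring
    have : 0 ≤ σ * (‖j‖ - ‖S‖ * |α| / σ) ^ 2 := by positivity
    linarith
  have b4 := mul_le_mul_of_nonneg_left b1 (sq_nonneg α)
  rw [e1]; linarith only [b1, b2, b3, b4]

lemma id_form (k : ℝ) (X : (EuclideanSpace ℝ (Fin n)) →L[ℝ] (EuclideanSpace ℝ (Fin n))) (a b : (EuclideanSpace ℝ (Fin n))) : ⟪(X + k • ContinuousLinearMap.id ℝ (EuclideanSpace ℝ (Fin n))) a, b⟫ = ⟪X a, b⟫ + k * ⟪a, b⟫ := by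
  simp [inner_add_left, inner_smul_left]

lemma id_symm (k : ℝ) (X : (EuclideanSpace ℝ (Fin n)) →L[ℝ] (EuclideanSpace ℝ (Fin n))) (hX : ∀ a b, ⟪X a, b⟫ = ⟪a, X b⟫) (a b : (EuclideanSpace ℝ (Fin n))) :
    ⟪(X + k • ContinuousLinearMap.id ℝ (EuclideanSpace ℝ (Fin n))) a, b⟫ = ⟪a, (X + k • ContinuousLinearMap.id ℝ (EuclideanSpace ℝ (Fin n))) b⟫ := by
  simp [inner_add_left, inner_add_right, inner_smul_left, inner_smul_right, hX]

variable {f : (EuclideanSpace ℝ (Fin n)) → ℝ} {u : (EuclideanSpace ℝ (Fin n)) → ℝ → ℝ}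

set_option maxHeartbeats 1000000 in
lemma dbl (hsub : ParabSubsol f univ u) (hsuper : ParabSupersol f univ u)
    (hucont : ContinuousOn (fun p : (EuclideanSpace ℝ (Fin n)) × ℝ => u p.1 p.2) (univ ×ˢ Ici 0))
    {c : ℝ} (hc : 0 ≤ c) (hule : ∀ x t, 0 ≤ t → u x t ≤ c * t) (huge : ∀ x t, 0 ≤ t → 0 ≤ u x t)
    {Ψ : (EuclideanSpace ℝ (Fin n)) → ℝ → (EuclideanSpace ℝ (Fin n)) → ℝ → ℝ} (hΨc : Continuous (fun q : ((EuclideanSpace ℝ (Fin n)) × ℝ) × ((EuclideanSpace ℝ (Fin n)) × ℝ) => Ψ q.1.1 q.1.2 q.2.1 q.2.2))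
    (Px : (EuclideanSpace ℝ (Fin n)) → ℝ → (EuclideanSpace ℝ (Fin n)) → ℝ → (EuclideanSpace ℝ (Fin n))) (Pt : (EuclideanSpace ℝ (Fin n)) → ℝ → (EuclideanSpace ℝ (Fin n)) → ℝ → ℝ) (Py : (EuclideanSpace ℝ (Fin n)) → ℝ → (EuclideanSpace ℝ (Fin n)) → ℝ → (EuclideanSpace ℝ (Fin n))) (Ps : (EuclideanSpace ℝ (Fin n)) → ℝ → (EuclideanSpace ℝ (Fin n)) → ℝ → ℝ)
    (hΨ : ∀ R : ℝ, ∃ C : ℝ, ∀ x t y s a α b β, ‖x‖ ≤ R → |t| ≤ R → ‖y‖ ≤ R → |s| ≤ R → ‖a‖ ≤ R → |α| ≤ R → ‖b‖ ≤ R → |β| ≤ R →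
      Ψ (x + a) (t + α) (y + b) (s + β) ≤ Ψ x t y s + ⟪Px x t y s, a⟫ + Pt x t y s * α + ⟪Py x t y s, b⟫ + Ps x t y s * β
        + C * (‖a‖ ^ 2 + α ^ 2 + ‖b‖ ^ 2 + β ^ 2))
    {ε : ℝ} (hε : 0 < ε) (M : ℝ)
    (hM : ∀ x t y s x' t' y' s', 0 ≤ t' → 0 ≤ s' → u x' t' - u y' s' -
      (‖x - x'‖ ^ 2 + (t - t') ^ 2 + (‖y - y'‖ ^ 2 + (s - s') ^ 2)) / (2 * ε) - Ψ x t y s ≤ M)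
    {x1 : (EuclideanSpace ℝ (Fin n))} {t1 : ℝ} {y1 : (EuclideanSpace ℝ (Fin n))} {s1 : ℝ} (ht1 : 0 ≤ t1) (hs1 : 0 ≤ s1) {κ : ℝ} (hκ : 0 < κ) :
    ∃ (x : (EuclideanSpace ℝ (Fin n))) (t : ℝ) (y : (EuclideanSpace ℝ (Fin n))) (s : ℝ) (x' : (EuclideanSpace ℝ (Fin n))) (t' : ℝ) (y' : (EuclideanSpace ℝ (Fin n))) (s' : ℝ) (ex : (EuclideanSpace ℝ (Fin n))) (et : ℝ) (ey : (EuclideanSpace ℝ (Fin n))) (es : ℝ)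
      (X Y : (EuclideanSpace ℝ (Fin n)) →L[ℝ] (EuclideanSpace ℝ (Fin n))), 0 ≤ t' ∧ 0 ≤ s' ∧ ‖ex‖ ≤ κ ∧ |et| ≤ κ ∧ ‖ey‖ ≤ κ ∧ |es| ≤ κ ∧
      u x1 t1 - u y1 s1 - Ψ x1 t1 y1 s1 - κ ≤ u x' t' - u y' s' -
      (‖x - x'‖ ^ 2 + (t - t') ^ 2 + (‖y - y'‖ ^ 2 + (s - s') ^ 2)) / (2 * ε) - Ψ x t y s ∧
      x' - x = ε • (Px x t y s + ex) ∧ t' - t = ε * (Pt x t y s + et) ∧ y' - y = ε • (Py x t y s + ey) ∧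
      s' - s = ε * (Ps x t y s + es) ∧ (∀ a b, ⟪X a, b⟫ = ⟪a, X b⟫) ∧ (∀ a b, ⟪Y a, b⟫ = ⟪a, Y b⟫) ∧
      (∃ ρ > 0, ∀ a b : (EuclideanSpace ℝ (Fin n)), ‖a‖ ^ 2 + ‖b‖ ^ 2 ≤ ρ ^ 2 → 1 / 2 * ⟪X a, a⟫ + 1 / 2 * ⟪Y b, b⟫ ≤
        Ψ (x + a) t (y + b) s - Ψ x t y s - ⟪Px x t y s, a⟫ - ⟪Py x t y s, b⟫ + 4 * κ * (‖a‖ ^ 2 + ‖b‖ ^ 2)) ∧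
      (0 < t' → ∃ η : (EuclideanSpace ℝ (Fin n)), ‖η‖ ≤ 1 ∧ ‖Px x t y s + ex‖ • η = Px x t y s + ex ∧
        Pt x t y s + et - (trProj X η + ‖Px x t y s + ex‖) ≤ f x') ∧
      (0 < s' → ∃ η : (EuclideanSpace ℝ (Fin n)), ‖η‖ ≤ 1 ∧ ‖-(Py x t y s + ey)‖ • η = -(Py x t y s + ey) ∧
        f y' ≤ -(Ps x t y s + es) - (trProj (-Y) η + ‖-(Py x t y s + ey)‖)) := by
  set D : Set (HH n) := {z | 0 ≤ z.fst.snd ∧ 0 ≤ z.snd.snd} with hDdef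
  have hD : IsClosed D := by
    have c1 : Continuous (fun z : HH n => z.fst.snd) := by fun_prop
    have c2 : Continuous (fun z : HH n => z.snd.snd) := by fun_prop
    exact (isClosed_le continuous_const c1).inter (isClosed_le continuous_const c2)
  set V : HH n → ℝ := fun z => u z.fst.fst z.fst.snd - u z.snd.fst z.snd.snd with hVdef
  have hV : ContinuousOn V D := by
    refine ContinuousOn.sub ?_ ?_
    · refine hucont.comp (f := fun z : HH n => (z.fst.fst, z.fst.snd)) (by fun_prop) ?_
      intro z hz; exact ⟨mem_univ _, hz.1⟩
    · refine hucont.comp (f := fun z : HH n => (z.snd.fst, z.snd.snd)) (by fun_prop) ?_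
      intro z hz; exact ⟨mem_univ _, hz.2⟩
  have hVb : ∀ w ∈ D, V w ≤ 0 + c * ‖w‖ := by
    intro w hw
    obtain ⟨x, t, y, s, rfl⟩ := exists_mk w
    have h1 := hule x t hw.1
    have h2 := huge y s hw.2
    have h3 := (mk_norm_le (le_refl ‖mk x t y s‖)).2.1
    have h4 := mul_le_mul_of_nonneg_left ((le_abs_self t).trans h3) hc
    change u x t - u y s ≤ _
    linarith
  set Ψ' : HH n → ℝ := fun z => Ψ z.fst.fst z.fst.snd z.snd.fst z.snd.snd with hΨ'
  set DΨ : HH n → HH n := fun z => mk (Px z.fst.fst z.fst.snd z.snd.fst z.snd.snd) (Pt z.fst.fst z.fst.snd z.snd.fst z.snd.snd)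
    (Py z.fst.fst z.fst.snd z.snd.fst z.snd.snd) (Ps z.fst.fst z.fst.snd z.snd.fst z.snd.snd) with hDΨ
  have hΨ'c : Continuous Ψ' :=
    hΨc.comp (f := fun z : HH n => ((z.fst.fst, z.fst.snd), (z.snd.fst, z.snd.snd))) (by fun_prop)
  have hsums := sums hD hV hVb hε hΨ'c DΨ (by
    intro R
    obtain ⟨C, hC⟩ := hΨ R
    refine ⟨C, fun z h hz hh => ?_⟩
    obtain ⟨x, t, y, s, rfl⟩ := exists_mk z
    obtain ⟨a, α, b, β, rfl⟩ := exists_mk h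
    obtain ⟨a1, a2, a3, a4⟩ := mk_norm_le hz
    obtain ⟨b1, b2, b3, b4⟩ := mk_norm_le hh
    have := hC x t y s a α b β a1 a2 a3 a4 b1 b2 b3 b4
    rw [mk_norm]
    change Ψ (x + a) (t + α) (y + b) (s + β) ≤ Ψ x t y s + ⟪mk (Px x t y s) (Pt x t y s) (Py x t y s) (Ps x t y s), mk a α b β⟫ + _
    rw [mk_inner]
    linarith) M (by
    intro z w hw
    obtain ⟨x, t, y, s, rfl⟩ := exists_mk z
    obtain ⟨x', t', y', s', rfl⟩ := exists_mk w
    rw [mk_sub, mk_norm]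
    exact hM x t y s x' t' y' s' hw.1 hw.2) (z1 := mk x1 t1 y1 s1) ⟨ht1, hs1⟩ hκ
  obtain ⟨z, w, e, S, hw, he, hval, hzw, hS, hjet, hmat, hsep⟩ := hsums
  obtain ⟨x, t, y, s, rfl⟩ := exists_mk z
  obtain ⟨x', t', y', s', rfl⟩ := exists_mk w
  obtain ⟨ex, et, ey, es, rfl⟩ := exists_mk e
  have hDz : DΨ (mk x t y s) = mk (Px x t y s) (Pt x t y s) (Py x t y s) (Ps x t y s) := rfl
  rw [hDz] at hzw hjet hmat
  set px := Px x t y s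
  set pt := Pt x t y s
  set py := Py x t y s
  set ps := Ps x t y s
  rw [mk_add, mk_sub, mk_smul] at hzw
  obtain ⟨z1, z2, z3, z4⟩ := mk_inj hzw
  obtain ⟨e1, e2, e3, e4⟩ := mk_norm_le he
  rw [mk_sub, mk_norm] at hval
  obtain ⟨X, hX, hXs⟩ := exists_block S hS J1
  obtain ⟨Y, hY, hYs⟩ := exists_block S hS J2
  obtain ⟨ρ1, hρ1, hjet⟩ := hjet (κ / 2) (by positivity)
  refine ⟨x, t, y, s, x', t', y', s', ex, et, ey, es, X + (2 * κ) • ContinuousLinearMap.id ℝ (EuclideanSpace ℝ (Fin n)),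
    Y + (2 * κ) • ContinuousLinearMap.id ℝ (EuclideanSpace ℝ (Fin n)), hw.1, hw.2, e1, e2, e3, e4, hval, z1, z2, z3, z4, ?_, ?_, ?_, ?_, ?_⟩
  · exact id_symm _ X hXs
  · exact id_symm _ Y hYs
  · obtain ⟨ρ, hρ, hmat⟩ := hmat
    refine ⟨ρ, hρ, fun a b hab => ?_⟩
    have h1 := hmat (mk a 0 b 0) (by
      refine abs_le_of_sq_le_sq' ?_ hρ.le |>.2
      rw [mk_norm]; linarith)
    rw [mk_norm, mk_inner] at h1
    have h2 : Ψ' (mk x t y s + mk a 0 b 0) = Ψ (x + a) t (y + b) s := by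
      rw [mk_add]; simp only [add_zero]; rfl
    have h3 : Ψ' (mk x t y s) = Ψ x t y s := rfl
    rw [h2, h3] at h1
    have h4 : 0 ≤ ⟪S (J1 a), J2 b⟫ := by
      apply hsep
      intro k w1 hw1 w2 hw2
      obtain ⟨x3, t3, y3, s3, rfl⟩ := exists_mk w1
      obtain ⟨x4, t4, y4, s4, rfl⟩ := exists_mk w2
      refine ⟨mk x3 t3 y4 s4, ⟨hw1.1, hw2.2⟩, mk x4 t4 y3 s3, ⟨hw2.1, hw1.2⟩, ?_, ?_⟩
      · change (u x3 t3 - u y3 s3) + (u x4 t4 - u y4 s4) ≤ (u x3 t3 - u y4 s4) + (u x4 t4 - u y3 s3)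
        linarith
      · change ‖mk x t y s + (k • mk a 0 0 0 + k • mk 0 0 b 0) - mk x3 t3 y4 s4‖ ^ 2 + ‖mk x t y s - mk x4 t4 y3 s3‖ ^ 2 ≤
          ‖mk x t y s + k • mk a 0 0 0 - mk x3 t3 y3 s3‖ ^ 2 + ‖mk x t y s + k • mk 0 0 b 0 - mk x4 t4 y4 s4‖ ^ 2
        simp only [mk_smul, mk_add, mk_sub, mk_norm, smul_zero, mul_zero, add_zero, zero_add]
        linarith
    have h5 : ⟪S (mk a 0 b 0), mk a 0 b 0⟫ = ⟪X a, a⟫ + ⟪Y b, b⟫ + 2 * ⟪S (J1 a), J2 b⟫ := by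
      have : mk a 0 b 0 = J1 a + J2 b := by
        change _ = mk a 0 0 0 + mk 0 0 b 0
        rw [mk_add]; simp
      rw [this, hX, hY]
      have := hS (J2 b) (J1 a)
      have := real_inner_comm (S (J1 a)) (J2 b)
      simp only [map_add, inner_add_left, inner_add_right]
      linarith
    rw [h5] at h1
    rw [id_form, id_form, real_inner_self_eq_norm_sq, real_inner_self_eq_norm_sq]
    linarith only [h1, h4, mul_nonneg hκ.le (sq_nonneg ‖a‖), mul_nonneg hκ.le (sq_nonneg ‖b‖)]
  · intro ht'
    refine jet_sub hsub (C := (‖S‖ ^ 2 / κ + ‖S‖) + κ) ht' ?_ ?_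
    · exact id_symm _ X hXs
    · have hev : ∀ᶠ q : (EuclideanSpace ℝ (Fin n)) × ℝ in 𝓝 (x', t'), ‖mk (q.1 - x') (q.2 - t') 0 0‖ ≤ ρ1 := by
        have hcont : Continuous (fun q : (EuclideanSpace ℝ (Fin n)) × ℝ => ‖mk (q.1 - x') (q.2 - t') 0 0‖) := by
          unfold mk; fun_prop
        have h0 : Tendsto (fun q : (EuclideanSpace ℝ (Fin n)) × ℝ => ‖mk (q.1 - x') (q.2 - t') 0 0‖) (𝓝 (x', t')) (𝓝 ‖mk (x' - x') (t' - t') 0 0‖) := hcont.continuousAt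
        have h1 : ‖mk (x' - x') (t' - t') 0 0‖ = 0 := by
          have := mk_norm (x' - x') (t' - t') 0 0
          simpa using this
        rw [h1] at h0
        exact (h0.eventually (gt_mem_nhds hρ1)).mono fun q hq => hq.le
      have hev2 : ∀ᶠ q : (EuclideanSpace ℝ (Fin n)) × ℝ in 𝓝 (x', t'), 0 < q.2 :=
        continuous_snd.continuousAt.eventually (lt_mem_nhds ht')
      filter_upwards [hev, hev2] with q hq hq2
      set a := q.1 - x' with ha
      set α := q.2 - t' with hα
      have e5 : mk x' t' y' s' + mk a α 0 0 = mk q.1 q.2 y' s' := by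
        rw [mk_add, ha, hα]; simp
      have h1 := hjet (mk a α 0 0) hq (by rw [e5]; exact ⟨hq2.le, hw.2⟩)
      rw [e5, mk_add, mk_inner, mk_norm] at h1
      change u q.1 q.2 - u y' s' ≤ (u x' t' - u y' s') + _ + _ + _ at h1
      have e6 : mk a α 0 0 = J1 a + α • mk (0 : (EuclideanSpace ℝ (Fin n))) 1 0 0 := by
        change _ = mk a 0 0 0 + _
        rw [mk_smul, mk_add]; simp
      have h2 := form_bound S hS (J1 a) (mk (0 : (EuclideanSpace ℝ (Fin n))) 1 0 0) α hκ (by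
        have := mk_norm (0 : (EuclideanSpace ℝ (Fin n))) 1 0 0
        have h3 : ‖mk (0 : (EuclideanSpace ℝ (Fin n))) 1 0 0‖ ^ 2 = 1 := by rw [this]; simp
        nlinarith only [h3, norm_nonneg (mk (0 : (EuclideanSpace ℝ (Fin n))) 1 0 0)])
      rw [← e6, ← hX] at h2
      have e7 : ‖J1 a‖ ^ 2 = ‖a‖ ^ 2 := by
        change ‖mk a 0 0 0‖ ^ 2 = _
        rw [mk_norm]; simp
      rw [e7] at h2
      rw [id_form, real_inner_self_eq_norm_sq]
      simp only [inner_zero_right, mul_zero, add_zero, norm_zero] at h1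
      have h8 : 0 ≤ (‖S‖ ^ 2 / κ + ‖S‖) * α ^ 2 := by positivity
      have h9 : 0 ≤ κ * ‖a‖ ^ 2 := by positivity
      have h10 : 0 ≤ κ * α ^ 2 := by positivity
      linarith only [h1, h2, h8, h9, h10]
  · intro ht'
    refine jet_super hsuper (C := -((‖S‖ ^ 2 / κ + ‖S‖) + κ)) ht' ?_ ?_
    · intro a b
      rw [ContinuousLinearMap.neg_apply, ContinuousLinearMap.neg_apply, inner_neg_left, inner_neg_right, id_symm _ Y hYs]
    · have hev : ∀ᶠ q : (EuclideanSpace ℝ (Fin n)) × ℝ in 𝓝 (y', s'), ‖mk 0 0 (q.1 - y') (q.2 - s')‖ ≤ ρ1 := by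
        have hcont : Continuous (fun q : (EuclideanSpace ℝ (Fin n)) × ℝ => ‖mk 0 0 (q.1 - y') (q.2 - s')‖) := by
          unfold mk; fun_prop
        have h0 : Tendsto (fun q : (EuclideanSpace ℝ (Fin n)) × ℝ => ‖mk 0 0 (q.1 - y') (q.2 - s')‖) (𝓝 (y', s')) (𝓝 ‖mk 0 0 (y' - y') (s' - s')‖) := hcont.continuousAt
        have h1 : ‖mk 0 0 (y' - y') (s' - s')‖ = 0 := by
          have := mk_norm 0 0 (y' - y') (s' - s')
          simpa using this
        rw [h1] at h0
        exact (h0.eventually (gt_mem_nhds hρ1)).mono fun q hq => hq.le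
      have hev2 : ∀ᶠ q : (EuclideanSpace ℝ (Fin n)) × ℝ in 𝓝 (y', s'), 0 < q.2 :=
        continuous_snd.continuousAt.eventually (lt_mem_nhds ht')
      filter_upwards [hev, hev2] with q hq hq2
      set a := q.1 - y' with ha
      set α := q.2 - s' with hα
      have e5 : mk x' t' y' s' + mk 0 0 a α = mk x' t' q.1 q.2 := by
        rw [mk_add, ha, hα]; simp
      have h1 := hjet (mk 0 0 a α) hq (by rw [e5]; exact ⟨hw.1, hq2.le⟩)
      rw [e5, mk_add, mk_inner, mk_norm] at h1
      change u x' t' - u q.1 q.2 ≤ (u x' t' - u y' s') + _ + _ + _ at h1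
      have e6 : mk 0 0 a α = J2 a + α • mk (0 : (EuclideanSpace ℝ (Fin n))) 0 0 1 := by
        change _ = mk 0 0 a 0 + _
        rw [mk_smul, mk_add]; simp
      have h2 := form_bound S hS (J2 a) (mk (0 : (EuclideanSpace ℝ (Fin n))) 0 0 1) α hκ (by
        have := mk_norm (0 : (EuclideanSpace ℝ (Fin n))) 0 0 1
        have h3 : ‖mk (0 : (EuclideanSpace ℝ (Fin n))) 0 0 1‖ ^ 2 = 1 := by rw [this]; simp
        nlinarith only [h3, norm_nonneg (mk (0 : (EuclideanSpace ℝ (Fin n))) 0 0 1)])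
      rw [← e6, ← hY] at h2
      have e7 : ‖J2 a‖ ^ 2 = ‖a‖ ^ 2 := by
        change ‖mk 0 0 a 0‖ ^ 2 = _
        rw [mk_norm]; simp
      rw [e7] at h2
      rw [ContinuousLinearMap.neg_apply, inner_neg_left, inner_neg_left, id_form, real_inner_self_eq_norm_sq]
      simp only [inner_zero_right, mul_zero, add_zero, norm_zero] at h1
      have h8 : 0 ≤ (‖S‖ ^ 2 / κ + ‖S‖) * α ^ 2 := by positivity
      have h9 : 0 ≤ κ * ‖a‖ ^ 2 := by positivity
      have h10 : 0 ≤ κ * α ^ 2 := by positivity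
      linarith only [h1, h2, h8, h9, h10]
end Dbl
end VS

open Set Filter Topology
open scoped RealInnerProductSpace
set_option linter.unusedSectionVars false
namespace VS
section KF
noncomputable def qf (δ s : ℝ) : ℝ := √(s ^ 2 + δ ^ 4)
noncomputable def kf (δ s : ℝ) : ℝ := √(qf δ s)

lemma qf_sq (δ s : ℝ) : qf δ s ^ 2 = s ^ 2 + δ ^ 4 := Real.sq_sqrt (by positivity)
lemma qf_nonneg (δ s : ℝ) : 0 ≤ qf δ s := Real.sqrt_nonneg _
lemma kf_nonneg (δ s : ℝ) : 0 ≤ kf δ s := Real.sqrt_nonneg _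
lemma kf_sq (δ s : ℝ) : kf δ s ^ 2 = qf δ s := Real.sq_sqrt (qf_nonneg _ _)
lemma qf_ge_del (δ s : ℝ) : δ ^ 2 ≤ qf δ s := by
  refine Real.le_sqrt_of_sq_le ?_
  nlinarith [sq_nonneg s]
lemma qf_ge (δ s : ℝ) : s ≤ qf δ s := by
  refine Real.le_sqrt_of_sq_le ?_
  nlinarith [sq_nonneg (δ ^ 2)]
lemma kf_ge_del (δ s : ℝ) : δ ≤ kf δ s := Real.le_sqrt_of_sq_le (qf_ge_del δ s)
lemma kf_ge (δ r : ℝ) : r ≤ kf δ (r ^ 2) := Real.le_sqrt_of_sq_le (qf_ge δ _)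
lemma qf_le (δ r : ℝ) : qf δ (r ^ 2) ≤ r ^ 2 + δ ^ 2 := by
  refine Real.sqrt_le_iff.2 ⟨by positivity, ?_⟩
  nlinarith [mul_nonneg (sq_nonneg r) (sq_nonneg δ)]
lemma kf_le {δ r : ℝ} (hδ : 0 < δ) (hr : 0 ≤ r) : kf δ (r ^ 2) ≤ r + δ := by
  refine Real.sqrt_le_iff.2 ⟨by positivity, ?_⟩
  nlinarith [qf_le δ r, mul_nonneg hr hδ.le]
lemma kf_add {δ : ℝ} (hδ : 0 < δ) (s d : ℝ) :
    kf δ (s + d) ≤ kf δ s + (2 * s * d + d ^ 2) / (4 * qf δ s * kf δ s) := by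
  have hq : 0 < qf δ s := lt_of_lt_of_le (by positivity) (qf_ge_del δ s)
  have hk : 0 < kf δ s := lt_of_lt_of_le (by positivity) (kf_ge_del δ s)
  have h1 : qf δ (s + d) ≤ qf δ s + (2 * s * d + d ^ 2) / (2 * qf δ s) := by
    have := sqrt_add_le (A := s ^ 2 + δ ^ 4) (B := 2 * s * d + d ^ 2) (by positivity) (by
      have : s ^ 2 + δ ^ 4 + (2 * s * d + d ^ 2) = (s + d) ^ 2 + δ ^ 4 := by ring
      rw [this]; positivity)
    unfold qf
    rw [show (s + d) ^ 2 + δ ^ 4 = s ^ 2 + δ ^ 4 + (2 * s * d + d ^ 2) by ring]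
    exact this
  have h2 := sqrt_add_le (A := qf δ s) (B := (2 * s * d + d ^ 2) / (2 * qf δ s)) hq ((qf_nonneg _ _).trans h1)
  have h3 : kf δ (s + d) ≤ √(qf δ s + (2 * s * d + d ^ 2) / (2 * qf δ s)) := Real.sqrt_le_sqrt h1
  refine h3.trans (h2.trans (le_of_eq ?_))
  change kf δ s + _ / (2 * kf δ s) = _
  field_simp
  ring
/-- the coefficient `2k'` -/
noncomputable def kp (δ r : ℝ) : ℝ := r ^ 2 / (qf δ (r ^ 2) * kf δ (r ^ 2))
lemma qk_ge {δ : ℝ} (hδ : 0 < δ) (s : ℝ) : δ ^ 3 ≤ qf δ s * kf δ s := by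
  calc δ ^ 3 = δ ^ 2 * δ := by ring
    _ ≤ _ := mul_le_mul (qf_ge_del δ s) (kf_ge_del δ s) hδ.le (qf_nonneg _ _)
lemma kp_nonneg (δ r : ℝ) : 0 ≤ kp δ r := by
  have := qf_nonneg δ (r ^ 2); have := kf_nonneg δ (r ^ 2)
  unfold kp; positivity
lemma kp_le {δ : ℝ} (hδ : 0 < δ) (r : ℝ) : kp δ r ≤ r ^ 2 / δ ^ 3 :=
  div_le_div_of_nonneg_left (by positivity) (by positivity) (qk_ge hδ _)
lemma kp_le' {δ : ℝ} (hδ : 0 < δ) (r : ℝ) : kp δ r ≤ 1 / δ := by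
  have h0 : 0 < qf δ (r ^ 2) * kf δ (r ^ 2) := lt_of_lt_of_le (by positivity) (qk_ge hδ _)
  unfold kp
  rw [div_le_div_iff₀ h0 hδ, one_mul]
  exact mul_le_mul (qf_ge δ _) (kf_ge_del δ _) hδ.le (qf_nonneg _ _)
lemma kpr_le {δ r : ℝ} (hδ : 0 < δ) (hr : 0 ≤ r) : kp δ r * r ≤ 1 := by
  have h0 : 0 < qf δ (r ^ 2) * kf δ (r ^ 2) := lt_of_lt_of_le (by positivity) (qk_ge hδ _)
  unfold kp
  rw [div_mul_eq_mul_div, div_le_one h0]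
  exact mul_le_mul (qf_ge δ _) (kf_ge δ _) hr (qf_nonneg _ _)
lemma kpr_ge {δ r : ℝ} (hδ : 0 < δ) (hr : δ ≤ r) : 1 / 2 ≤ kp δ r * r := by
  have h0 : 0 < qf δ (r ^ 2) * kf δ (r ^ 2) := lt_of_lt_of_le (by positivity) (qk_ge hδ _)
  have hr0 : 0 < r := hδ.trans_le hr
  have h1 : qf δ (r ^ 2) ≤ 3 / 2 * r ^ 2 := by
    refine Real.sqrt_le_iff.2 ⟨by positivity, ?_⟩
    have : δ ^ 4 ≤ r ^ 4 := by gcongr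
    nlinarith
  have h2 : kf δ (r ^ 2) ≤ 4 / 3 * r := by
    refine Real.sqrt_le_iff.2 ⟨by positivity, ?_⟩
    nlinarith
  have h3 := mul_le_mul h1 h2 (kf_nonneg _ _) (by positivity)
  unfold kp
  rw [div_mul_eq_mul_div, le_div_iff₀ h0]
  nlinarith
lemma kpr_ge' {δ r r1 R0 : ℝ} (hδ : 0 < δ) (h1 : 0 < r1) (h : r1 ≤ r) (h2 : r ≤ R0) :
    r1 ^ 3 / ((R0 ^ 2 + δ ^ 2) * (R0 + δ)) ≤ kp δ r * r := by
  have h0 : 0 < qf δ (r ^ 2) * kf δ (r ^ 2) := lt_of_lt_of_le (by positivity) (qk_ge hδ _)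
  have hr : 0 < r := h1.trans_le h
  unfold kp
  rw [div_mul_eq_mul_div]
  have a1 : qf δ (r ^ 2) ≤ R0 ^ 2 + δ ^ 2 := (qf_le δ r).trans (by gcongr)
  have a2 : kf δ (r ^ 2) ≤ R0 + δ := (kf_le hδ hr.le).trans (by gcongr)
  refine div_le_div₀ (by positivity) ?_ h0 (mul_le_mul a1 a2 (kf_nonneg _ _) (by positivity))
  calc r1 ^ 3 ≤ r ^ 3 := by gcongr
    _ = r ^ 2 * r := by ring
end KF
section Mat
variable {n : ℕ}

lemma proj_norm_le (η b : (EuclideanSpace ℝ (Fin n))) {a : ℝ} (ha : 2 * a - a ^ 2 * ‖η‖ ^ 2 = 1) :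
    ‖b - (a * ⟪η, b⟫) • η‖ ^ 2 ≤ ‖b‖ ^ 2 := by
  rw [norm_sub_sq_real, inner_smul_right, norm_smul, mul_pow, Real.norm_eq_abs, sq_abs]
  have : ‖b‖ ^ 2 - 2 * (a * ⟪η, b⟫ * ⟪η, b⟫) + (a * ⟪η, b⟫) ^ 2 * ‖η‖ ^ 2 = ‖b‖ ^ 2 - (2 * a - a ^ 2 * ‖η‖ ^ 2) * ⟪η, b⟫ ^ 2 := by ring
  rw [real_inner_comm η b] 
  rw [this, ha]; nlinarith [sq_nonneg ⟪η, b⟫]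

lemma trace_small (X : (EuclideanSpace ℝ (Fin n)) →L[ℝ] (EuclideanSpace ℝ (Fin n))) (hX : ∀ a b, ⟪X a, b⟫ = ⟪a, X b⟫) {B : ℝ} (hB : 0 ≤ B)
    (h : ∀ v, ⟪X v, v⟫ ≤ B * ‖v‖ ^ 2) {η : (EuclideanSpace ℝ (Fin n))} (hη : ‖η‖ ≤ 1) : trProj X η ≤ n * B := by
  obtain ⟨a, _, _, ha⟩ := exists_sqrt_proj η hη
  rw [trProj_eq X hX η ha (EuclideanSpace.basisFun (Fin n) ℝ)]
  calc _ ≤ ∑ i : Fin n, B := by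
        refine Finset.sum_le_sum fun i _ => ?_
        refine (h _).trans ?_
        have h1 := proj_norm_le η (EuclideanSpace.basisFun (Fin n) ℝ i) ha
        rw [(EuclideanSpace.basisFun (Fin n) ℝ).norm_eq_one] at h1
        nlinarith
    _ = _ := by simp

lemma trace_pair (X Y : (EuclideanSpace ℝ (Fin n)) →L[ℝ] (EuclideanSpace ℝ (Fin n))) (hX : ∀ a b, ⟪X a, b⟫ = ⟪a, X b⟫) (hY : ∀ a b, ⟪Y a, b⟫ = ⟪a, Y b⟫)
    {A B C r σ μ : ℝ} (hA : 0 ≤ A) (hB : 0 ≤ B) (hC : 0 ≤ C) (hr : 0 ≤ r) (hσ : 0 ≤ σ) (hμ : 0 ≤ μ) {e η1 η2 : (EuclideanSpace ℝ (Fin n))}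
    (h : ∀ v1 v2, ⟪X v1, v1⟫ + ⟪Y v2, v2⟫ ≤ A * ‖v1 - v2‖ ^ 2 + B * ⟪r • e, v1 - v2⟫ ^ 2 + C * (‖v1‖ ^ 2 + ‖v2‖ ^ 2))
    (h1 : ‖η1‖ = 1) (h2 : ‖η2‖ = 1) (h3 : ‖η1 - e‖ ≤ σ) (h4 : ‖η2 - e‖ ≤ σ) :
    trProj X η1 + (1 + μ) ^ 2 * trProj Y η2 ≤ n * (A * (μ + 4 * σ) ^ 2 + B * (r * σ * (2 + μ)) ^ 2 + C * (1 + (1 + μ) ^ 2)) := by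
  rw [trProj_eq X hX η1 (a := 1) (by rw [h1]; norm_num) (EuclideanSpace.basisFun (Fin n) ℝ),
    trProj_eq Y hY η2 (a := 1) (by rw [h2]; norm_num) (EuclideanSpace.basisFun (Fin n) ℝ), Finset.mul_sum, ← Finset.sum_add_distrib]
  calc _ ≤ ∑ i : Fin n, (A * (μ + 4 * σ) ^ 2 + B * (r * σ * (2 + μ)) ^ 2 + C * (1 + (1 + μ) ^ 2)) := by
        refine Finset.sum_le_sum fun i _ => ?_
        set b := EuclideanSpace.basisFun (Fin n) ℝ i
        have hb : ‖b‖ = 1 := (EuclideanSpace.basisFun (Fin n) ℝ).norm_eq_one i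
        have n1 := proj_norm_le η1 b (a := 1) (by rw [h1]; norm_num)
        have n2 := proj_norm_le η2 b (a := 1) (by rw [h2]; norm_num)
        set w1 := b - (1 * ⟪η1, b⟫) • η1 with hw1
        set w2 := b - (1 * ⟪η2, b⟫) • η2 with hw2
        rw [hb] at n1 n2
        have m1 : ‖w1‖ ≤ 1 := by nlinarith [norm_nonneg w1]
        have m2 : ‖w2‖ ≤ 1 := by nlinarith [norm_nonneg w2]
        have o : ∀ η : (EuclideanSpace ℝ (Fin n)), ‖η‖ = 1 → ‖η - e‖ ≤ σ → ∀ w : (EuclideanSpace ℝ (Fin n)), w = b - (1 * ⟪η, b⟫) • η → ‖w‖ ≤ 1 → |⟪e, w⟫| ≤ σ := by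
          intro η hη hηe w hw hw1
          have o1 : ⟪η, w⟫ = 0 := by
            rw [hw, inner_sub_right, inner_smul_right, real_inner_self_eq_norm_sq, hη]; ring
          have o2 : ⟪e, w⟫ = - ⟪η - e, w⟫ := by rw [inner_sub_left, o1]; ring
          rw [o2, abs_neg]
          refine (abs_real_inner_le_norm _ _).trans ?_
          nlinarith [norm_nonneg (η - e), norm_nonneg w]
        have o1 := o η1 h1 h3 w1 hw1 m1
        have o2 := o η2 h2 h4 w2 hw2 m2
        have d12 : ‖η1 - η2‖ ≤ 2 * σ := by
          have : η1 - η2 = (η1 - e) - (η2 - e) := by abel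
          rw [this]; exact (norm_sub_le _ _).trans (by linarith)
        have d : ‖w1 - w2‖ ≤ 4 * σ := by
          have e1 : w1 - w2 = ⟪η2 - η1, b⟫ • η2 - ⟪η1, b⟫ • (η1 - η2) := by
            rw [hw1, hw2, inner_sub_left]; module
          have i1 := abs_real_inner_le_norm (η2 - η1) b
          have i2 := abs_real_inner_le_norm η1 b
          rw [hb, mul_one, norm_sub_rev] at i1
          rw [hb, h1, mul_one] at i2
          rw [e1]
          refine (norm_sub_le _ _).trans ?_
          rw [norm_smul, norm_smul, Real.norm_eq_abs, Real.norm_eq_abs, h2]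
          nlinarith [norm_nonneg (η1 - η2)]
        have hv : ‖w1 - (1 + μ) • w2‖ ≤ μ + 4 * σ := by
          have e1 : w1 - (1 + μ) • w2 = (w1 - w2) - μ • w2 := by module
          rw [e1]
          refine (norm_sub_le _ _).trans ?_
          rw [norm_smul, Real.norm_eq_abs, abs_of_nonneg hμ]
          nlinarith
        have hd : |⟪r • e, w1 - (1 + μ) • w2⟫| ≤ r * σ * (2 + μ) := by
          rw [inner_smul_left, inner_sub_right, inner_smul_right, conj_trivial, abs_mul, abs_of_nonneg hr, mul_assoc]
          refine mul_le_mul_of_nonneg_left ?_ hr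
          refine (abs_sub _ _).trans ?_
          rw [abs_mul, abs_of_nonneg (by linarith : (0:ℝ) ≤ 1 + μ)]
          nlinarith
        have key := h w1 ((1 + μ) • w2)
        have e3 : ⟪Y ((1 + μ) • w2), (1 + μ) • w2⟫ = (1 + μ) ^ 2 * ⟪Y w2, w2⟫ := by
          rw [map_smul, inner_smul_left, inner_smul_right, conj_trivial]; ring
        rw [e3, norm_smul, mul_pow, Real.norm_eq_abs, sq_abs] at key
        refine key.trans ?_
        have q1 : ‖w1 - (1 + μ) • w2‖ ^ 2 ≤ (μ + 4 * σ) ^ 2 := by gcongr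
        have q2 : ⟪r • e, w1 - (1 + μ) • w2⟫ ^ 2 ≤ (r * σ * (2 + μ)) ^ 2 := by
          rw [← sq_abs]; gcongr
        have q3 : ‖w1‖ ^ 2 + (1 + μ) ^ 2 * ‖w2‖ ^ 2 ≤ 1 + (1 + μ) ^ 2 := by
          nlinarith [sq_nonneg (1 + μ)]
        gcongr
    _ = _ := by simp; ring

lemma eta_near {e ex p η : (EuclideanSpace ℝ (Fin n))} {G κ m : ℝ} (he : ‖e‖ = 1) (hex : ‖ex‖ ≤ κ) (hp : p = G • e + ex) (hη : ‖p‖ • η = p)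
    (hm : 0 < m) (hG : m ≤ G) (hκ : κ ≤ m / 2) : ‖η - e‖ ≤ 4 * κ / m ∧ ‖η‖ = 1 ∧ G - κ ≤ ‖p‖ ∧ ‖p‖ ≤ G + κ := by
  have hG0 : 0 ≤ G := hm.le.trans hG
  have hGe : ‖G • e‖ = G := by rw [norm_smul, he, Real.norm_eq_abs, abs_of_nonneg hG0, mul_one]
  have h1 : ‖p‖ ≤ G + κ := by rw [hp]; exact (norm_add_le _ _).trans (by linarith)
  have h2 : G - κ ≤ ‖p‖ := by
    have : G • e = p - ex := by rw [hp]; abel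
    have h3 := norm_sub_le p ex
    rw [← this, hGe] at h3
    linarith
  have hp0 : 0 < ‖p‖ := by linarith
  refine ⟨?_, ?_, h2, h1⟩
  · have e1 : ‖p‖ • (η - e) = ex + (G - ‖p‖) • e := by
      rw [smul_sub, hη]; nth_rewrite 1 [hp]; module
    have e2 : ‖p‖ * ‖η - e‖ ≤ 2 * κ := by
      have := congrArg norm e1
      rw [norm_smul, norm_norm] at this
      rw [this]
      refine (norm_add_le _ _).trans ?_
      rw [norm_smul, he, mul_one, Real.norm_eq_abs]
      have : |G - ‖p‖| ≤ κ := abs_le.2 ⟨by linarith, by linarith⟩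
      linarith
    rw [le_div_iff₀ hm]
    nlinarith [norm_nonneg (η - e)]
  · have := congrArg norm hη
    rw [norm_smul, norm_norm] at this
    exact mul_left_cancel₀ hp0.ne' (by rw [this, mul_one])

lemma scale_lim {A B C1 C2 h0 : ℝ} (hh : 0 < h0) (h : ∀ h, 0 < h → h ≤ h0 → h ^ 2 * A ≤ h ^ 2 * B + h ^ 3 * C1 + h ^ 4 * C2) : A ≤ B := by
  have hlim : Tendsto (fun h : ℝ => B + h * C1 + h ^ 2 * C2) (𝓝[>] 0) (𝓝 (B + 0 * C1 + 0 ^ 2 * C2)) :=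
    ((by fun_prop : Continuous (fun h : ℝ => B + h * C1 + h ^ 2 * C2)).tendsto 0).mono_left nhdsWithin_le_nhds
  have := ge_of_tendsto hlim (b := A) (by
    have : ∀ᶠ x in 𝓝[>] (0:ℝ), x ∈ Ioc 0 h0 := Ioc_mem_nhdsGT hh
    filter_upwards [this] with x hx
    have h1 := h x hx.1 hx.2
    have : x ^ 2 * A ≤ x ^ 2 * (B + x * C1 + x ^ 2 * C2) := by linarith
    exact le_of_mul_le_mul_left this (by have := hx.1; positivity))
  simpa using this

/-- the expansion of the penalisation -/
lemma kf_expand {δ : ℝ} (hδ : 0 < δ) (d v : (EuclideanSpace ℝ (Fin n))) :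
    kf δ (‖d + v‖ ^ 2) ≤ kf δ (‖d‖ ^ 2) + kp δ ‖d‖ * ⟪d, v⟫ + kp δ ‖d‖ / 2 * ‖v‖ ^ 2 + (2 * ⟪d, v⟫ + ‖v‖ ^ 2) ^ 2 / (4 * δ ^ 3) := by
  have e1 : ‖d + v‖ ^ 2 = ‖d‖ ^ 2 + (2 * ⟪d, v⟫ + ‖v‖ ^ 2) := by rw [norm_add_sq_real]; ring
  rw [e1]
  refine (kf_add hδ _ _).trans ?_
  set q := qf δ (‖d‖ ^ 2) with hq'
  set k := kf δ (‖d‖ ^ 2) with hk'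
  have hqk := qk_ge hδ (‖d‖ ^ 2)
  have hq : 0 < q := lt_of_lt_of_le (by positivity) (qf_ge_del δ _)
  have hk : 0 < k := lt_of_lt_of_le (by positivity) (kf_ge_del δ _)
  have e2 : (2 * ‖d‖ ^ 2 * (2 * ⟪d, v⟫ + ‖v‖ ^ 2) + (2 * ⟪d, v⟫ + ‖v‖ ^ 2) ^ 2) / (4 * q * k) =
    kp δ ‖d‖ * ⟪d, v⟫ + kp δ ‖d‖ / 2 * ‖v‖ ^ 2 + (2 * ⟪d, v⟫ + ‖v‖ ^ 2) ^ 2 / (4 * (q * k)) := by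
    unfold kp
    rw [← hq', ← hk']
    field_simp
    ring
  have e3 : (2 * ⟪d, v⟫ + ‖v‖ ^ 2) ^ 2 / (4 * (q * k)) ≤ (2 * ⟪d, v⟫ + ‖v‖ ^ 2) ^ 2 / (4 * δ ^ 3) :=
    div_le_div_of_nonneg_left (by positivity) (by positivity) (by linarith)
  rw [e2]; linarith

lemma h_expand {c δ : ℝ} (hc : 0 ≤ c) (hδ : 0 < δ) (τ α : ℝ) :
    c * √((τ + α) ^ 2 + δ ^ 2) ≤ c * √(τ ^ 2 + δ ^ 2) + c * τ / √(τ ^ 2 + δ ^ 2) * α + c / (2 * δ) * α ^ 2 := by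
  have hA : 0 < √(τ ^ 2 + δ ^ 2) := Real.sqrt_pos.2 (by positivity)
  have hd : δ ≤ √(τ ^ 2 + δ ^ 2) := Real.le_sqrt_of_sq_le (by nlinarith [sq_nonneg τ])
  have h := sqrt_add_le (A := τ ^ 2 + δ ^ 2) (B := 2 * τ * α + α ^ 2) (by positivity) (by nlinarith [sq_nonneg (τ + α), sq_nonneg δ])
  rw [show τ ^ 2 + δ ^ 2 + (2 * τ * α + α ^ 2) = (τ + α) ^ 2 + δ ^ 2 by ring] at h
  have h2 := mul_le_mul_of_nonneg_left h hc
  have e : c * (√(τ ^ 2 + δ ^ 2) + (2 * τ * α + α ^ 2) / (2 * √(τ ^ 2 + δ ^ 2))) =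
    c * √(τ ^ 2 + δ ^ 2) + c * τ / √(τ ^ 2 + δ ^ 2) * α + c / (2 * √(τ ^ 2 + δ ^ 2)) * α ^ 2 := by
    field_simp; ring
  have h3 : c / (2 * √(τ ^ 2 + δ ^ 2)) * α ^ 2 ≤ c / (2 * δ) * α ^ 2 := by gcongr
  linarith

lemma h_bound {c δ : ℝ} (hc : 0 ≤ c) (hδ : 0 < δ) (τ : ℝ) : |c * τ / √(τ ^ 2 + δ ^ 2)| ≤ c := by
  have hA : 0 < √(τ ^ 2 + δ ^ 2) := Real.sqrt_pos.2 (by positivity)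
  rw [abs_div, abs_of_pos hA, div_le_iff₀ hA, abs_mul, abs_of_nonneg hc]
  exact mul_le_mul_of_nonneg_left (Real.abs_le_sqrt (by nlinarith [sq_nonneg δ])) hc
end Mat
end VS

open Set Filter Topology
open scoped RealInnerProductSpace
set_option linter.unusedSectionVars false
namespace VS
section Core
variable {n : ℕ}
lemma trProj_neg (Y : (EuclideanSpace ℝ (Fin n)) →L[ℝ] (EuclideanSpace ℝ (Fin n))) (η : (EuclideanSpace ℝ (Fin n))) : trProj (-Y) η = - trProj Y η := by
  simp [trProj, clmTrace, inner_neg_left]; ring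

noncomputable def Cb (n : ℕ) (L δ R m : ℝ) : ℝ :=
  2 + 2 * (2 * R + R ^ 2) + n * (L / δ * (8 * R * (4 / m) + 16 * (4 / m)) + 2 * L / δ ^ 3 * (R ^ 2 * (4 / m) * (2 + R) ^ 2) + 8 * (1 + (1 + R) ^ 2))

set_option maxHeartbeats 1000000 in
lemma core (hn : 1 ≤ n) {L δ g c K r R0 r1 r2 κ m : ℝ} {D ex ey η1 η2 : (EuclideanSpace ℝ (Fin n))} {X Y : (EuclideanSpace ℝ (Fin n)) →L[ℝ] (EuclideanSpace ℝ (Fin n))} {θ1 θ2 F1 F2 : ℝ}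
    (hL : 0 < L) (hδ : 0 < δ) (hg : 0 < g) (hc : 0 ≤ c) (hK : 0 ≤ K) (hr : r = ‖D‖) (hR : r ≤ R0)
    (hX : ∀ a b, ⟪X a, b⟫ = ⟪a, X b⟫) (hY : ∀ a b, ⟪Y a, b⟫ = ⟪a, Y b⟫)
    (hmat : ∀ v1 v2, ⟪X v1, v1⟫ + ⟪Y v2, v2⟫ ≤ L * kp δ r * ‖v1 - v2‖ ^ 2 + 2 * L / δ ^ 3 * ⟪D, v1 - v2⟫ ^ 2 + 8 * κ * (‖v1‖ ^ 2 + ‖v2‖ ^ 2))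
    (hex : ‖ex‖ ≤ κ) (hey : ‖ey‖ ≤ κ) (hη1 : ‖η1‖ ≤ 1) (hη2 : ‖η2‖ ≤ 1)
    (hp1 : ‖(L * kp δ r) • D + ex‖ • η1 = (L * kp δ r) • D + ex)
    (hp2 : ‖(L * kp δ r) • D + ey‖ • η2 = (L * kp δ r) • D + ey)
    (hθ : g / 2 ≤ θ1 - θ2) (hθ2 : θ2 ≤ c + κ)
    (h1 : θ1 - (trProj X η1 + ‖(L * kp δ r) • D + ex‖) ≤ F1)
    (h2 : F2 ≤ θ2 + trProj Y η2 - ‖(L * kp δ r) • D + ey‖)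
    (hF2 : 0 ≤ F2) (hF : F1 - F2 ≤ K * r + g / 16)
    (hr1 : 0 < r1) (hr1' : 6 * n * L * r1 ^ 2 / δ ^ 3 + K * r1 ≤ g / 8)
    (hm : m = L * (r1 ^ 3 / ((R0 ^ 2 + δ ^ 2) * (R0 + δ)))) (hκ : 0 < κ) (hκm : κ ≤ m / 4)
    (hκ1 : (16 * n + 2) * κ ≤ g / 16) (hr2' : (2 * c / n + K) * r2 + c / n ^ 2 * r2 ^ 2 ≤ g / 8) (hδr : δ ≤ r2)
    (hL1 : c ≤ L / 2) (hL2 : 2 * c + n * K ≤ L / 2) (hκ2 : κ * Cb n L δ R0 m ≤ g / 16) : False := by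
  have hn0 : (0:ℝ) < n := by exact_mod_cast (by omega : 0 < n)
  have hr0 : 0 ≤ r := hr ▸ norm_nonneg D
  have hR0 : 0 ≤ R0 := hr0.trans hR
  have hkp := kp_nonneg δ r
  set a := L * kp δ r with ha
  have ha0 : 0 ≤ a := by positivity
  by_cases hcase : r ≤ r1
  · -- small r
    have hB0 : (0:ℝ) ≤ 3 * L * r1 ^ 2 / δ ^ 3 + 8 * κ := by positivity
    have hk1 : a ≤ L * r1 ^ 2 / δ ^ 3 := by
      rw [ha, mul_div_assoc]
      refine mul_le_mul_of_nonneg_left ((kp_le hδ r).trans ?_) hL.le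
      gcongr
    have hin : ∀ v : (EuclideanSpace ℝ (Fin n)), 2 * L / δ ^ 3 * ⟪D, v⟫ ^ 2 ≤ 2 * (L * r1 ^ 2 / δ ^ 3) * ‖v‖ ^ 2 := by
      intro v
      have i1 := abs_real_inner_le_norm D v
      have i2 : ⟪D, v⟫ ^ 2 ≤ (r1 * ‖v‖) ^ 2 := by
        rw [← sq_abs]
        have : |⟪D, v⟫| ≤ r1 * ‖v‖ := i1.trans (by rw [← hr]; gcongr)
        gcongr
      calc 2 * L / δ ^ 3 * ⟪D, v⟫ ^ 2 ≤ 2 * L / δ ^ 3 * (r1 * ‖v‖) ^ 2 := by gcongr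
        _ = _ := by ring
    have hTX := trace_small X hX hB0 (by
      intro v
      have h3 := hmat v 0
      have h4 := hin v
      have h5 := mul_le_mul_of_nonneg_right hk1 (sq_nonneg ‖v‖)
      simp only [map_zero, inner_zero_right, sub_zero, norm_zero] at h3
      have : (3 * L * r1 ^ 2 / δ ^ 3 + 8 * κ) * ‖v‖ ^ 2 = L * r1 ^ 2 / δ ^ 3 * ‖v‖ ^ 2 + 2 * (L * r1 ^ 2 / δ ^ 3) * ‖v‖ ^ 2 + 8 * κ * ‖v‖ ^ 2 := by ring
      rw [this]; linarith) hη1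
    have hTY := trace_small Y hY hB0 (by
      intro v
      have h3 := hmat 0 v
      have h4 := hin v
      have h5 := mul_le_mul_of_nonneg_right hk1 (sq_nonneg ‖v‖)
      simp only [map_zero, inner_zero_right, zero_sub, norm_zero, inner_neg_right, norm_neg, neg_sq] at h3
      have : (3 * L * r1 ^ 2 / δ ^ 3 + 8 * κ) * ‖v‖ ^ 2 = L * r1 ^ 2 / δ ^ 3 * ‖v‖ ^ 2 + 2 * (L * r1 ^ 2 / δ ^ 3) * ‖v‖ ^ 2 + 8 * κ * ‖v‖ ^ 2 := by ring
      rw [this]; linarith) hη2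
    have hpp : ‖a • D + ex‖ - ‖a • D + ey‖ ≤ 2 * κ := by
      refine (norm_sub_norm_le _ _).trans ?_
      have : a • D + ex - (a • D + ey) = ex - ey := by abel
      rw [this]; exact (norm_sub_le _ _).trans (by linarith)
    have hKr : K * r ≤ K * r1 := by gcongr
    have e1 : (n:ℝ) * (3 * L * r1 ^ 2 / δ ^ 3 + 8 * κ) = 6 * n * L * r1 ^ 2 / δ ^ 3 / 2 + 8 * n * κ := by ring
    rw [e1] at hTX hTY
    linarith
  · push Not at hcase
    have hrpos : 0 < r := hr1.trans hcase
    have hm0 : 0 < m := by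
      rw [hm]
      have : 0 < R0 + δ := by positivity
      positivity
    set e := r⁻¹ • D with he'
    have he : ‖e‖ = 1 := by
      rw [he', norm_smul, ← hr, Real.norm_eq_abs, abs_of_pos (inv_pos.2 hrpos)]; field_simp
    have hDe : D = r • e := by rw [he', smul_smul, mul_inv_cancel₀ hrpos.ne', one_smul]
    set G := a * r with hG
    have hPG : a • D = G • e := by rw [hDe, smul_smul]
    have hmG : m ≤ G := by
      rw [hm, hG, ha, mul_assoc]
      exact mul_le_mul_of_nonneg_left (kpr_ge' hδ hr1 hcase.le hR) hL.le
    obtain ⟨n1, n2, n3, n4⟩ := eta_near he hex (by rw [hPG]) hp1 hm0 hmG (by linarith)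
    obtain ⟨m1, m2, m3, m4⟩ := eta_near he hey (by rw [hPG]) hp2 hm0 hmG (by linarith)
    set σ := 4 * κ / m with hσ
    have hσ0 : 0 ≤ σ := by positivity
    have hσ1 : σ ≤ 1 := by rw [hσ, div_le_one hm0]; linarith
    set μ := r / n with hμ
    have hμ0 : 0 ≤ μ := by positivity
    have hμR : μ ≤ R0 := by
      rw [hμ, div_le_iff₀ hn0]
      have : (1:ℝ) ≤ n := by exact_mod_cast hn
      nlinarith only [this, hR, hR0]
    have htr := trace_pair X Y hX hY (A := a) (B := 2 * L / δ ^ 3) (C := 8 * κ) ha0 (by positivity) (by positivity) hr0 hσ0 hμ0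
      (by rw [← hDe]; exact hmat) n2 m2 n1 m1
    -- lower bound
    have hlow : F2 - θ2 + ‖a • D + ey‖ ≤ trProj Y η2 := by linarith
    have hlow2 : G - c - 2 * κ ≤ trProj Y η2 := by linarith
    have hlow3 : (2 * μ + μ ^ 2) * (G - c - 2 * κ) ≤ (2 * μ + μ ^ 2) * trProj Y η2 :=
      mul_le_mul_of_nonneg_left hlow2 (by positivity)
    have hsum : g / 2 - 2 * κ - K * r - g / 16 + (2 * μ + μ ^ 2) * (G - c - 2 * κ) ≤ trProj X η1 + (1 + μ) ^ 2 * trProj Y η2 := by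
      have : trProj X η1 + (1 + μ) ^ 2 * trProj Y η2 = trProj X η1 + trProj Y η2 + (2 * μ + μ ^ 2) * trProj Y η2 := by ring
      rw [this]
      have : θ1 - F1 - ‖a • D + ex‖ ≤ trProj X η1 := by linarith
      linarith
    have haL : a ≤ L / δ := by
      rw [ha, div_eq_mul_one_div]; exact mul_le_mul_of_nonneg_left (kp_le' hδ r) hL.le
    have hσs : σ ^ 2 ≤ σ := by nlinarith only [hσ0, hσ1]
    have hup : (n:ℝ) * (a * (μ + 4 * σ) ^ 2 + 2 * L / δ ^ 3 * (r * σ * (2 + μ)) ^ 2 + 8 * κ * (1 + (1 + μ) ^ 2)) + 2 * κ + (2 * μ + μ ^ 2) * (2 * κ)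
        ≤ G * μ + κ * Cb n L δ R0 m := by
      have t1 : a * (μ + 4 * σ) ^ 2 ≤ a * μ ^ 2 + L / δ * (8 * R0 * σ + 16 * σ) := by
        have : (μ + 4 * σ) ^ 2 ≤ μ ^ 2 + (8 * R0 * σ + 16 * σ) := by
          have : μ * σ ≤ R0 * σ := by gcongr
          nlinarith only [this, hσs]
        calc a * (μ + 4 * σ) ^ 2 ≤ a * (μ ^ 2 + (8 * R0 * σ + 16 * σ)) := by gcongr
          _ = a * μ ^ 2 + a * (8 * R0 * σ + 16 * σ) := by ring
          _ ≤ _ := by gcongr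
      have t2 : 2 * L / δ ^ 3 * (r * σ * (2 + μ)) ^ 2 ≤ 2 * L / δ ^ 3 * (R0 ^ 2 * σ * (2 + R0) ^ 2) := by
        have : (r * σ * (2 + μ)) ^ 2 = r ^ 2 * σ ^ 2 * (2 + μ) ^ 2 := by ring
        rw [this]
        gcongr
      have t3 : 8 * κ * (1 + (1 + μ) ^ 2) ≤ 8 * κ * (1 + (1 + R0) ^ 2) := by gcongr
      have t4 : (2 * μ + μ ^ 2) * (2 * κ) ≤ (2 * R0 + R0 ^ 2) * (2 * κ) := by gcongr
      have t5 : (n:ℝ) * (a * μ ^ 2) = G * μ := by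
        rw [hG, hμ]; field_simp
      have t6 : κ * Cb n L δ R0 m = 2 * κ + (2 * R0 + R0 ^ 2) * (2 * κ) + n * (L / δ * (8 * R0 * σ + 16 * σ) + 2 * L / δ ^ 3 * (R0 ^ 2 * σ * (2 + R0) ^ 2) + 8 * κ * (1 + (1 + R0) ^ 2)) := by
        unfold Cb; rw [hσ]; field_simp
      have t7 := mul_le_mul_of_nonneg_left (add_le_add (add_le_add t1 t2) t3) hn0.le
      rw [t6]
      rw [← t5]
      linarith
    have hfin : g / 4 ≤ g / 2 + (2 * μ + μ ^ 2) * (G - c) - K * r - G * μ := by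
      have hG0 : 0 ≤ G := hm0.le.trans hmG
      have e1 : (2 * μ + μ ^ 2) * (G - c) - K * r - G * μ = μ * (G - 2 * c - n * K) + μ ^ 2 * (G - c) := by
        have : K * r = μ * (n * K) := by rw [hμ]; field_simp
        rw [this]; ring
      by_cases h : r ≤ r2
      · have e2 : μ * (2 * c + n * K) + μ ^ 2 * c = (2 * c / n + K) * r + c / n ^ 2 * r ^ 2 := by
          rw [hμ]; field_simp
        have e3 : (2 * c / n + K) * r + c / n ^ 2 * r ^ 2 ≤ (2 * c / n + K) * r2 + c / n ^ 2 * r2 ^ 2 := by gcongr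
        have e4 : 0 ≤ μ * G := by positivity
        have e5 : 0 ≤ μ ^ 2 * G := by positivity
        have e6 : μ * (G - 2 * c - n * K) + μ ^ 2 * (G - c) = μ * G + μ ^ 2 * G - (μ * (2 * c + n * K) + μ ^ 2 * c) := by ring
        linarith
      · push Not at h
        have hGL : L / 2 ≤ G := by
          have := mul_le_mul_of_nonneg_left (kpr_ge hδ (hδr.trans h.le)) hL.le
          rw [hG, ha, mul_assoc]; linarith
        have e4 : 0 ≤ μ * (G - 2 * c - n * K) := mul_nonneg hμ0 (by linarith)
        have e5 : 0 ≤ μ ^ 2 * (G - c) := mul_nonneg (sq_nonneg _) (by linarith)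
        linarith
    have e9 : (2 * μ + μ ^ 2) * (G - c - 2 * κ) = (2 * μ + μ ^ 2) * (G - c) - (2 * μ + μ ^ 2) * (2 * κ) := by ring
    rw [e9] at hsum
    linarith
end Core
end VS

open Set Filter Topology
open scoped RealInnerProductSpace
set_option linter.unusedSectionVars false
namespace VS
section Lip
variable {n : ℕ} {f : (EuclideanSpace ℝ (Fin n)) → ℝ} {u : (EuclideanSpace ℝ (Fin n)) → ℝ → ℝ}

lemma mat_scale {L δ κ ρ : ℝ} (hL : 0 < L) (hδ : 0 < δ) (hρ : 0 < ρ) {X Y : (EuclideanSpace ℝ (Fin n)) →L[ℝ] (EuclideanSpace ℝ (Fin n))} {D : (EuclideanSpace ℝ (Fin n))}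
    (h : ∀ a b : (EuclideanSpace ℝ (Fin n)), ‖a‖ ^ 2 + ‖b‖ ^ 2 ≤ ρ ^ 2 → 1 / 2 * ⟪X a, a⟫ + 1 / 2 * ⟪Y b, b⟫ ≤
      L * (kp δ ‖D‖ / 2 * ‖a - b‖ ^ 2 + (2 * ⟪D, a - b⟫ + ‖a - b‖ ^ 2) ^ 2 / (4 * δ ^ 3)) + 4 * κ * (‖a‖ ^ 2 + ‖b‖ ^ 2)) (v1 v2 : (EuclideanSpace ℝ (Fin n))) :
    ⟪X v1, v1⟫ + ⟪Y v2, v2⟫ ≤ L * kp δ ‖D‖ * ‖v1 - v2‖ ^ 2 + 2 * L / δ ^ 3 * ⟪D, v1 - v2⟫ ^ 2 + 8 * κ * (‖v1‖ ^ 2 + ‖v2‖ ^ 2) := by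
  set N := ‖v1‖ ^ 2 + ‖v2‖ ^ 2 with hN
  have hN0 : 0 ≤ N := by positivity
  refine scale_lim (h0 := ρ / (1 + N)) (C1 := 2 * L / δ ^ 3 * (⟪D, v1 - v2⟫ * ‖v1 - v2‖ ^ 2)) (C2 := L / (2 * δ ^ 3) * ‖v1 - v2‖ ^ 4) (by positivity) ?_
  intro k hk hk2
  have e0 : ‖k • v1‖ ^ 2 + ‖k • v2‖ ^ 2 = k ^ 2 * N := by
    rw [norm_smul, norm_smul, mul_pow, mul_pow, Real.norm_eq_abs, sq_abs]; ring
  have h1 := h (k • v1) (k • v2) (by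
    rw [e0]
    rw [le_div_iff₀ (by positivity)] at hk2
    have : k ^ 2 * N ≤ (k * (1 + N)) ^ 2 := by
      rw [mul_pow]; gcongr; nlinarith
    exact this.trans (by gcongr))
  rw [e0, ← smul_sub, map_smul, map_smul, inner_smul_left, inner_smul_left, inner_smul_right, inner_smul_right, inner_smul_right, norm_smul, mul_pow,
    Real.norm_eq_abs, sq_abs, conj_trivial] at h1
  have e1 : L * (kp δ ‖D‖ / 2 * (k ^ 2 * ‖v1 - v2‖ ^ 2) + (2 * (k * ⟪D, v1 - v2⟫) + k ^ 2 * ‖v1 - v2‖ ^ 2) ^ 2 / (4 * δ ^ 3)) + 4 * κ * (k ^ 2 * N)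
    = 1 / 2 * (k ^ 2 * (L * kp δ ‖D‖ * ‖v1 - v2‖ ^ 2 + 2 * L / δ ^ 3 * ⟪D, v1 - v2⟫ ^ 2 + 8 * κ * N) + k ^ 3 * (2 * L / δ ^ 3 * (⟪D, v1 - v2⟫ * ‖v1 - v2‖ ^ 2)) +
      k ^ 4 * (L / (2 * δ ^ 3) * ‖v1 - v2‖ ^ 4)) := by
    field_simp; ring
  rw [e1] at h1
  linarith

lemma par_r1 {N L δ K g : ℝ} (hN : 0 < N) (hL : 0 < L) (hδ : 0 < δ) (hK : 0 ≤ K) (hg : 0 < g) :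
    ∃ r1 : ℝ, 0 < r1 ∧ 6 * N * L * r1 ^ 2 / δ ^ 3 + K * r1 ≤ g / 8 := by
  set A := 6 * N * L / δ ^ 3 + K with hA
  have hA0 : 0 < A := by positivity
  refine ⟨min 1 (g / (8 * A)), by positivity, ?_⟩
  set r := min 1 (g / (8 * A))
  have hr0 : 0 < r := by positivity
  have h1 : r ≤ 1 := min_le_left _ _
  have h2 : r ≤ g / (8 * A) := min_le_right _ _
  rw [le_div_iff₀ (by positivity)] at h2
  have h3 : r ^ 2 ≤ r := by nlinarith
  calc 6 * N * L * r ^ 2 / δ ^ 3 + K * r ≤ 6 * N * L * r / δ ^ 3 + K * r := by gcongr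
    _ = A * r := by rw [hA]; ring
    _ ≤ g / 8 := by linarith

lemma par_k {m N g B m1 : ℝ} (hm0 : 0 < m) (hN : 0 < N) (hg : 0 < g) (hCb : 0 ≤ B) (hm1p : 0 < m1) :
    ∃ κ : ℝ, 0 < κ ∧ κ ≤ m / 4 ∧ (16 * N + 2) * κ ≤ g / 16 ∧ κ * B ≤ g / 16 ∧ κ ≤ 1 ∧ κ ≤ m1 / 2 ∧ κ ≤ g / 16 := by
  refine ⟨min (min (m / 4) (g / 16 / (16 * N + 2))) (min (g / 16 / (B + 1)) (min 1 (min (m1 / 2) (g / 16)))), by positivity, ?_⟩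
  set κ := min (min (m / 4) (g / 16 / (16 * N + 2))) (min (g / 16 / (B + 1)) (min 1 (min (m1 / 2) (g / 16))))
  have hκ : 0 < κ := by positivity
  have a0 : κ ≤ min (m / 4) (g / 16 / (16 * N + 2)) := min_le_left _ _
  have a1 : κ ≤ min (g / 16 / (B + 1)) (min 1 (min (m1 / 2) (g / 16))) := min_le_right _ _
  have a2 := a1.trans (min_le_right _ _)
  have a3 := a2.trans (min_le_right _ _)
  have b1 := a0.trans (min_le_right _ _)
  have b2 := a1.trans (min_le_left _ _)
  rw [le_div_iff₀ (by positivity)] at b1 b2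
  exact ⟨a0.trans (min_le_left _ _), by linarith, by nlinarith, a2.trans (min_le_left _ _), a3.trans (min_le_left _ _), a3.trans (min_le_right _ _)⟩

lemma par_e {Cp c g m1 K : ℝ} (hCp0 : 0 < Cp) (hc : 0 ≤ c) (hg : 0 < g) (hm1p : 0 < m1) (hK : 0 ≤ K) :
    ∃ ε : ℝ, 0 < ε ∧ ε ≤ 1 ∧ ε * Cp ≤ 1 / 16 ∧ (2 * c + g) * (ε * Cp) ≤ m1 / 4 ∧ 2 * K * (ε * Cp) ≤ g / 16 := by
  refine ⟨min (min 1 (1 / 16 / Cp)) (min (m1 / 4 / ((2 * c + g) * Cp)) (g / 16 / (2 * K * Cp + 1))), by positivity, ?_⟩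
  set ε := min (min 1 (1 / 16 / Cp)) (min (m1 / 4 / ((2 * c + g) * Cp)) (g / 16 / (2 * K * Cp + 1)))
  have hε : 0 < ε := by positivity
  have a0 : ε ≤ min 1 (1 / 16 / Cp) := min_le_left _ _
  have a1 : ε ≤ min (m1 / 4 / ((2 * c + g) * Cp)) (g / 16 / (2 * K * Cp + 1)) := min_le_right _ _
  have b0 := a0.trans (min_le_right _ _)
  have b1 := a1.trans (min_le_left _ _)
  have b2 := a1.trans (min_le_right _ _)
  rw [le_div_iff₀ (by positivity)] at b0 b1 b2
  exact ⟨a0.trans (min_le_left _ _), b0, by linarith, by nlinarith⟩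

lemma psi_num {L c δ g A1 k0 k1 kk I1 I2 V2 Q S1 S2 h' α β t a b E : ℝ}
    (h1 : L * k1 ≤ L * (k0 + kk * (I1 - I2) + kk / 2 * V2 + Q)) (h2 : S1 ≤ S2 + h' * (α - β) + E)
    (w1 : L * (kk / 2 * V2) ≤ L / δ * (a + b)) (w2 : L * Q ≤ A1 * (a + b)) (w3 : E ≤ c / δ * (α ^ 2 + β ^ 2))
    (z1 : 0 ≤ L / δ * (α ^ 2 + β ^ 2)) (z2 : 0 ≤ A1 * (α ^ 2 + β ^ 2)) (z3 : 0 ≤ c / δ * (a + b)) (z4 : 0 ≤ g * (a + b + β ^ 2)) :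
    L * k1 + S1 + g * (t + α + (t + α) ^ 2) ≤ L * k0 + S2 + g * (t + t ^ 2) + L * kk * I1 + (h' + g * (1 + 2 * t)) * α + -(L * kk * I2) + -h' * β
      + (L / δ + A1 + c / δ + g) * (a + α ^ 2 + b + β ^ 2) := by
  linarith
lemma psi_expand {L c δ g : ℝ} (hL : 0 < L) (hc : 0 ≤ c) (hδ : 0 < δ) (hg : 0 < g) (R : ℝ) :
    ∃ C : ℝ, ∀ (x : (EuclideanSpace ℝ (Fin n))) (t : ℝ) (y : (EuclideanSpace ℝ (Fin n))) (s : ℝ) (a : (EuclideanSpace ℝ (Fin n))) (α : ℝ) (b : (EuclideanSpace ℝ (Fin n))) (β : ℝ), ‖x‖ ≤ R → |t| ≤ R → ‖y‖ ≤ R → |s| ≤ R → ‖a‖ ≤ R → |α| ≤ R → ‖b‖ ≤ R → |β| ≤ R →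
      L * kf δ (‖x + a - (y + b)‖ ^ 2) + c * √((t + α - (s + β)) ^ 2 + δ ^ 2) + g * (t + α + (t + α) ^ 2) ≤
      L * kf δ (‖x - y‖ ^ 2) + c * √((t - s) ^ 2 + δ ^ 2) + g * (t + t ^ 2) + ⟪(L * kp δ ‖x - y‖) • (x - y), a⟫
        + (c * (t - s) / √((t - s) ^ 2 + δ ^ 2) + g * (1 + 2 * t)) * α + ⟪-((L * kp δ ‖x - y‖) • (x - y)), b⟫
        + -(c * (t - s) / √((t - s) ^ 2 + δ ^ 2)) * β + C * (‖a‖ ^ 2 + α ^ 2 + ‖b‖ ^ 2 + β ^ 2) := by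
  refine ⟨L / δ + L * (36 * R ^ 2) * 2 / (4 * δ ^ 3) + c / δ + g, ?_⟩
  intro x t y s a α b β hx ht hy hs ha hα hb hβ
  have hR : 0 ≤ R := (norm_nonneg x).trans hx
  have h1 := kf_expand hδ (x - y) (a - b)
  have e1 : x + a - (y + b) = x - y + (a - b) := by abel
  have h2 := h_expand hc hδ (t - s) (α - β)
  have e2 : t + α - (s + β) = t - s + (α - β) := by ring
  have hab : ‖a - b‖ ^ 2 ≤ 2 * (‖a‖ ^ 2 + ‖b‖ ^ 2) := by
    have := norm_sub_le a b
    have : ‖a - b‖ ^ 2 ≤ (‖a‖ + ‖b‖) ^ 2 := by gcongr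
    nlinarith [sq_nonneg (‖a‖ - ‖b‖)]
  have hαβ : (α - β) ^ 2 ≤ 2 * (α ^ 2 + β ^ 2) := by nlinarith [sq_nonneg (α + β)]
  have hq : (2 * ⟪x - y, a - b⟫ + ‖a - b‖ ^ 2) ^ 2 ≤ 36 * R ^ 2 * ‖a - b‖ ^ 2 := by
    have i1 := abs_real_inner_le_norm (x - y) (a - b)
    have i2 : ‖x - y‖ ≤ 2 * R := (norm_sub_le _ _).trans (by linarith)
    have i3 : ‖a - b‖ ≤ 2 * R := (norm_sub_le _ _).trans (by linarith)
    have i4 : |2 * ⟪x - y, a - b⟫ + ‖a - b‖ ^ 2| ≤ 6 * R * ‖a - b‖ := by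
      refine (abs_add_le _ _).trans ?_
      rw [abs_mul, abs_of_pos (by norm_num : (0:ℝ) < 2), abs_of_nonneg (by positivity : 0 ≤ ‖a - b‖ ^ 2)]
      nlinarith [norm_nonneg (a - b)]
    rw [← sq_abs]
    calc _ ≤ (6 * R * ‖a - b‖) ^ 2 := by gcongr
      _ = _ := by ring
  have hkp := kp_le' hδ ‖x - y‖
  have w1 : L * (kp δ ‖x - y‖ / 2 * ‖a - b‖ ^ 2) ≤ L / δ * (‖a‖ ^ 2 + ‖b‖ ^ 2) := by
    calc L * (kp δ ‖x - y‖ / 2 * ‖a - b‖ ^ 2) ≤ L * (1 / δ / 2 * (2 * (‖a‖ ^ 2 + ‖b‖ ^ 2))) := by gcongr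
      _ = _ := by ring
  have w2 : L * ((2 * ⟪x - y, a - b⟫ + ‖a - b‖ ^ 2) ^ 2 / (4 * δ ^ 3)) ≤ L * (36 * R ^ 2) * 2 / (4 * δ ^ 3) * (‖a‖ ^ 2 + ‖b‖ ^ 2) := by
    calc L * ((2 * ⟪x - y, a - b⟫ + ‖a - b‖ ^ 2) ^ 2 / (4 * δ ^ 3)) ≤ L * ((36 * R ^ 2 * (2 * (‖a‖ ^ 2 + ‖b‖ ^ 2))) / (4 * δ ^ 3)) := by
          gcongr; exact hq.trans (by gcongr)
      _ = _ := by ring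
  have w3 : c / (2 * δ) * (α - β) ^ 2 ≤ c / δ * (α ^ 2 + β ^ 2) := by
    calc c / (2 * δ) * (α - β) ^ 2 ≤ c / (2 * δ) * (2 * (α ^ 2 + β ^ 2)) := by gcongr
      _ = _ := by field_simp
  have h1' := mul_le_mul_of_nonneg_left h1 hL.le
  have z1 : 0 ≤ L / δ * (α ^ 2 + β ^ 2) := by positivity
  have z2 : 0 ≤ L * (36 * R ^ 2) * 2 / (4 * δ ^ 3) * (α ^ 2 + β ^ 2) := by positivity
  have z3 : 0 ≤ c / δ * (‖a‖ ^ 2 + ‖b‖ ^ 2) := by positivity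
  have z4 : 0 ≤ g * (‖a‖ ^ 2 + ‖b‖ ^ 2 + β ^ 2) := by positivity
  rw [e1, e2, inner_neg_left, inner_smul_left, inner_smul_left, conj_trivial]
  have e3 : ⟪x - y, a - b⟫ = ⟪x - y, a⟫ - ⟪x - y, b⟫ := inner_sub_right _ _ _
  rw [e3] at w2
  rw [e3] at h1'
  exact psi_num h1' h2 w1 w2 w3 z1 z2 z3 z4
lemma psi_M {L c δ g ε : ℝ} (hL : 0 < L) (hc : 0 ≤ c) (hg : 0 < g) (hε : 0 < ε) (hule : ∀ x t, 0 ≤ t → u x t ≤ c * t) (huge : ∀ x t, 0 ≤ t → 0 ≤ u x t) :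
    ∀ x t y s x' t' y' s', 0 ≤ t' → 0 ≤ s' → u x' t' - u y' s' -
      (‖x - x'‖ ^ 2 + (t - t') ^ 2 + (‖y - y'‖ ^ 2 + (s - s') ^ 2)) / (2 * ε) - (L * kf δ (‖x - y‖ ^ 2) + c * √((t - s) ^ 2 + δ ^ 2) + g * (t + t ^ 2))
      ≤ c ^ 2 * ε / 2 + (c + g) ^ 2 / (4 * g) := by
  intro x t y s x' t' y' s' ht' hs'
  have a1 := hule x' t' ht'
  have a2 := huge y' s' hs'
  have a3 : c * (t' - t) ≤ (t - t') ^ 2 / (2 * ε) + c ^ 2 * ε / 2 := by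
    have : (t - t') ^ 2 / (2 * ε) + c ^ 2 * ε / 2 - c * (t' - t) = (t' - t - c * ε) ^ 2 / (2 * ε) := by field_simp; ring
    have : 0 ≤ (t' - t - c * ε) ^ 2 / (2 * ε) := by positivity
    linarith
  have a4 : (c * t - g * (t + t ^ 2)) ≤ (c + g) ^ 2 / (4 * g) := by
    have b1 : (c - g) ^ 2 / (4 * g) - (c * t - g * (t + t ^ 2)) = (2 * g * t - (c - g)) ^ 2 / (4 * g) := by field_simp; ring
    have b2 : 0 ≤ (2 * g * t - (c - g)) ^ 2 / (4 * g) := by positivity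
    have b3 : (c - g) ^ 2 / (4 * g) ≤ (c + g) ^ 2 / (4 * g) := by gcongr ?_ / _; nlinarith [mul_nonneg hc hg.le]
    linarith
  have a5 : 0 ≤ L * kf δ (‖x - y‖ ^ 2) := mul_nonneg hL.le (kf_nonneg _ _)
  have a6 : 0 ≤ c * √((t - s) ^ 2 + δ ^ 2) := by positivity
  have a7 : (t - t') ^ 2 / (2 * ε) ≤ (‖x - x'‖ ^ 2 + (t - t') ^ 2 + (‖y - y'‖ ^ 2 + (s - s') ^ 2)) / (2 * ε) := by
    gcongr; nlinarith [sq_nonneg ‖x - x'‖, sq_nonneg ‖y - y'‖, sq_nonneg (s - s')]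
  linarith

lemma est {c g ε L a b Q k S t t' s m1 κ r : ℝ} (hc : 0 ≤ c) (hg : 0 < g) (hε : 0 < ε) (hε1 : ε ≤ 1) (hL : 0 < L)
    (ha : a ≤ c * t') (hb : 0 ≤ b) (hQ : (t - t') ^ 2 / (2 * ε) ≤ Q) (hr : 0 ≤ r) (hk : r ≤ k) (hS : c * |t - s| ≤ S)
    (hm : 0 < m1) (hκ : κ ≤ m1 / 2) (h : m1 - κ ≤ a - b - Q - (L * k + S + g * (t + t ^ 2))) :
    |t| ≤ 1 + (c ^ 2 / 2 + c + g) / g ∧ r ≤ (c ^ 2 / 2 + (c + g) * (1 + (c ^ 2 / 2 + c + g) / g)) / L ∧ m1 / 2 ≤ a - b - (c * |t - s| + g * t) := by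
  have hQ0 : 0 ≤ (t - t') ^ 2 / (2 * ε) := by positivity
  have hS0 : 0 ≤ c * |t - s| := by positivity
  have hLr : L * r ≤ L * k := by gcongr
  have hLr0 : 0 ≤ L * r := by positivity
  have a3 : c * (t' - t) ≤ (t - t') ^ 2 / (2 * ε) + c ^ 2 * ε / 2 := by
    have : (t - t') ^ 2 / (2 * ε) + c ^ 2 * ε / 2 - c * (t' - t) = (t' - t - c * ε) ^ 2 / (2 * ε) := by field_simp; ring
    have : 0 ≤ (t' - t - c * ε) ^ 2 / (2 * ε) := by positivity
    linarith
  have a4 : c ^ 2 * ε / 2 ≤ c ^ 2 / 2 := by nlinarith [sq_nonneg c]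
  have a5 : c * t ≤ c * |t| := by gcongr; exact le_abs_self t
  have a6 : g * (-t) ≤ g * |t| := by gcongr; exact neg_le_abs t
  have main : L * r + g * |t| ^ 2 ≤ c ^ 2 / 2 + (c + g) * |t| := by rw [sq_abs]; linarith
  have hT : |t| ≤ 1 + (c ^ 2 / 2 + c + g) / g := by
    by_cases h1 : |t| ≤ 1
    · have : 0 ≤ (c ^ 2 / 2 + c + g) / g := by positivity
      linarith
    · push Not at h1
      have : |t| ≤ (c ^ 2 / 2 + c + g) / g := by
        rw [le_div_iff₀ hg]
        have h2 : g * |t| ^ 2 ≤ (c ^ 2 / 2 + c + g) * |t| := by nlinarith [sq_nonneg c]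
        have h3 : |t| * (|t| * g) ≤ |t| * (c ^ 2 / 2 + c + g) := by linarith
        exact le_of_mul_le_mul_left h3 (by linarith)
      linarith
  refine ⟨hT, ?_, ?_⟩
  · rw [le_div_iff₀ hL]
    have : (c + g) * |t| ≤ (c + g) * (1 + (c ^ 2 / 2 + c + g) / g) := by gcongr
    have : 0 ≤ g * |t| ^ 2 := by positivity
    linarith
  · have : 0 ≤ g * t ^ 2 := by positivity
    linarith

set_option maxHeartbeats 1000000 in
lemma lip1 (hsub : ParabSubsol f univ u) (hsuper : ParabSupersol f univ u)
    (hucont : ContinuousOn (fun p : (EuclideanSpace ℝ (Fin n)) × ℝ => u p.1 p.2) (univ ×ˢ Ici 0)) (hn : 1 ≤ n)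
    {c : ℝ} (hc : 0 ≤ c) (hule : ∀ x t, 0 ≤ t → u x t ≤ c * t) (huge : ∀ x t, 0 ≤ t → 0 ≤ u x t) (hinit : ∀ x, u x 0 = 0)
    {K L : ℝ} (hK : 0 ≤ K) (hfK : ∀ x y, |f x - f y| ≤ K * ‖x - y‖) (hf0 : ∀ x, 0 ≤ f x)
    (hL : 0 < L) (hL1 : c ≤ L / 2) (hL2 : 2 * c + n * K ≤ L / 2) {δ g r2 : ℝ} (hδ : 0 < δ) (hg : 0 < g)
    (hr2' : (2 * c / n + K) * r2 + c / n ^ 2 * r2 ^ 2 ≤ g / 8) (hδr : δ ≤ r2)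
    (x1 y1 : (EuclideanSpace ℝ (Fin n))) (t1 s1 : ℝ) (ht1 : 0 ≤ t1) (hs1 : 0 ≤ s1) :
    u x1 t1 - u y1 s1 ≤ L * kf δ (‖x1 - y1‖ ^ 2) + c * √((t1 - s1) ^ 2 + δ ^ 2) + g * (t1 + t1 ^ 2) := by
  by_contra hcon
  push Not at hcon
  set m1 := u x1 t1 - u y1 s1 - (L * kf δ (‖x1 - y1‖ ^ 2) + c * √((t1 - s1) ^ 2 + δ ^ 2) + g * (t1 + t1 ^ 2)) with hm1
  have hm1p : 0 < m1 := by linarith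
  have hn0 : (0:ℝ) < n := by exact_mod_cast (by omega : 0 < n)
  -- parameters
  set T0 := 1 + (c ^ 2 / 2 + c + g) / g with hT0
  have hT0p : 0 < T0 := by positivity
  set R0 := (c ^ 2 / 2 + (c + g) * T0) / L with hR0
  have hR0p : 0 ≤ R0 := by positivity
  obtain ⟨r1, hr1, hr1'⟩ : ∃ r1 : ℝ, 0 < r1 ∧ 6 * n * L * r1 ^ 2 / δ ^ 3 + K * r1 ≤ g / 8 := by
    exact par_r1 hn0 hL hδ hK hg
  set m := L * (r1 ^ 3 / ((R0 ^ 2 + δ ^ 2) * (R0 + δ))) with hm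
  have hm0 : 0 < m := by positivity
  have hCb : 0 ≤ Cb n L δ R0 m := by unfold Cb; positivity
  obtain ⟨κ, hκ, k1, k2, k3, k4, k5, k6⟩ : ∃ κ : ℝ, 0 < κ ∧ κ ≤ m / 4 ∧ (16 * n + 2) * κ ≤ g / 16 ∧ κ * Cb n L δ R0 m ≤ g / 16 ∧ κ ≤ 1 ∧ κ ≤ m1 / 2 ∧ κ ≤ g / 16 := by
    exact par_k hm0 hn0 hg hCb hm1p
  set Cp := L + c + g * (1 + 2 * T0) + 1 with hCp
  have hCp0 : 0 < Cp := by positivity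
  obtain ⟨ε, hε, ep1, ep2, ep3, ep4⟩ : ∃ ε : ℝ, 0 < ε ∧ ε ≤ 1 ∧ ε * Cp ≤ 1 / 16 ∧ (2 * c + g) * (ε * Cp) ≤ m1 / 4 ∧ 2 * K * (ε * Cp) ≤ g / 16 := by
    exact par_e hCp0 hc hg hm1p hK
  -- apply doubling
  have hd := dbl hsub hsuper hucont hc hule huge
    (Ψ := fun x t y s => L * kf δ (‖x - y‖ ^ 2) + c * √((t - s) ^ 2 + δ ^ 2) + g * (t + t ^ 2))
    (by unfold kf qf; fun_prop)
    (fun x t y s => (L * kp δ ‖x - y‖) • (x - y)) (fun x t y s => c * (t - s) / √((t - s) ^ 2 + δ ^ 2) + g * (1 + 2 * t))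
    (fun x t y s => -((L * kp δ ‖x - y‖) • (x - y))) (fun x t y s => -(c * (t - s) / √((t - s) ^ 2 + δ ^ 2)))
    (by
      exact psi_expand hL hc hδ hg)
    hε (c ^ 2 * ε / 2 + (c + g) ^ 2 / (4 * g))
    (by
      exact psi_M hL hc hg hε hule huge)
    ht1 hs1 (x1 := x1) (y1 := y1) hκ
  obtain ⟨x, t, y, s, x', t', y', s', ex, et, ey, es, X, Y, ht', hs', hex, het, hey, hes, hval, hx', htt', hy', hss', hX, hY, ⟨ρ, hρ, hmat⟩, hs1', hs2'⟩ := hd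
  have hκm1 : u x1 t1 - u y1 s1 - (L * kf δ (‖x1 - y1‖ ^ 2) + c * √((t1 - s1) ^ 2 + δ ^ 2) + g * (t1 + t1 ^ 2)) - κ = m1 - κ := rfl
  rw [hκm1] at hval
  clear_value m1
  have hSge : c * |t - s| ≤ c * √((t - s) ^ 2 + δ ^ 2) := by
    gcongr; exact Real.abs_le_sqrt (by nlinarith only [sq_nonneg δ])
  obtain ⟨q1, q2, q3⟩ := est hc hg hε ep1 hL (hule x' t' ht') (huge y' s' hs')
    (Q := (‖x - x'‖ ^ 2 + (t - t') ^ 2 + (‖y - y'‖ ^ 2 + (s - s') ^ 2)) / (2 * ε))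
    (by gcongr; nlinarith only [sq_nonneg ‖x - x'‖, sq_nonneg ‖y - y'‖, sq_nonneg (s - s')])
    (norm_nonneg (x - y)) (kf_ge δ ‖x - y‖) hSge hm1p k5 hval
  rw [← hT0] at q1 q2
  rw [← hR0] at q2
  have hCm : κ * Cb n L δ R0 m ≤ g / 16 := k3
  clear_value T0
  set hh := c * (t - s) / √((t - s) ^ 2 + δ ^ 2) with hhh
  have hhb : |hh| ≤ c := h_bound hc hδ (t - s)
  clear_value hh
  clear hCm hcon hval
  have hP : ‖(L * kp δ ‖x - y‖) • (x - y)‖ ≤ L := by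
    rw [norm_smul, Real.norm_eq_abs, abs_of_nonneg (mul_nonneg hL.le (kp_nonneg _ _)), mul_assoc]
    have := mul_le_mul_of_nonneg_left (kpr_le hδ (norm_nonneg (x - y))) hL.le
    rwa [mul_one] at this
  have hgT : 0 ≤ g * (1 + 2 * T0) := by positivity
  have dx : ‖x' - x‖ ≤ ε * Cp := by
    rw [hx', norm_smul, Real.norm_eq_abs, abs_of_pos hε]
    refine mul_le_mul_of_nonneg_left ((norm_add_le _ _).trans ?_) hε.le
    linarith only [hP, hex, k4, hCp, hgT, hc]
  have dy : ‖y' - y‖ ≤ ε * Cp := by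
    rw [hy', norm_smul, Real.norm_eq_abs, abs_of_pos hε]
    refine mul_le_mul_of_nonneg_left ((norm_add_le _ _).trans ?_) hε.le
    rw [norm_neg]
    linarith only [hP, hey, k4, hCp, hgT, hc]
  have dt : |t' - t| ≤ ε * Cp := by
    rw [htt', abs_mul, abs_of_pos hε]
    refine mul_le_mul_of_nonneg_left ((abs_add_le _ _).trans ?_) hε.le
    have : |hh + g * (1 + 2 * t)| ≤ c + g * (1 + 2 * T0) := by
      refine (abs_add_le _ _).trans (add_le_add hhb ?_)
      rw [abs_mul, abs_of_pos hg]
      refine mul_le_mul_of_nonneg_left ((abs_add_le _ _).trans ?_) hg.le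
      rw [abs_mul, abs_one, abs_of_pos (by norm_num : (0:ℝ) < 2)]
      linarith only [q1]
    linarith only [this, het, k4, hCp, hL]
  have ds : |s' - s| ≤ ε * Cp := by
    rw [hss', abs_mul, abs_of_pos hε]
    refine mul_le_mul_of_nonneg_left ((abs_add_le _ _).trans ?_) hε.le
    rw [abs_neg]
    linarith only [hhb, hes, k4, hCp, hgT, hL]
  set w := ε * Cp with hw
  clear_value w
  have hw0 : 0 ≤ w := (abs_nonneg _).trans ds
  have dt' := abs_le.1 dt
  have ds' := abs_le.1 ds
  have htge : -w ≤ t := by linarith only [dt'.2, ht']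
  have hgt : -(g * w) ≤ g * t := by
    have := mul_le_mul_of_nonneg_left htge hg.le
    linarith only [this]
  have hcw : 0 ≤ c * w := by positivity
  have hcts : 0 ≤ c * |t - s| := by positivity
  have htpos : 0 < t' := by
    rcases ht'.lt_or_eq with h | h
    · exact h
    · exfalso
      have h1 := huge y' s' hs'
      rw [← h, hinit] at q3
      linarith only [q3, h1, hgt, ep3, hcw, hcts, hm1p]
  have hspos : 0 < s' := by
    rcases hs'.lt_or_eq with h | h
    · exact h
    · exfalso
      have h1 := hule x' t' ht'
      rw [← h, hinit] at q3
      have h2 : t' ≤ |t - s| + 2 * w := by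
        have := le_abs_self (t - s)
        linarith only [this, dt'.2, ds'.1, h]
      have h3 := mul_le_mul_of_nonneg_left h2 hc
      linarith only [q3, h1, h3, hgt, ep3, hm1p]
  obtain ⟨η1, hη1, hp1, hi1⟩ := hs1' htpos
  obtain ⟨η2, hη2, hp2, hi2⟩ := hs2' hspos
  have hpe : -(-((L * kp δ ‖x - y‖) • (x - y)) + ey) = (L * kp δ ‖x - y‖) • (x - y) + (-ey) := by abel
  rw [hpe] at hp2 hi2
  rw [trProj_neg] at hi2
  have het' := abs_le.1 het
  have hes' := abs_le.1 hes
  have hhb' := abs_le.1 hhb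
  refine core hn (θ1 := hh + g * (1 + 2 * t) + et) (θ2 := -(-hh + es)) (F1 := f x') (F2 := f y')
    (D := x - y) hL hδ hg hc hK rfl q2 hX hY ?_ hex (by rwa [norm_neg]) hη1 hη2 hp1 hp2 ?_ ?_ hi1 ?_ (hf0 y') ?_ hr1 hr1' hm hκ k1 k2 hr2' hδr hL1 hL2 k3
  · refine mat_scale hL hδ hρ ?_
    intro a b hab
    refine (hmat a b hab).trans ?_
    have h1 := kf_expand hδ (x - y) (a - b)
    have e1 : x + a - (y + b) = x - y + (a - b) := by abel
    rw [e1, inner_neg_left, inner_smul_left, inner_smul_left, conj_trivial]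
    have h1' := mul_le_mul_of_nonneg_left h1 hL.le
    have e3 : ⟪x - y, a - b⟫ = ⟪x - y, a⟫ - ⟪x - y, b⟫ := inner_sub_right _ _ _
    rw [e3] at h1' ⊢
    linarith only [h1']
  · have h3 : g * w ≤ g * (1 / 16) := by gcongr
    linarith only [h3, hgt, het'.1, hes'.1, k6, hg]
  · linarith only [hhb'.2, hes'.1]
  · linarith only [hi2]
  · have h1 := (le_abs_self _).trans (hfK x' y')
    have h2 : ‖x' - y'‖ ≤ ‖x - y‖ + 2 * w := by
      have e1 : x' - y' = (x' - x) + (x - y) - (y' - y) := by abel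
      rw [e1]
      refine (norm_sub_le _ _).trans ?_
      have := norm_add_le (x' - x) (x - y)
      linarith only [this, dx, dy]
    have h3 := mul_le_mul_of_nonneg_left h2 hK
    linarith only [h1, h3, ep4]

lemma lip (hsub : ParabSubsol f univ u) (hsuper : ParabSupersol f univ u)
    (hucont : ContinuousOn (fun p : (EuclideanSpace ℝ (Fin n)) × ℝ => u p.1 p.2) (univ ×ˢ Ici 0)) (hn : 1 ≤ n)
    {c : ℝ} (hc : 0 ≤ c) (hule : ∀ x t, 0 ≤ t → u x t ≤ c * t) (huge : ∀ x t, 0 ≤ t → 0 ≤ u x t) (hinit : ∀ x, u x 0 = 0)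
    {K L : ℝ} (hK : 0 ≤ K) (hfK : ∀ x y, |f x - f y| ≤ K * ‖x - y‖) (hf0 : ∀ x, 0 ≤ f x)
    (hL : 0 < L) (hL1 : c ≤ L / 2) (hL2 : 2 * c + n * K ≤ L / 2)
    (x y : (EuclideanSpace ℝ (Fin n))) (t s : ℝ) (ht : 0 ≤ t) (hs : 0 ≤ s) : u x t - u y s ≤ L * ‖x - y‖ + c * |t - s| := by
  have hn0 : (0:ℝ) < n := by exact_mod_cast (by omega : 0 < n)
  have key : ∀ g : ℝ, 0 < g → u x t - u y s ≤ L * ‖x - y‖ + c * |t - s| + g * (L + c + (t + t ^ 2)) := by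
    intro g hg
    set A := 2 * c / n + K + c / n ^ 2 + 1 with hA
    have hA0 : 0 < A := by positivity
    set r2 := min 1 (g / (8 * A)) with hr2
    have hr0 : 0 < r2 := by positivity
    have h1 : r2 ≤ 1 := min_le_left _ _
    have h2 : r2 ≤ g / (8 * A) := min_le_right _ _
    rw [le_div_iff₀ (by positivity)] at h2
    have h3 : r2 ^ 2 ≤ r2 := by nlinarith only [hr0, h1]
    have h4 : (2 * c / n + K) * r2 + c / n ^ 2 * r2 ^ 2 ≤ g / 8 := by
      calc _ ≤ (2 * c / n + K) * r2 + c / n ^ 2 * r2 := by gcongr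
        _ ≤ A * r2 := by rw [hA]; linarith only [hr0]
        _ ≤ _ := by linarith only [h2]
    set δ := min g r2 with hδ
    have hδ0 : 0 < δ := by positivity
    have hδg : δ ≤ g := min_le_left _ _
    have h5 := lip1 hsub hsuper hucont hn hc hule huge hinit hK hfK hf0 hL hL1 hL2 hδ0 hg h4 (min_le_right _ _) x y t s ht hs
    have h6 := mul_le_mul_of_nonneg_left ((kf_le hδ0 (norm_nonneg (x - y))).trans (add_le_add_right hδg _)) hL.le
    have h7 : √((t - s) ^ 2 + δ ^ 2) ≤ |t - s| + g := by
      refine Real.sqrt_le_iff.2 ⟨by positivity, ?_⟩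
      have : δ ^ 2 ≤ g ^ 2 := by gcongr
      have h8 : 0 ≤ |t - s| * g := by positivity
      have h9 := sq_abs (t - s)
      nlinarith only [this, h8, h9]
    have h8 := mul_le_mul_of_nonneg_left h7 hc
    linarith only [h5, h6, h8]
  refine le_of_forall_pos_le_add fun e he => ?_
  have hB : 0 < L + c + (t + t ^ 2) := by positivity
  have := key (e / (L + c + (t + t ^ 2))) (by positivity)
  rwa [div_mul_cancel₀ _ hB.ne'] at this
end Lip
end VS

open Set Filter Topology
open scoped RealInnerProductSpace
set_option linter.unusedSectionVars false
namespace VS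
section Stab
variable {n : ℕ}

lemma stab_pts {W : (EuclideanSpace ℝ (Fin n)) → ℝ → ℝ} {v φ : (EuclideanSpace ℝ (Fin n)) → ℝ} {x0 : (EuclideanSpace ℝ (Fin n))} {ρ : ℝ} (hρ : 0 < ρ)
    (hW : TendstoUniformlyOn (fun t x => W x t) v atTop (Metric.closedBall x0 ρ))
    (hcont : ContinuousOn (fun p : (EuclideanSpace ℝ (Fin n)) × ℝ => W p.1 p.2) (univ ×ˢ Ici 0)) (hφ : Continuous φ)
    (hmax : ∀ x ∈ Metric.closedBall x0 ρ, v x - φ x ≤ v x0 - φ x0) {e : ℝ} (he : 0 < e) :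
    ∃ (x : (EuclideanSpace ℝ (Fin n))) (t T : ℝ), 0 < t ∧ ‖x - x0‖ < e ∧ |t - T| < e ∧
      IsLocalMax (fun p : (EuclideanSpace ℝ (Fin n)) × ℝ => W p.1 p.2 - (φ p.1 + (‖p.1 - x0‖ ^ 2) ^ 2 + (p.2 - T) ^ 2)) (x, t) := by
  obtain ⟨d, hd, hde, hdρ, hd1⟩ : ∃ d : ℝ, 0 < d ∧ d ≤ e ∧ d ≤ ρ ∧ d ≤ 1 :=
    ⟨min e (min ρ 1), by positivity, min_le_left _ _, (min_le_right _ _).trans (min_le_left _ _),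
      (min_le_right _ _).trans (min_le_right _ _)⟩
  have hδ : 0 < (d ^ 2) ^ 2 / 4 := by positivity
  obtain ⟨T0, hT0⟩ := eventually_atTop.1 (Metric.tendstoUniformlyOn_iff.1 hW _ hδ)
  obtain ⟨T, hT1, hT2⟩ : ∃ T : ℝ, 2 ≤ T ∧ T0 ≤ T - 1 := ⟨max 2 (T0 + 1), le_max_left _ _, by
    linarith [le_max_right 2 (T0 + 1)]⟩
  have hT : ∀ t, T - 1 ≤ t → ∀ x ∈ Metric.closedBall x0 ρ, |v x - W x t| < (d ^ 2) ^ 2 / 4 :=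
    fun t ht x hx => by simpa [Real.dist_eq] using hT0 t (hT2.trans ht) x hx
  have hx0 : x0 ∈ Metric.closedBall x0 ρ := Metric.mem_closedBall_self hρ.le
  have hcpt : IsCompact (Metric.closedBall x0 ρ ×ˢ Icc (T - 1) (T + 1)) :=
    (isCompact_closedBall x0 ρ).prod isCompact_Icc
  have hc2 : ContinuousOn (fun p : (EuclideanSpace ℝ (Fin n)) × ℝ => W p.1 p.2 - (φ p.1 + (‖p.1 - x0‖ ^ 2) ^ 2 + (p.2 - T) ^ 2))
      (Metric.closedBall x0 ρ ×ˢ Icc (T - 1) (T + 1)) := by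
    refine (hcont.mono ?_).sub (Continuous.continuousOn ?_)
    · rintro ⟨x, t⟩ ⟨_, ht⟩
      exact ⟨mem_univ _, by have := ht.1; simp only [mem_Ici] at *; linarith⟩
    · exact ((hφ.comp continuous_fst).add (((continuous_fst.sub continuous_const).norm.pow 2).pow 2)).add
        ((continuous_snd.sub continuous_const).pow 2)
  obtain ⟨⟨x, t⟩, ⟨hx, ht⟩, hm⟩ := hcpt.exists_isMaxOn ⟨(x0, T), hx0, by constructor <;> simp⟩ hc2
  have h1 := hm (show (x0, T) ∈ Metric.closedBall x0 ρ ×ˢ Icc (T - 1) (T + 1) from ⟨hx0, by constructor <;> simp⟩)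
  simp only [mem_setOf_eq, sub_self, norm_zero] at h1
  have hx' : x ∈ Metric.closedBall x0 ρ := hx
  have ht' : T - 1 ≤ t := ht.1
  have h2 := abs_lt.1 (hT t ht' x hx')
  have h3 := abs_lt.1 (hT T (by linarith) x0 hx0)
  have h4 := hmax x hx'
  have h5 : (‖x - x0‖ ^ 2) ^ 2 + (t - T) ^ 2 < (d ^ 2) ^ 2 := by linarith only [h1, h2.1, h2.2, h3.1, h3.2, h4]
  have h6 : ‖x - x0‖ < d := by
    by_contra hcon
    push Not at hcon
    have : (d ^ 2) ^ 2 ≤ (‖x - x0‖ ^ 2) ^ 2 := by gcongr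
    linarith only [this, h5, sq_nonneg (t - T)]
  have h7 : |t - T| < d := by
    refine abs_lt_of_sq_lt_sq ?_ hd.le
    have : (d ^ 2) ^ 2 ≤ d ^ 2 := by
      have : d ^ 2 ≤ 1 := by nlinarith only [hd, hd1]
      nlinarith only [this, sq_nonneg d]
    linarith only [this, h5, sq_nonneg (‖x - x0‖ ^ 2)]
  refine ⟨x, t, T, by linarith, h6.trans_le hde, h7.trans_le hde, ?_⟩
  refine hm.isLocalMax ?_
  refine prod_mem_nhds ?_ ?_
  · refine Metric.closedBall_mem_nhds_of_mem ?_
    rw [mem_ball_iff_norm]; linarith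
  · have := abs_lt.1 h7
    exact Icc_mem_nhds (by linarith) (by linarith)

lemma clmTrace_cont : Continuous (fun A : (EuclideanSpace ℝ (Fin n)) →L[ℝ] (EuclideanSpace ℝ (Fin n)) => clmTrace A) := by
  have : (fun A : (EuclideanSpace ℝ (Fin n)) →L[ℝ] (EuclideanSpace ℝ (Fin n)) => clmTrace A) = fun A => ∑ i, ⟪(EuclideanSpace.basisFun (Fin n) ℝ) i, A ((EuclideanSpace.basisFun (Fin n) ℝ) i)⟫ := by
    funext A
    unfold clmTrace
    rw [LinearMap.trace_eq_sum_inner _ (EuclideanSpace.basisFun (Fin n) ℝ)]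
    rfl
  rw [this]
  exact continuous_finsetSum _ fun i _ => continuous_const.inner (continuous_id.clm_apply continuous_const)

lemma lim_lem {P : (EuclideanSpace ℝ (Fin n)) → (EuclideanSpace ℝ (Fin n))} {H : (EuclideanSpace ℝ (Fin n)) → (EuclideanSpace ℝ (Fin n)) →L[ℝ] (EuclideanSpace ℝ (Fin n))} {f : (EuclideanSpace ℝ (Fin n)) → ℝ} (hP : Continuous P) (hH : Continuous H) (hf : Continuous f)
    {x0 : (EuclideanSpace ℝ (Fin n))} {c ς : ℝ}
    (h : ∀ e : ℝ, 0 < e → ∃ (x : (EuclideanSpace ℝ (Fin n))) (τ : ℝ) (η : (EuclideanSpace ℝ (Fin n))), ‖x - x0‖ < e ∧ |τ| < e ∧ ‖η‖ ≤ 1 ∧ ‖P x‖ • η = P x ∧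
      ς * (c + 2 * ς * τ - (trProj (H x) η + ‖P x‖) - f x) ≤ 0) :
    ∃ η : (EuclideanSpace ℝ (Fin n)), ‖η‖ ≤ 1 ∧ ‖P x0‖ • η = P x0 ∧ ς * (c - (trProj (H x0) η + ‖P x0‖) - f x0) ≤ 0 := by
  have h' := fun k : ℕ => h (1 / ((k : ℝ) + 1)) (by positivity)
  choose x τ η h1 h2 h3 h4 h5 using h'
  have hz := tendsto_one_div_add_atTop_nhds_zero_nat (𝕜 := ℝ)
  have hx : Tendsto x atTop (𝓝 x0) := by
    rw [tendsto_iff_norm_sub_tendsto_zero]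
    exact squeeze_zero (fun _ => norm_nonneg _) (fun k => (h1 k).le) hz
  have hτ : Tendsto τ atTop (𝓝 0) := squeeze_zero_norm (fun k => (h2 k).le) hz
  obtain ⟨η0, hη0, ns, hns, hlim⟩ := (isCompact_closedBall (0 : (EuclideanSpace ℝ (Fin n))) 1).tendsto_subseq
    (fun k => (by simpa using h3 k : η k ∈ Metric.closedBall (0 : (EuclideanSpace ℝ (Fin n))) 1))
  have hx := hx.comp hns.tendsto_atTop
  have hτ := hτ.comp hns.tendsto_atTop
  have hPx := (hP.tendsto x0).comp hx
  have hHx := (hH.tendsto x0).comp hx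
  have hfx := (hf.tendsto x0).comp hx
  have htr : Tendsto (fun k => trProj (H (x (ns k))) (η (ns k))) atTop (𝓝 (trProj (H x0) η0)) :=
    ((clmTrace_cont.tendsto (H x0)).comp hHx).sub (((isBoundedBilinearMap_apply.continuous.tendsto (H x0, η0)).comp (hHx.prodMk_nhds hlim)).inner hlim)
  refine ⟨η0, by simpa using hη0, ?_, ?_⟩
  · refine tendsto_nhds_unique (hPx.norm.smul hlim) ?_
    exact hPx.congr fun k => (h4 (ns k)).symm
  · have hg := ((((hτ.const_mul (2 * ς)).const_add c).sub (htr.add hPx.norm)).sub hfx).const_mul ς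
    rw [mul_zero, add_zero] at hg
    exact le_of_tendsto hg (Eventually.of_forall fun k => h5 (ns k))

lemma gradient_cd {φ : (EuclideanSpace ℝ (Fin n)) → ℝ} (hφ : ContDiff ℝ 2 φ) : ContDiff ℝ 1 (gradient φ) := by
  have h := hφ.fderiv_right (m := 1) (by norm_num)
  exact (InnerProductSpace.toDual ℝ (EuclideanSpace ℝ (Fin n))).symm.contDiff.comp h

lemma quart_cd (x0 : (EuclideanSpace ℝ (Fin n))) (ς : ℝ) : ContDiff ℝ 1 (fun y : (EuclideanSpace ℝ (Fin n)) => (4 * ς * ‖y - x0‖ ^ 2) • (y - x0)) := by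
  have h1 : ContDiff ℝ 1 (fun q : (EuclideanSpace ℝ (Fin n)) => q - x0) := contDiff_id.sub contDiff_const
  exact (contDiff_const.mul (h1.norm_sq ℝ)).smul h1

lemma quart_fd (x0 : (EuclideanSpace ℝ (Fin n))) (ς : ℝ) : HasFDerivAt (fun y : (EuclideanSpace ℝ (Fin n)) => (4 * ς * ‖y - x0‖ ^ 2) • (y - x0)) (0 : (EuclideanSpace ℝ (Fin n)) →L[ℝ] (EuclideanSpace ℝ (Fin n))) x0 := by
  have h0 : HasFDerivAt (fun y : (EuclideanSpace ℝ (Fin n)) => y - x0) (ContinuousLinearMap.id ℝ (EuclideanSpace ℝ (Fin n))) x0 :=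
    (hasFDerivAt_id x0).sub_const x0
  have h1 := (h0.norm_sq.const_mul (4 * ς)).smul h0
  refine h1.congr_fderiv ?_
  ext1 w
  simp

lemma test_grad {φ : (EuclideanSpace ℝ (Fin n)) → ℝ} (hφ : ContDiff ℝ 2 φ) (x0 : (EuclideanSpace ℝ (Fin n))) (ς k : ℝ) (y : (EuclideanSpace ℝ (Fin n))) :
    gradient (fun y : (EuclideanSpace ℝ (Fin n)) => φ y + ς * (‖y - x0‖ ^ 2) ^ 2 + k) y = gradient φ y + (4 * ς * ‖y - x0‖ ^ 2) • (y - x0) := by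
  apply HasGradientAt.gradient
  have h0 : HasFDerivAt (fun y : (EuclideanSpace ℝ (Fin n)) => y - x0) (ContinuousLinearMap.id ℝ (EuclideanSpace ℝ (Fin n))) y :=
    (hasFDerivAt_id y).sub_const x0
  have h1 := (h0.norm_sq.pow 2).const_mul ς
  have h2 := ((hφ.differentiable (by norm_num) y).hasGradientAt).hasFDerivAt
  rw [hasGradientAt_iff_hasFDerivAt]
  refine ((h2.add h1).add_const k).congr_fderiv ?_
  ext1 w
  simp [inner_add_left, inner_smul_left]
  ring

lemma test_facts {φ : (EuclideanSpace ℝ (Fin n)) → ℝ} (hφ : ContDiff ℝ 2 φ) (x0 : (EuclideanSpace ℝ (Fin n))) (c ς T : ℝ) (x : (EuclideanSpace ℝ (Fin n))) (t : ℝ) :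
    sGrad (fun y t => φ y + ς * (‖y - x0‖ ^ 2) ^ 2 + (c * t + ς * (t - T) ^ 2)) x t = gradient φ x + (4 * ς * ‖x - x0‖ ^ 2) • (x - x0) ∧
    sHess (fun y t => φ y + ς * (‖y - x0‖ ^ 2) ^ 2 + (c * t + ς * (t - T) ^ 2)) x t
      = fderiv ℝ (fun y => gradient φ y + (4 * ς * ‖y - x0‖ ^ 2) • (y - x0)) x ∧
    tDeriv (fun y t => φ y + ς * (‖y - x0‖ ^ 2) ^ 2 + (c * t + ς * (t - T) ^ 2)) x t = c + 2 * ς * (t - T) := by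
  refine ⟨test_grad hφ x0 ς _ x, ?_, ?_⟩
  · unfold sHess
    congr 1
    funext y
    exact test_grad hφ x0 ς _ y
  · unfold tDeriv
    have h0 : HasDerivAt (fun s : ℝ => s - T) 1 t := (hasDerivAt_id t).sub_const T
    have h1 := (((hasDerivAt_id t).const_mul c).add ((h0.pow 2).const_mul ς)).const_add (φ x + ς * (‖x - x0‖ ^ 2) ^ 2)
    refine h1.deriv.trans ?_
    norm_num
    ring

lemma test_cd {φ : (EuclideanSpace ℝ (Fin n)) → ℝ} (hφ : ContDiff ℝ 2 φ) (x0 : (EuclideanSpace ℝ (Fin n))) (c ς T : ℝ) :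
    ContDiff ℝ 2 (fun q : (EuclideanSpace ℝ (Fin n)) × ℝ => φ q.1 + ς * (‖q.1 - x0‖ ^ 2) ^ 2 + (c * q.2 + ς * (q.2 - T) ^ 2)) := by
  have h1 : ContDiff ℝ 2 (fun q : (EuclideanSpace ℝ (Fin n)) × ℝ => q.1 - x0) := contDiff_fst.sub contDiff_const
  have h2 : ContDiff ℝ 2 (fun q : (EuclideanSpace ℝ (Fin n)) × ℝ => q.2 - T) := contDiff_snd.sub contDiff_const
  exact ((hφ.comp contDiff_fst).add (contDiff_const.mul ((h1.norm_sq ℝ).pow 2))).add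
    ((contDiff_const.mul contDiff_snd).add (contDiff_const.mul (h2.pow 2)))

variable {f : (EuclideanSpace ℝ (Fin n)) → ℝ} {u : (EuclideanSpace ℝ (Fin n)) → ℝ → ℝ} {v φ : (EuclideanSpace ℝ (Fin n)) → ℝ} {c : ℝ}

lemma stab_core (hφ : ContDiff ℝ 2 φ) (hf : Continuous f) (x0 : (EuclideanSpace ℝ (Fin n))) (ς : ℝ)
    (h : ∀ e : ℝ, 0 < e → ∃ (x : (EuclideanSpace ℝ (Fin n))) (τ : ℝ) (η : (EuclideanSpace ℝ (Fin n))), ‖x - x0‖ < e ∧ |τ| < e ∧ ‖η‖ ≤ 1 ∧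
      ‖gradient φ x + (4 * ς * ‖x - x0‖ ^ 2) • (x - x0)‖ • η = gradient φ x + (4 * ς * ‖x - x0‖ ^ 2) • (x - x0) ∧
      ς * (c + 2 * ς * τ - (trProj (fderiv ℝ (fun y => gradient φ y + (4 * ς * ‖y - x0‖ ^ 2) • (y - x0)) x) η +
        ‖gradient φ x + (4 * ς * ‖x - x0‖ ^ 2) • (x - x0)‖) - f x) ≤ 0) :
    (gradient φ x0 ≠ 0 → ς * (c - (trProj (hess φ x0) (‖gradient φ x0‖⁻¹ • gradient φ x0) + ‖gradient φ x0‖) - f x0) ≤ 0) ∧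
    (gradient φ x0 = 0 → ∃ η : (EuclideanSpace ℝ (Fin n)), ‖η‖ ≤ 1 ∧ ς * (c - trProj (hess φ x0) η - f x0) ≤ 0) := by
  have hcd : ContDiff ℝ 1 (fun y => gradient φ y + (4 * ς * ‖y - x0‖ ^ 2) • (y - x0)) :=
    (gradient_cd hφ).add (quart_cd x0 ς)
  obtain ⟨η, h1, h2, h3⟩ := lim_lem (P := fun y => gradient φ y + (4 * ς * ‖y - x0‖ ^ 2) • (y - x0))
    (H := fderiv ℝ (fun y => gradient φ y + (4 * ς * ‖y - x0‖ ^ 2) • (y - x0))) hcd.continuous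
    (hcd.continuous_fderiv (by norm_num)) hf h
  have hH : fderiv ℝ (fun y => gradient φ y + (4 * ς * ‖y - x0‖ ^ 2) • (y - x0)) x0 = hess φ x0 := by
    have := (((gradient_cd hφ).differentiable (by norm_num) x0).hasFDerivAt.add (quart_fd x0 ς)).fderiv
    rw [add_zero] at this
    exact this
  rw [hH] at h3
  simp only [sub_self, smul_zero, add_zero] at h2 h3
  constructor
  · intro hp
    have : η = ‖gradient φ x0‖⁻¹ • gradient φ x0 := by
      have hne : ‖gradient φ x0‖ ≠ 0 := norm_ne_zero_iff.mpr hp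
      calc η = ‖gradient φ x0‖⁻¹ • (‖gradient φ x0‖ • η) := by rw [smul_smul, inv_mul_cancel₀ hne, one_smul]
        _ = _ := by rw [h2]
    rw [← this]; exact h3
  · intro hp
    refine ⟨η, h1, ?_⟩
    rw [hp, norm_zero, add_zero] at h3
    exact h3

lemma stab_sub (hsub : ParabSubsol f univ u) (hf : Continuous f)
    (hucont : ContinuousOn (fun p : (EuclideanSpace ℝ (Fin n)) × ℝ => u p.1 p.2) (univ ×ˢ Ici 0))
    (hlim : ∀ K : Set (EuclideanSpace ℝ (Fin n)), IsCompact K → TendstoUniformlyOn (fun t x => u x t - c * t) v atTop K) :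
    StatSubsol (fun x => f x - c) univ v := by
  intro φ hφ x0 _ hm
  obtain ⟨ρ, hρ, hb⟩ := Metric.nhds_basis_closedBall.eventually_iff.1 hm
  have key := stab_core (c := c) hφ hf x0 1 ?_
  · refine ⟨fun hp => ?_, fun hp => ?_⟩
    · have := key.1 hp; simp only [one_mul] at this ⊢; linarith
    · obtain ⟨η, h1, h2⟩ := key.2 hp
      exact ⟨η, h1, by simp only [one_mul] at h2 ⊢; linarith⟩
  intro e he
  obtain ⟨x, t, T, ht, hx, htT, hloc⟩ := stab_pts (W := fun x t => u x t - c * t) hρ (hlim _ (isCompact_closedBall x0 ρ))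
    (hucont.sub (continuous_const.mul continuous_snd).continuousOn) hφ.continuous (fun x hx => hb hx) he
  have hloc' : IsLocalMax (fun p : (EuclideanSpace ℝ (Fin n)) × ℝ => u p.1 p.2 - (φ p.1 + 1 * (‖p.1 - x0‖ ^ 2) ^ 2 + (c * p.2 + 1 * (p.2 - T) ^ 2))) (x, t) := by
    convert hloc using 2
    ring
  have h := hsub (fun y t => φ y + 1 * (‖y - x0‖ ^ 2) ^ 2 + (c * t + 1 * (t - T) ^ 2)) (test_cd hφ x0 c 1 T) x (mem_univ _) t ht hloc'
  obtain ⟨e1, e2, e3⟩ := test_facts hφ x0 c 1 T x t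
  rw [e1, e2, e3] at h
  by_cases hp : gradient φ x + (4 * 1 * ‖x - x0‖ ^ 2) • (x - x0) = 0
  · obtain ⟨η, h2, h3⟩ := h.2 hp
    refine ⟨x, t - T, η, hx, htT, h2, by rw [hp]; simp, ?_⟩
    rw [hp, norm_zero]; linarith
  · refine ⟨x, t - T, _, hx, htT, (norm_inv_smul_aux hp).1, (norm_inv_smul_aux hp).2, ?_⟩
    have := h.1 hp
    linarith

lemma stab_super (hsuper : ParabSupersol f univ u) (hf : Continuous f)
    (hucont : ContinuousOn (fun p : (EuclideanSpace ℝ (Fin n)) × ℝ => u p.1 p.2) (univ ×ˢ Ici 0))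
    (hlim : ∀ K : Set (EuclideanSpace ℝ (Fin n)), IsCompact K → TendstoUniformlyOn (fun t x => u x t - c * t) v atTop K) :
    StatSupersol (fun x => f x - c) univ v := by
  intro φ hφ x0 _ hm
  obtain ⟨ρ, hρ, hb⟩ := Metric.nhds_basis_closedBall.eventually_iff.1 hm
  have key := stab_core (c := c) hφ hf x0 (-1) ?_
  · refine ⟨fun hp => ?_, fun hp => ?_⟩
    · have := key.1 hp; simp only [neg_mul, one_mul] at this ⊢; linarith
    · obtain ⟨η, h1, h2⟩ := key.2 hp
      exact ⟨η, h1, by simp only [neg_mul, one_mul] at h2 ⊢; linarith⟩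
  intro e he
  obtain ⟨x, t, T, ht, hx, htT, hloc⟩ := stab_pts (W := fun x t => -(u x t - c * t)) (v := fun x => -v x)
    (φ := fun x => -φ x) hρ ((hlim _ (isCompact_closedBall x0 ρ)).neg)
    (hucont.sub (continuous_const.mul continuous_snd).continuousOn).neg hφ.continuous.neg
    (fun x hx => by have := hb hx; linarith) he
  have hloc' : IsLocalMin (fun p : (EuclideanSpace ℝ (Fin n)) × ℝ => u p.1 p.2 - (φ p.1 + (-1) * (‖p.1 - x0‖ ^ 2) ^ 2 + (c * p.2 + (-1) * (p.2 - T) ^ 2))) (x, t) := by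
    filter_upwards [hloc] with p hp
    linarith only [hp]
  have h := hsuper (fun y t => φ y + (-1) * (‖y - x0‖ ^ 2) ^ 2 + (c * t + (-1) * (t - T) ^ 2)) (test_cd hφ x0 c (-1) T) x (mem_univ _) t ht hloc'
  obtain ⟨e1, e2, e3⟩ := test_facts hφ x0 c (-1) T x t
  rw [e1, e2, e3] at h
  by_cases hp : gradient φ x + (4 * (-1) * ‖x - x0‖ ^ 2) • (x - x0) = 0
  · obtain ⟨η, h2, h3⟩ := h.2 hp
    refine ⟨x, t - T, η, hx, htT, h2, by rw [hp]; simp, ?_⟩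
    rw [hp, norm_zero]; linarith
  · refine ⟨x, t - T, _, hx, htT, (norm_inv_smul_aux hp).1, (norm_inv_smul_aux hp).2, ?_⟩
    have := h.1 hp
    linarith

lemma limit_exists {L : ℝ} (hL : 0 ≤ L) {x0 : (EuclideanSpace ℝ (Fin n))}
    (hucont : ContinuousOn (fun p : (EuclideanSpace ℝ (Fin n)) × ℝ => u p.1 p.2) (univ ×ˢ Ici 0))
    (hlip : ∀ x y t s, 0 ≤ t → 0 ≤ s → u x t - u y s ≤ L * ‖x - y‖ + c * |t - s|)
    (hcen : ∀ t, 0 ≤ t → c * t ≤ u x0 t) :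
    ∃ v : (EuclideanSpace ℝ (Fin n)) → ℝ, Continuous v ∧
      ∀ K : Set (EuclideanSpace ℝ (Fin n)), IsCompact K → TendstoUniformlyOn (fun t x => u x t - c * t) v atTop K := by
  have hm : ∀ t : ℝ, 0 ≤ max t 0 := fun t => le_max_right _ _
  have hanti : ∀ x, Antitone (fun t : ℝ => u x (max t 0) - c * max t 0) := by
    intro x a b hab
    have h1 := hlip x x (max b 0) (max a 0) (hm _) (hm _)
    have h2 : max a 0 ≤ max b 0 := max_le_max_right 0 hab
    rw [abs_of_nonneg (sub_nonneg.2 h2), sub_self, norm_zero, mul_zero] at h1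
    show u x (max b 0) - c * max b 0 ≤ u x (max a 0) - c * max a 0
    linarith
  have hbdd : ∀ x, BddBelow (range fun t : ℝ => u x (max t 0) - c * max t 0) := by
    intro x
    refine ⟨-(L * ‖x0 - x‖), ?_⟩
    rintro _ ⟨t, rfl⟩
    have h1 := hlip x0 x (max t 0) (max t 0) (hm _) (hm _)
    rw [sub_self, abs_zero, mul_zero] at h1
    have h2 := hcen _ (hm t)
    show -(L * ‖x0 - x‖) ≤ u x (max t 0) - c * max t 0
    linarith
  have hlim := fun x => tendsto_atTop_ciInf (hanti x) (hbdd x)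
  set v : (EuclideanSpace ℝ (Fin n)) → ℝ := fun x => ⨅ t : ℝ, (u x (max t 0) - c * max t 0) with hv
  have hvl : ∀ x y, v x - v y ≤ L * ‖x - y‖ := by
    intro x y
    refine le_of_tendsto ((hlim x).sub (hlim y)) (Eventually.of_forall fun t => ?_)
    have h1 := hlip x y (max t 0) (max t 0) (hm _) (hm _)
    rw [sub_self, abs_zero, mul_zero] at h1
    linarith
  have hvc : Continuous v := by
    refine (LipschitzWith.of_le_add_mul ⟨L, hL⟩ fun x y => ?_).continuous
    have := hvl x y
    rw [dist_eq_norm]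
    show v x ≤ v y + L * ‖x - y‖
    linarith
  refine ⟨v, hvc, fun K hK => ?_⟩
  have hD := Antitone.tendstoUniformlyOn_of_forall_tendsto (F := fun (t : ℝ) x => u x (max t 0) - c * max t 0) (f := v) hK
    (fun t => ?_) (fun x _ => hanti x) hvc.continuousOn (fun x _ => hlim x)
  · refine hD.congr ?_
    filter_upwards [eventually_ge_atTop (0 : ℝ)] with t ht
    intro x _
    simp only [max_eq_left ht]
  · refine ContinuousOn.sub ?_ continuousOn_const
    exact hucont.comp (f := fun x : (EuclideanSpace ℝ (Fin n)) => (x, max t 0)) (by fun_prop) (fun x _ => ⟨mem_univ _, hm t⟩)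
end Stab
end VS

/-- Under (A3)–(A5) (as in Statement 13), the solution `u` of the
level-set flow with zero initial data satisfies `u(x,t) - c·t → v_∞(x)` locally
uniformly as `t → ∞`, where `v_∞` is a viscosity solution of the stationary problem
`-(div(Dv/|Dv|)+1)|Dv| = f(x) - c` in `ℝⁿ`. -/
theorem stmt_14 (n : ℕ) (hn : 2 ≤ n)
    (f : EuclideanSpace ℝ (Fin n) → ℝ) (hfC1 : ContDiff ℝ 1 f)
    (hfnonneg : ∀ x, 0 ≤ f x) (hfne : ∃ x, f x ≠ 0) (hfsupp : HasCompactSupport f)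
    (c : ℝ) (hc : IsGreatest (Set.range f) c) (hcpos : 0 < c)
    (U : Set (EuclideanSpace ℝ (Fin n))) (hU : U = {x : EuclideanSpace ℝ (Fin n) | f x = c})
    (hball : ∃ x₀ : EuclideanSpace ℝ (Fin n), Metric.closedBall x₀ ((n : ℝ) - 1) ⊆ U)
    (ι : Type) (hι : Nonempty ι)
    (Eset : ι → Set (EuclideanSpace ℝ (Fin n))) (ρ : ι → EuclideanSpace ℝ (Fin n) → ℝ)
    (hUE : U = ⋃ i : ι, Eset i)
    (hρC2 : ∀ i : ι, ContDiff ℝ 2 (ρ i))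
    (hE : ∀ i : ι, Eset i = {x : EuclideanSpace ℝ (Fin n) | ρ i x ≤ 0})
    (hEint : ∀ i : ι, (interior (Eset i)).Nonempty)
    (hEfront : ∀ i : ι, frontier (Eset i) = {x : EuclideanSpace ℝ (Fin n) | ρ i x = 0})
    (hρgrad : ∀ i : ι, ∀ x : EuclideanSpace ℝ (Fin n), ρ i x = 0 → gradient (ρ i) x ≠ 0)
    (hκ : ∀ i : ι, ∀ x : EuclideanSpace ℝ (Fin n), ρ i x = 0 →
      -‖gradient (ρ i) x‖ ≤ trProj (hess (ρ i) x) (‖gradient (ρ i) x‖⁻¹ • gradient (ρ i) x))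
    (u : EuclideanSpace ℝ (Fin n) → ℝ → ℝ)
    (hucont : ContinuousOn (fun p : EuclideanSpace ℝ (Fin n) × ℝ => u p.1 p.2)
      (Set.univ ×ˢ Set.Ici 0))
    (hubuc : ∀ T > (0 : ℝ),
      (∃ M : ℝ, ∀ x : EuclideanSpace ℝ (Fin n), ∀ t ∈ Set.Icc (0 : ℝ) T, |u x t| ≤ M) ∧
      UniformContinuousOn (fun p : EuclideanSpace ℝ (Fin n) × ℝ => u p.1 p.2)
        (Set.univ ×ˢ Set.Icc (0 : ℝ) T))
    (hinit : ∀ x, u x 0 = 0)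
    (hsub : ParabSubsol f Set.univ u) (hsuper : ParabSupersol f Set.univ u) :
    ∃ vinf : EuclideanSpace ℝ (Fin n) → ℝ,
      Continuous vinf ∧
      StatSubsol (fun x => f x - c) Set.univ vinf ∧
      StatSupersol (fun x => f x - c) Set.univ vinf ∧
      ∀ K : Set (EuclideanSpace ℝ (Fin n)), IsCompact K →
        TendstoUniformlyOn (fun t x => u x t - c * t) vinf Filter.atTop K := by
  obtain ⟨C, hC⟩ := hfC1.lipschitzWith_of_hasCompactSupport hfsupp (by norm_num)
  have hfcont := hfC1.continuous
  obtain ⟨x0, hx0⟩ := hball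
  have hfK : ∀ x y, |f x - f y| ≤ ((C : ℝ) + 1) * ‖x - y‖ := by
    intro x y
    have h1 := hC.dist_le_mul x y
    rw [Real.dist_eq, dist_eq_norm] at h1
    have h2 := norm_nonneg (x - y)
    linarith only [h1, h2]
  have hKp : (0 : ℝ) < (C : ℝ) + 1 := by positivity
  have hfc : ∀ x, f x ≤ c := fun x => hc.2 ⟨x, rfl⟩
  have hub : ∀ T > (0 : ℝ), ∃ M : ℝ, ∀ x : EuclideanSpace ℝ (Fin n), ∀ t ∈ Set.Icc (0 : ℝ) T, |u x t| ≤ M :=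
    fun T hT => (hubuc T hT).1
  have hule := VS.u_le hsub hucont hub hinit hcpos.le hfc
  have huge := VS.u_ge hsuper hucont hub hinit hfnonneg
  have hb : ∀ x, ‖x - x0‖ ≤ (n : ℝ) - 1 → f x = c := by
    intro x hx
    have : x ∈ U := hx0 (by rwa [mem_closedBall_iff_norm])
    rw [hU] at this
    exact this
  have hcen := VS.u_center hsuper hn hucont hub hinit hcpos.le hKp hfK hb
  have hnK : 0 ≤ (n : ℝ) * ((C : ℝ) + 1) := by positivity
  have hlip := fun x y t s ht hs => VS.lip (L := 2 * (2 * c + (n : ℝ) * ((C : ℝ) + 1))) hsub hsuper hucont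
    (by omega) hcpos.le hule huge hinit hKp.le hfK hfnonneg (by linarith only [hcpos, hnK]) (by linarith only [hcpos, hnK])
    (by linarith only [hcpos, hnK]) x y t s ht hs
  obtain ⟨v, hv, hlim⟩ := VS.limit_exists (L := 2 * (2 * c + (n : ℝ) * ((C : ℝ) + 1))) (by linarith only [hcpos, hnK])
    hucont hlip hcen
  exact ⟨v, hv, VS.stab_sub hsub hfcont hucont hlim, VS.stab_super hsuper hfcont hucont hlim, hlim⟩
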